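/- Let d ≥ 3 be an integer. For a general pencil of plane curves of degree d over ℂ, the number of members of the pencil that admit a hyperflex line (i.e., a line having contact order at least 4 with the curve at some point) is exactly 6(d−3)(3d−2). -/

import Mathlib

noncomputable section

/-- The restriction of the form `F` to the line through `[v]` and `[w]`,
parametrized by `t ↦ v + t • w`, as a polynomial in `t`. -/
def linePoly (F : MvPolynomial (Fin 3) ℂ) (v w : Fin 3 → ℂ) : Polynomial ℂ :=
  MvPolynomial.aeval (fun i => Polynomial.C (v i) + Polynomial.X * Polynomial.C (w i)) F

/-- The line through the two (projectively distinct) points `[v]`, `[w]` has contact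
order at least `m` with the curve `{F = 0}` at the point `[v]`. -/
def ContactLE (F : MvPolynomial (Fin 3) ℂ) (v w : Fin 3 → ℂ) (m : ℕ) : Prop :=
  (Polynomial.X : Polynomial ℂ) ^ m ∣ linePoly F v w

/-- The member of the pencil spanned by `F` and `G` corresponding to `c ∈ ℙ¹`. -/
def pencilMember (F G : MvPolynomial (Fin 3) ℂ) (c : Projectivization ℂ (Fin 2 → ℂ)) :
    MvPolynomial (Fin 3) ℂ :=
  c.rep 0 • F + c.rep 1 • G

/-- The coefficient vector of a pair of forms. -/
def coeffs2 (F G : MvPolynomial (Fin 3) ℂ) : (Fin 3 →₀ ℕ) ⊕ (Fin 3 →₀ ℕ) → ℂ :=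
  Sum.elim (fun m => MvPolynomial.coeff m F) (fun m => MvPolynomial.coeff m G)

/-- The set of members of the pencil spanned by `F` and `G` admitting a hyperflex line,
i.e. a line with contact order at least 4 at some point. -/
def hyperflexMembers (F G : MvPolynomial (Fin 3) ℂ) : Set (Projectivization ℂ (Fin 2 → ℂ)) :=
  {c | ∃ v w : Fin 3 → ℂ, LinearIndependent ℂ ![v, w] ∧ ContactLE (pencilMember F G c) v w 4}

set_option linter.all false

namespace HF
open MvPolynomial

/-! ### Algebra -/

theorem alg_dep {D ι : Type} [CommRing D] [IsDomain D] [Algebra ℂ D] [Fintype ι] (Y : ι → D) (N : ℕ)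
    (hN : Algebra.trdeg ℂ D = N) (h : N < Fintype.card ι) :
    ∃ Q : MvPolynomial ι ℂ, Q ≠ 0 ∧ aeval Y Q = 0 := by
  by_contra hc
  push Not at hc
  have hi : AlgebraicIndependent ℂ Y := by
    rw [algebraicIndependent_iff]
    intro p hp
    by_contra h0
    exact hc p h0 hp
  have := hi.cardinalMk_le_trdeg
  rw [hN, Cardinal.mk_fintype] at this
  have := Nat.cast_le.mp this
  omega

theorem alg_sep {D ι : Type} [CommRing D] [IsDomain D] [Algebra ℂ D] [Fintype ι] (Y : ι → D) (N : ℕ)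
    (hN : Algebra.trdeg ℂ D = N) (h : N = Fintype.card ι) (y : D) :
    ∃ Q : MvPolynomial ι ℂ, Q ≠ 0 ∧ (aeval Y Q = 0 ∨ ∃ p : Polynomial (MvPolynomial ι ℂ),
      p.eval₂ (aeval Y : MvPolynomial ι ℂ →ₐ[ℂ] D).toRingHom y = 0 ∧
      p.derivative.eval₂ (aeval Y : MvPolynomial ι ℂ →ₐ[ℂ] D).toRingHom y ∣ aeval Y Q) := by
  by_cases hi : AlgebraicIndependent ℂ Y
  swap
  · rw [algebraicIndependent_iff] at hi
    push Not at hi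
    obtain ⟨p, hp, h0⟩ := hi
    exact ⟨p, h0, Or.inl hp⟩
  have htb : IsTranscendenceBasis ℂ Y := by
    apply hi.isTranscendenceBasis_of_trdeg_le_of_finite
    rw [hN, h, Cardinal.mk_fintype]
  letI : Algebra (MvPolynomial ι ℂ) D := (aeval Y : MvPolynomial ι ℂ →ₐ[ℂ] D).toRingHom.toAlgebra
  have hmap : ∀ q, algebraMap (MvPolynomial ι ℂ) D q = aeval Y q := fun q => rfl
  have hinj : Function.Injective (algebraMap (MvPolynomial ι ℂ) D) := hi
  have halg : ∀ z : D, IsAlgebraic (MvPolynomial ι ℂ) z := by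
    intro z
    have h1 := htb.isAlgebraic.1 z
    obtain ⟨q, hq, hq0⟩ := h1
    -- transport along the equivalence
    let e := hi.aevalEquiv
    refine ⟨q.map (e.symm : _ →+* MvPolynomial ι ℂ), ?_, ?_⟩
    · intro h0
      apply hq
      exact (Polynomial.map_injective _ e.symm.injective) (by simpa using h0)
    · rw [Polynomial.aeval_def, Polynomial.eval₂_map]
      rw [Polynomial.aeval_def] at hq0
      convert hq0 using 2
      ext1 w
      obtain ⟨w', rfl⟩ := e.surjective w
      simp only [RingHom.comp_apply, hmap]
      have : (e.symm : _ →+* MvPolynomial ι ℂ) (e w') = w' := e.symm_apply_apply w'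
      rw [this]
      exact (hi.algebraMap_aevalEquiv w').symm
  have hex : ∃ m, ∃ p : Polynomial (MvPolynomial ι ℂ), p ≠ 0 ∧ Polynomial.aeval y p = 0 ∧ p.natDegree = m := by
    obtain ⟨p, hp, hp0⟩ := halg y
    exact ⟨_, p, hp, hp0, rfl⟩
  classical
  obtain ⟨p, hp, hp0, hpm⟩ := Nat.find_spec hex
  have hmin := fun m hm => Nat.find_min hex (m := m) hm
  rw [← hpm] at hmin
  have hdeg : 0 < p.natDegree := by
    by_contra h0
    have h0 : p.natDegree = 0 := by omega
    rw [Polynomial.eq_C_of_natDegree_eq_zero h0] at hp0 hp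
    rw [Polynomial.aeval_C] at hp0
    have := hinj (hp0.trans (map_zero _).symm)
    rw [this] at hp
    simp at hp
  have hd : Polynomial.aeval y p.derivative ≠ 0 := by
    intro h0
    refine hmin _ (Polynomial.natDegree_derivative_lt (by omega)) ⟨p.derivative, ?_, h0, rfl⟩
    intro h1
    have := Polynomial.derivative_eq_zero.1 h1
    omega
  obtain ⟨r, hr, hdvd⟩ := (halg (Polynomial.aeval y p.derivative)).exists_nonzero_dvd
    (mem_nonZeroDivisors_of_ne_zero hd)
  exact ⟨r, hr, Or.inr ⟨p, hp0, hdvd⟩⟩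

/-- evaluation point for the variables that are kept -/
def evA {ι C : Type} {n k : ℕ} (b : Fin n → ι) (v : ι → C) (x : Fin k → C) :
    {i // i ∉ Set.range b} ⊕ Fin k → C := Sum.elim (fun a => v a.1) x

/-- polynomials in the variables that are kept -/
abbrev PA {ι : Type} {n : ℕ} (b : Fin n → ι) (k : ℕ) := MvPolynomial ({i // i ∉ Set.range b} ⊕ Fin k) ℂ

section core
variable {ι : Type} [Fintype ι] {n k : ℕ} (b : Fin n → ι)
  (T : Matrix (Fin n) (Fin n) (MvPolynomial ({i // i ∉ Set.range b} ⊕ Fin k) ℂ))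
  (R : Fin n → MvPolynomial ({i // i ∉ Set.range b} ⊕ Fin k) ℂ)

abbrev Loc := Localization.Away T.det

def beta : Fin n → Loc b T :=
  - ((T.map (algebraMap (PA b k) (Loc b T)))⁻¹.mulVec (fun e => algebraMap (PA b k) (Loc b T) (R e)))

open Classical in
def Yv (i : ι) : Loc b T :=
  if h : i ∈ Set.range b then beta b T R h.choose
  else algebraMap (PA b k) (Loc b T) (X (Sum.inl ⟨i, h⟩))

theorem ev_exists (hb : Function.Injective b) {C : Type} [CommRing C] [Algebra ℂ C] (v : ι → C) (x : Fin k → C)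
    (hE : ∀ e, aeval (evA b v x) (R e) + ∑ j, v (b j) * aeval (evA b v x) (T e j) = 0)
    (hu : IsUnit (aeval (evA b v x) T.det)) :
    ∃ ev : Loc b T →+* C, (∀ i, ev (Yv b T R i) = v i) ∧
      (∀ z : ℂ, ev (algebraMap ℂ _ z) = algebraMap ℂ C z) ∧
      (∀ l, ev (algebraMap (PA b k) (Loc b T) (X (Sum.inr l))) = x l) := by
  let g : MvPolynomial ({i // i ∉ Set.range b} ⊕ Fin k) ℂ →+* C := (aeval (evA b v x)).toRingHom
  have hg : ∀ q, g q = aeval (evA b v x) q := fun _ => rfl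
  let ev : Loc b T →+* C := IsLocalization.Away.lift (S := Loc b T) T.det (g := g) hu
  have hev : ∀ q, ev (algebraMap _ _ q) = aeval (evA b v x) q := fun q =>
    IsLocalization.Away.lift_eq T.det hu q
  have hTu : IsUnit (T.map (algebraMap (PA b k) (Loc b T))).det := by
    rw [← RingHom.mapMatrix_apply, ← RingHom.map_det]
    exact IsLocalization.Away.algebraMap_isUnit (S := Loc b T) T.det
  have hTb : (T.map (algebraMap (PA b k) (Loc b T))).mulVec (beta b T R) =
      fun e => - algebraMap (PA b k) (Loc b T) (R e) := by
    rw [beta, Matrix.mulVec_neg, Matrix.mulVec_mulVec, Matrix.mul_nonsing_inv _ hTu, Matrix.one_mulVec]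
    rfl
  have hbv : (fun j => ev (beta b T R j)) = fun j => v (b j) := by
    have h1 : (T.map g).mulVec (fun j => ev (beta b T R j)) = (T.map g).mulVec (fun j => v (b j)) := by
      ext e
      have := congrArg ev (congrFun hTb e)
      simp only [Matrix.mulVec, dotProduct, map_sum, map_mul, map_neg, Matrix.map_apply, hev] at this ⊢
      have h2 := hE e
      have h3 : ∑ j, v (b j) * aeval (evA b v x) (T e j) = ∑ j, aeval (evA b v x) (T e j) * v (b j) :=
        Finset.sum_congr rfl fun j _ => mul_comm _ _
      rw [h3] at h2
      simp only [hg]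
      rw [this]
      linear_combination -h2
    have h2 : IsUnit (T.map g).det := by
      rw [← RingHom.mapMatrix_apply, ← RingHom.map_det]
      exact hu
    exact Matrix.mulVec_injective_of_isUnit ((Matrix.isUnit_iff_isUnit_det _).2 h2) h1
  refine ⟨ev, ?_, ?_, ?_⟩
  · intro i
    unfold Yv
    split_ifs with h
    · rw [congrFun hbv h.choose, h.choose_spec]
    · rw [hev]; simp [evA]
  · intro z
    rw [IsScalarTower.algebraMap_apply ℂ (MvPolynomial ({i // i ∉ Set.range b} ⊕ Fin k) ℂ), hev]
    simp
  · intro l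
    rw [hev]; simp [evA]

theorem ev_aeval {ι D C : Type} [CommRing D] [Algebra ℂ D] [CommRing C] [Algebra ℂ C] (ev : D →+* C)
    (Y : ι → D) (v : ι → C) (h : ∀ i, ev (Y i) = v i) (hc : ∀ z : ℂ, ev (algebraMap ℂ _ z) = algebraMap ℂ C z)
    (Q : MvPolynomial ι ℂ) : ev (aeval Y Q) = aeval v Q := by
  induction Q using MvPolynomial.induction_on with
  | C a => simp [hc]
  | add p q hp hq => simp [hp, hq]
  | mul_X p i hp => simp [hp, h]

theorem loc_trdeg (hb : Function.Injective b) (hT : T.det ≠ 0) :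
    Algebra.trdeg ℂ (Loc b T) = ((Fintype.card ι - n + k : ℕ) : Cardinal) := by
  classical
  haveI : IsDomain (Loc b T) := IsLocalization.isDomain_localization
    (Submonoid.powers_le.2 (mem_nonZeroDivisors_of_ne_zero hT))
  haveI : FaithfulSMul (MvPolynomial ({i // i ∉ Set.range b} ⊕ Fin k) ℂ) (Loc b T) :=
    (faithfulSMul_iff_algebraMap_injective _ _).2 (IsLocalization.injective (Loc b T)
     (Submonoid.powers_le.2 (mem_nonZeroDivisors_of_ne_zero hT)))
  have h1 := trdeg_add_eq ℂ (MvPolynomial ({i // i ∉ Set.range b} ⊕ Fin k) ℂ) (A := Loc b T)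
  haveI : Algebra.IsAlgebraic (MvPolynomial ({i // i ∉ Set.range b} ⊕ Fin k) ℂ) (Loc b T) :=
    IsLocalization.isAlgebraic _ (Submonoid.powers T.det)
  rw [trdeg_eq_zero (R := PA b k) (A := Loc b T), add_zero] at h1
  rw [← h1, MvPolynomial.trdeg_of_isDomain, Cardinal.mk_fintype]
  simp only [Fintype.card_sum, Fintype.card_fin, Cardinal.lift_natCast, Nat.cast_inj,
    Nat.add_right_cancel_iff]
  rw [Fintype.card_subtype_compl]
  congr 1
  have := Fintype.card_congr (Equiv.ofInjective b hb)
  rw [Fintype.card_fin] at this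
  refine Eq.trans ?_ this.symm
  convert rfl

theorem core_empty (hb : Function.Injective b) (hk : k < n) : ∃ Q : MvPolynomial ι ℂ, Q ≠ 0 ∧
    ∀ (v : ι → ℂ) (x : Fin k → ℂ), eval v Q ≠ 0 → eval (evA b v x) T.det ≠ 0 →
      ¬ ∀ e, eval (evA b v x) (R e) + ∑ j, v (b j) * eval (evA b v x) (T e j) = 0 := by
  by_cases hT : T.det = 0
  · exact ⟨1, one_ne_zero, fun v x _ h => by simp [hT] at h⟩
  haveI : IsDomain (Loc b T) := IsLocalization.isDomain_localization
    (Submonoid.powers_le.2 (mem_nonZeroDivisors_of_ne_zero hT))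
  have hn : n ≤ Fintype.card ι := by simpa using Fintype.card_le_of_injective b hb
  obtain ⟨Q, hQ, hQ0⟩ := alg_dep (Yv b T R) _ (loc_trdeg b T hb hT) (by omega)
  refine ⟨Q, hQ, fun v x hv hd hE => ?_⟩
  obtain ⟨ev, h1, h2, -⟩ := ev_exists b T R hb v x hE (isUnit_iff_ne_zero.2 hd)
  have := ev_aeval ev _ v h1 h2 Q
  rw [hQ0, map_zero] at this
  exact hv this.symm

/-- the dual number `a + ε b` -/
abbrev dn (a b : ℂ) : DualNumber ℂ := TrivSqZeroExt.inl a + TrivSqZeroExt.inr b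

theorem core_nondeg (hb : Function.Injective b) (hk : k = n) : ∃ Q : MvPolynomial ι ℂ, Q ≠ 0 ∧
    ∀ (v : ι → ℂ) (x ξ : Fin k → ℂ), eval v Q ≠ 0 → eval (evA b v x) T.det ≠ 0 →
      (∀ e, aeval (evA b (fun i => dn (v i) 0) (fun l => dn (x l) (ξ l))) (R e) +
        ∑ j, dn (v (b j)) 0 * aeval (evA b (fun i => dn (v i) 0) (fun l => dn (x l) (ξ l))) (T e j) = 0) →
      ξ = 0 := by
  by_cases hT : T.det = 0
  · exact ⟨1, one_ne_zero, fun v x _ _ h => by simp [hT] at h⟩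
  haveI : IsDomain (Loc b T) := IsLocalization.isDomain_localization
    (Submonoid.powers_le.2 (mem_nonZeroDivisors_of_ne_zero hT))
  have hn : n ≤ Fintype.card ι := by simpa using Fintype.card_le_of_injective b hb
  have key := fun l : Fin k => alg_sep (Yv b T R) _ (loc_trdeg b T hb hT) (by omega)
    (algebraMap (PA b k) (Loc b T) (X (Sum.inr l)))
  choose Q hQ hQ2 using key
  refine ⟨∏ l, Q l, Finset.prod_ne_zero_iff.2 fun l _ => hQ l, fun v x ξ hv hd hE => ?_⟩
  rw [map_prod, Finset.prod_ne_zero_iff] at hv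
  have hunit : IsUnit (aeval (evA b (fun i => dn (v i) 0) (fun l => dn (x l) (ξ l))) T.det) := by
    rw [TrivSqZeroExt.isUnit_iff_isUnit_fst, isUnit_iff_ne_zero]
    have := ev_aeval (TrivSqZeroExt.fstHom ℂ ℂ ℂ).toRingHom
      (evA b (fun i => dn (v i) 0) (fun l => dn (x l) (ξ l))) (evA b v x)
      (by rintro (i | i) <;> simp [evA]) (by intro z; simp) T.det
    change TrivSqZeroExt.fst _ = _ at this
    rw [this]
    exact hd
  obtain ⟨ev, h1, h2, h3⟩ := ev_exists b T R hb _ _ hE hunit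
  have h4 : ∀ P : MvPolynomial ι ℂ, ev (aeval (Yv b T R) P) = TrivSqZeroExt.inl (eval v P) := by
    intro P
    rw [ev_aeval ev _ _ h1 h2 P]
    rw [ev_aeval (TrivSqZeroExt.inlHom ℂ ℂ : ℂ →+* DualNumber ℂ) v _ (by intro i; simp) (by intro z; simp; rfl) P |>.symm]
    rfl
  ext l
  have hvl := hv l (Finset.mem_univ _)
  rcases hQ2 l with h | ⟨p, hp0, hpd⟩
  · have := h4 (Q l)
    rw [h, map_zero] at this
    have := congrArg TrivSqZeroExt.fst this
    simp at this
    exact absurd this.symm hvl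
  · have hcomp : ∀ q : Polynomial (MvPolynomial ι ℂ),
        ev (q.eval₂ (aeval (Yv b T R) : MvPolynomial ι ℂ →ₐ[ℂ] Loc b T).toRingHom
          (algebraMap (PA b k) (Loc b T) (X (Sum.inr l)))) =
        Polynomial.aeval (dn (x l) (ξ l)) (q.map (eval v)) := by
      intro q
      rw [Polynomial.hom_eval₂, h3, Polynomial.aeval_def, Polynomial.eval₂_map]
      congr 1
      exact RingHom.ext fun w => h4 w
    have e1 := hcomp p
    rw [hp0, map_zero] at e1
    have hy : (TrivSqZeroExt.inr (ξ l) : DualNumber ℂ) ^ 2 = 0 := by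
      rw [pow_two, TrivSqZeroExt.inr_mul_inr]
    have hz : ∀ q : Polynomial ℂ, Polynomial.aeval (TrivSqZeroExt.inl (x l) : DualNumber ℂ) q =
        TrivSqZeroExt.inl (q.eval (x l)) := by
      intro q
      have := Polynomial.aeval_algebraMap_apply (DualNumber ℂ) (x l) q
      rw [Polynomial.coe_aeval_eq_eval] at this
      exact this
    rw [dn, Polynomial.aeval_add_of_sq_eq_zero _ _ _ hy, hz, hz] at e1
    have e2 := congrArg TrivSqZeroExt.snd e1
    simp only [TrivSqZeroExt.snd_zero, TrivSqZeroExt.snd_add, TrivSqZeroExt.snd_inl, zero_add,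
      TrivSqZeroExt.inl_mul_inr, TrivSqZeroExt.snd_inr] at e2
    obtain ⟨r, hr⟩ := hpd
    have e3 := congrArg ev hr
    rw [h4, map_mul, hcomp] at e3
    have e4 := congrArg TrivSqZeroExt.fst e3
    rw [Polynomial.derivative_map] at e2
    rw [dn, Polynomial.aeval_add_of_sq_eq_zero _ _ _ hy, hz, hz] at e4
    simp only [TrivSqZeroExt.fst_inl, TrivSqZeroExt.fst_mul, TrivSqZeroExt.fst_add, TrivSqZeroExt.fst_inr, mul_zero, add_zero] at e4
    have e5 : Polynomial.eval (x l) (Polynomial.map (eval v) (Polynomial.derivative p)) ≠ 0 := by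
      intro h; rw [h, zero_mul] at e4; exact hvl e4
    have : Polynomial.eval (x l) (Polynomial.map (eval v) (Polynomial.derivative p)) * ξ l = 0 := by
      simpa [smul_eq_mul] using e2.symm
    simpa [e5] using this

end core
end HF

namespace HF
open MvPolynomial

/-! ### Polynomial functions -/

/-- polynomial functions -/
def PF {σ : Type} (f : (σ → ℂ) → ℂ) : Prop := ∃ P : MvPolynomial σ ℂ, ∀ x, f x = eval x P

namespace PF
variable {σ τ : Type}
theorem const (c : ℂ) : PF (fun _ : σ → ℂ => c) := ⟨C c, fun x => by simp⟩
theorem var (i : σ) : PF (fun x : σ → ℂ => x i) := ⟨X i, fun x => by simp⟩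
theorem add {f g : (σ → ℂ) → ℂ} (hf : PF f) (hg : PF g) : PF (fun x => f x + g x) := by
  obtain ⟨P, hP⟩ := hf; obtain ⟨Q, hQ⟩ := hg
  exact ⟨P + Q, fun x => by simp [hP, hQ]⟩
theorem mul {f g : (σ → ℂ) → ℂ} (hf : PF f) (hg : PF g) : PF (fun x => f x * g x) := by
  obtain ⟨P, hP⟩ := hf; obtain ⟨Q, hQ⟩ := hg
  exact ⟨P * Q, fun x => by simp [hP, hQ]⟩
theorem neg {f : (σ → ℂ) → ℂ} (hf : PF f) : PF (fun x => - f x) := by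
  obtain ⟨P, hP⟩ := hf
  exact ⟨-P, fun x => by simp [hP]⟩
theorem sub {f g : (σ → ℂ) → ℂ} (hf : PF f) (hg : PF g) : PF (fun x => f x - g x) := by
  obtain ⟨P, hP⟩ := hf; obtain ⟨Q, hQ⟩ := hg
  exact ⟨P - Q, fun x => by simp [hP, hQ]⟩
theorem pow {f : (σ → ℂ) → ℂ} (hf : PF f) (n : ℕ) : PF (fun x => f x ^ n) := by
  obtain ⟨P, hP⟩ := hf
  exact ⟨P ^ n, fun x => by simp [hP]⟩
theorem sum {κ : Type} (s : Finset κ) {f : κ → (σ → ℂ) → ℂ} (hf : ∀ i ∈ s, PF (f i)) :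
    PF (fun x => ∑ i ∈ s, f i x) := by
  classical
  induction s using Finset.induction_on with
  | empty => simpa using const 0
  | insert a s ha ih =>
    simp only [Finset.sum_insert ha]
    exact add (hf a (by simp)) (ih fun i hi => hf i (by simp [hi]))
theorem prod {κ : Type} (s : Finset κ) {f : κ → (σ → ℂ) → ℂ} (hf : ∀ i ∈ s, PF (f i)) :
    PF (fun x => ∏ i ∈ s, f i x) := by
  classical
  induction s using Finset.induction_on with
  | empty => simpa using const 1
  | insert a s ha ih =>
    simp only [Finset.prod_insert ha]
    exact mul (hf a (by simp)) (ih fun i hi => hf i (by simp [hi]))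
theorem comp {f : (σ → ℂ) → ℂ} (hf : PF f) {g : (τ → ℂ) → (σ → ℂ)} (hg : ∀ i, PF (fun y => g y i)) :
    PF (fun y => f (g y)) := by
  obtain ⟨P, hP⟩ := hf
  choose Q hQ using hg
  refine ⟨bind₁ Q P, fun y => ?_⟩
  show f (g y) = _
  rw [hP, ← MvPolynomial.coe_aeval_eq_eval, ← MvPolynomial.coe_aeval_eq_eval]
  simp only [RingHom.coe_coe]
  rw [aeval_bind₁]
  congr 2
  ext i
  exact (hQ i y).trans (by rw [← MvPolynomial.coe_aeval_eq_eval]; rfl)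
theorem contDiff [Fintype σ] {f : (σ → ℂ) → ℂ} (hf : PF f) {n : ℕ∞} : ContDiff ℂ n f := by
  obtain ⟨P, hP⟩ := hf
  rw [show f = fun x => eval x P from funext hP]
  induction P using MvPolynomial.induction_on generalizing f with
  | C a => simpa using contDiff_const
  | add p q hp hq =>
    simp only [map_add]
    exact (hp (fun _ => rfl)).add (hq (fun _ => rfl))
  | mul_X p i hp =>
    simp only [map_mul, eval_X]
    exact (hp (fun _ => rfl)).mul (contDiff_apply ℂ ℂ i)
theorem continuous [Fintype σ] {f : (σ → ℂ) → ℂ} (hf : PF f) : Continuous f :=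
  (hf.contDiff (n := 0)).continuous
end PF

/-- zeroing out the coordinates in `I` -/
def z0 {ι : Type} [DecidableEq ι] (I : Finset ι) (v : ι → ℂ) : ι → ℂ := fun i => if i ∈ I then 0 else v i

/-- polynomial in both groups of variables -/
def PF2 {ι κ : Type} (f : (ι → ℂ) → (κ → ℂ) → ℂ) : Prop :=
  PF (fun y : ι ⊕ κ → ℂ => f (fun i => y (Sum.inl i)) (fun l => y (Sum.inr l)))

/-- affine in the coordinates in `I` -/
def AffOn {ι X : Type} [DecidableEq ι] (I : Finset ι) (g : (ι → ℂ) → X → ℂ) : Prop :=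
  ∀ v x, g v x = g (z0 I v) x + ∑ i ∈ I, v i * (g (z0 I v + Pi.single i 1) x - g (z0 I v) x)

/-- the variations in the coordinates in `I` are independent at `(v,x)` -/
def Surj {ι X : Type} {n : ℕ} (I : Finset ι) (E : Fin n → (ι → ℂ) → X → ℂ) (v : ι → ℂ) (x : X) : Prop :=
  ∀ l : Fin n → ℂ, (∀ u : ι → ℂ, (∀ i, i ∉ I → u i = 0) → ∑ e, l e * (E e (v + u) x - E e v x) = 0) → l = 0

theorem surj_of_tri {ι X : Type} {n : ℕ} {I : Finset ι} {E : Fin n → (ι → ℂ) → X → ℂ} {v : ι → ℂ} {x : X}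
    (h : ∀ e, ∃ u : ι → ℂ, (∀ i, i ∉ I → u i = 0) ∧ (∀ e' < e, E e' (v + u) x = E e' v x) ∧
      E e (v + u) x ≠ E e v x) : Surj I E v x := by
  intro l hl
  by_contra hne
  have hne : (Finset.univ.filter fun e => l e ≠ 0).Nonempty := by
    obtain ⟨e, he⟩ := Function.ne_iff.1 hne
    exact ⟨e, by simpa using he⟩
  obtain ⟨e, he, hmax⟩ := (Finset.univ.filter fun e => l e ≠ 0).exists_max_image id hne
  obtain ⟨u, hu, h1, h2⟩ := h e
  have := hl u hu
  rw [Finset.sum_eq_single e] at this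
  · rcases mul_eq_zero.1 this with h3 | h3
    · simp at he; exact he h3
    · exact h2 (sub_eq_zero.1 h3)
  · intro e' _ hne'
    rcases lt_or_gt_of_ne hne' with h3 | h3
    · rw [h1 e' h3]; simp
    · have : l e' = 0 := by
        by_contra h4
        have := hmax e' (by simpa using h4)
        exact absurd h3 (not_lt.2 this)
      rw [this, zero_mul]
  · simp

theorem exists_cols {κ : Type} {n : ℕ} (I : Finset κ) (M : Fin n → κ → ℂ)
    (h : ∀ l : Fin n → ℂ, (∀ i ∈ I, ∑ e, l e * M e i = 0) → l = 0) :
    ∃ b : Fin n → κ, Function.Injective b ∧ (∀ j, b j ∈ I) ∧ (Matrix.of fun e j => M e (b j)).det ≠ 0 := by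
  let s : Set (Fin n → ℂ) := Set.image (fun i e => M e i) (I : Set κ)
  have hs : Submodule.span ℂ s = ⊤ := by
    by_contra hne
    obtain ⟨f, hf, hle⟩ := Submodule.exists_le_ker_of_lt_top _ (lt_top_iff_ne_top.2 hne)
    apply hf
    have h0 : (fun e => f (Pi.single e 1)) = 0 := by
      apply h
      intro i hi
      have h1 : f (fun e => M e i) = 0 := hle (Submodule.subset_span ⟨i, hi, rfl⟩)
      rw [pi_eq_sum_univ' (fun e => M e i)] at h1
      rw [map_sum] at h1
      rw [← h1]
      refine Finset.sum_congr rfl fun e _ => ?_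
      rw [map_smul, smul_eq_mul, mul_comm]
    apply LinearMap.pi_ext'
    intro e
    ext
    simpa using congrFun h0 e
  obtain ⟨f, hf, hspan, hli⟩ := Submodule.exists_fun_fin_finrank_span_eq ℂ s
  have hn : Module.finrank ℂ (Submodule.span ℂ s) = n := by rw [hs]; simp
  have hg : ∀ m, m = n → ∀ f : Fin m → (Fin n → ℂ), (∀ i, f i ∈ s) → LinearIndependent ℂ f →
      ∃ f : Fin n → (Fin n → ℂ), (∀ i, f i ∈ s) ∧ LinearIndependent ℂ f := by
    rintro m rfl f h1 h2
    exact ⟨f, h1, h2⟩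
  obtain ⟨f, hf, hli⟩ := hg _ hn f hf hli
  choose b hb hbf using hf
  refine ⟨b, ?_, hb, ?_⟩
  · intro i j hij
    apply hli.injective
    rw [← hbf, ← hbf, hij]
  · rw [← isUnit_iff_ne_zero, ← Matrix.isUnit_iff_isUnit_det, ← Matrix.linearIndependent_cols_iff_isUnit]
    have h3 : (Matrix.of fun e j => M e (b j)).col = f := by
      ext j e
      rw [← hbf j]
      rfl
    rw [h3]
    exact hli

section gen
variable {ι : Type} [Fintype ι] [DecidableEq ι] {n k : ℕ} (I : Finset ι)

open Classical in
/-- substitution killing the variables in `I` -/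
def sub0 (b : Fin n → ι) (hb : ∀ j, b j ∈ I) (k : ℕ) : ι ⊕ Fin k → PA b k :=
  Sum.elim (fun i => if h : i ∈ I then 0 else X (Sum.inl ⟨i, by rintro ⟨j, rfl⟩; exact h (hb j)⟩))
    (fun l => X (Sum.inr l))

open Classical in
def sub1 (b : Fin n → ι) (hb : ∀ j, b j ∈ I) (k : ℕ) (i : ι) : ι ⊕ Fin k → PA b k :=
  sub0 I b hb k + Pi.single (Sum.inl i) 1

open Classical in
def Tm (b : Fin n → ι) (hb : ∀ j, b j ∈ I) (P : Fin n → MvPolynomial (ι ⊕ Fin k) ℂ) :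
    Matrix (Fin n) (Fin n) (PA b k) :=
  Matrix.of fun e j => aeval (sub1 I b hb k (b j)) (P e) - aeval (sub0 I b hb k) (P e)

open Classical in
def Rm (b : Fin n → ι) (hb : ∀ j, b j ∈ I) (P : Fin n → MvPolynomial (ι ⊕ Fin k) ℂ) :
    Fin n → PA b k := fun e => aeval (sub0 I b hb k) (P e) +
  ∑ i : {i // i ∉ Set.range b}, if i.1 ∈ I then X (Sum.inl i) * (aeval (sub1 I b hb k i) (P e) - aeval (sub0 I b hb k) (P e)) else 0

variable (E : Fin n → (ι → ℂ) → (Fin k → ℂ) → ℂ) (P : Fin n → MvPolynomial (ι ⊕ Fin k) ℂ)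

theorem eval_sub0 (hP : ∀ e v x, E e v x = eval (Sum.elim v x) (P e)) (b : Fin n → ι) (hb : ∀ j, b j ∈ I) (v : ι → ℂ) (x : Fin k → ℂ) (e : Fin n) :
    eval (evA b v x) (aeval (sub0 I b hb k) (P e)) = E e (z0 I v) x := by
  rw [hP, MvPolynomial.aeval_def, MvPolynomial.eval_eval₂, MvPolynomial.eval, MvPolynomial.coe_eval₂Hom]
  congr 1
  · ext z <;> simp
  · ext i
    rcases i with i | i
    · by_cases h : i ∈ I <;> simp [sub0, z0, h, evA]
    · simp [sub0, evA]

theorem eval_sub1 (hP : ∀ e v x, E e v x = eval (Sum.elim v x) (P e)) (b : Fin n → ι) (hb : ∀ j, b j ∈ I) (v : ι → ℂ) (x : Fin k → ℂ) (e : Fin n) (i : ι) :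
    eval (evA b v x) (aeval (sub1 I b hb k i) (P e)) = E e (z0 I v + Pi.single i 1) x := by
  rw [hP, MvPolynomial.aeval_def, MvPolynomial.eval_eval₂, MvPolynomial.eval, MvPolynomial.coe_eval₂Hom]
  congr 1
  · ext z <;> simp
  · ext i'
    rcases i' with i' | i'
    · by_cases h2 : i' = i
      · subst h2
        by_cases h : i' ∈ I <;> simp [sub1, sub0, z0, h, evA]
      · by_cases h : i' ∈ I <;> simp [sub1, sub0, z0, h, evA, h2, Pi.single_apply]
    · simp [sub1, sub0, evA]

theorem poly_identity (hP : ∀ e v x, E e v x = eval (Sum.elim v x) (P e)) (b : Fin n → ι) (hbi : Function.Injective b) (hb : ∀ j, b j ∈ I) (hA : ∀ e, AffOn I (E e)) (e : Fin n) :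
    P e = rename (Sum.map Subtype.val id) (Rm I b hb P e) +
      ∑ j, X (Sum.inl (b j)) * rename (Sum.map Subtype.val id) (Tm I b hb P e j) := by
  classical
  apply MvPolynomial.funext
  intro y
  have hy : y = Sum.elim (y ∘ Sum.inl) (y ∘ Sum.inr) := by ext i; rcases i with i | i <;> rfl
  generalize y ∘ Sum.inl = v at hy
  generalize y ∘ Sum.inr = x at hy
  subst hy
  have hc : (Sum.elim v x : ι ⊕ Fin k → ℂ) ∘ (Sum.map Subtype.val id : {i // i ∉ Set.range b} ⊕ Fin k → ι ⊕ Fin k)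
      = evA b v x := by
    ext i; rcases i with i | i <;> rfl
  rw [← hP, hA e v x]
  simp only [map_add, map_sum, map_mul, eval_X, eval_rename, hc, Rm, Tm, Matrix.of_apply, map_sub,
    eval_sub0 I E P hP, eval_sub1 I E P hP, Sum.elim_inl, apply_ite (eval (evA b v x)), map_zero]
  rw [add_assoc]
  congr 1
  have h1 : ∀ f : ι → ℂ, ∑ i ∈ I, f i = (∑ i : {i // i ∉ Set.range b}, if i.1 ∈ I then f i else 0) + ∑ j, f (b j) := by
    intro f
    have h2 : ∑ i ∈ I, f i = ∑ i, if i ∈ I then f i else 0 := by simp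
    rw [h2, ← Fintype.sum_subtype_add_sum_subtype (fun i => i ∈ Set.range b), add_comm]
    congr 1
    symm
    have h4 := Fintype.sum_equiv (Equiv.ofInjective b hbi) (fun j => f (b j))
      (fun i => if i.1 ∈ I then f i.1 else 0) (fun j => by simp [hb j])
    rw [h4]
    exact Finset.sum_congr (by ext; simp) fun _ _ => rfl
  rw [h1]
  rfl

theorem aeval_identity (hP : ∀ e v x, E e v x = eval (Sum.elim v x) (P e)) {C : Type} [CommRing C] [Algebra ℂ C] (b : Fin n → ι) (hbi : Function.Injective b)
    (hb : ∀ j, b j ∈ I) (hA : ∀ e, AffOn I (E e)) (e : Fin n) (v : ι → C) (x : Fin k → C) :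
    aeval (Sum.elim v x) (P e) = aeval (evA b v x) (Rm I b hb P e) +
      ∑ j, v (b j) * aeval (evA b v x) (Tm I b hb P e j) := by
  have hc : (Sum.elim v x : ι ⊕ Fin k → C) ∘ (Sum.map Subtype.val id : {i // i ∉ Set.range b} ⊕ Fin k → ι ⊕ Fin k)
      = evA b v x := by
    ext i; rcases i with i | i <;> rfl
  conv_lhs => rw [poly_identity I E P hP b hbi hb hA e]
  simp only [map_add, map_sum, map_mul, aeval_X, aeval_rename, hc, Sum.elim_inl]

theorem surj_cols (hP : ∀ e v x, E e v x = eval (Sum.elim v x) (P e)) (hA : ∀ e, AffOn I (E e)) (v : ι → ℂ) (x : Fin k → ℂ) (hS : Surj I E v x) :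
    ∃ (b : Fin n → ι) (_ : Function.Injective b) (hb : ∀ j, b j ∈ I), eval (evA b v x) (Tm I b hb P).det ≠ 0 := by
  have hz : ∀ u : ι → ℂ, (∀ i, i ∉ I → u i = 0) → z0 I (v + u) = z0 I v := by
    intro u hu; ext i
    by_cases h : i ∈ I <;> simp [z0, h, hu]
  obtain ⟨b, hb, hbI, hd⟩ := exists_cols I (fun e i => E e (z0 I v + Pi.single i 1) x - E e (z0 I v) x) (by
    intro l hl
    apply hS
    intro u hu
    have : ∀ e, E e (v + u) x - E e v x = ∑ i ∈ I, u i * (E e (z0 I v + Pi.single i 1) x - E e (z0 I v) x) := by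
      intro e
      rw [hA e (v + u) x, hA e v x, hz u hu, add_sub_add_left_eq_sub, ← Finset.sum_sub_distrib]
      refine Finset.sum_congr rfl fun i _ => ?_
      simp; ring
    simp only [this, Finset.mul_sum]
    rw [Finset.sum_comm]
    refine Finset.sum_eq_zero fun i hi => ?_
    calc _ = u i * ∑ e, l e * (E e (z0 I v + Pi.single i 1) x - E e (z0 I v) x) := by
          rw [Finset.mul_sum]; refine Finset.sum_congr rfl fun e _ => ?_; ring
      _ = 0 := by rw [hl i hi, mul_zero])
  refine ⟨b, hb, hbI, ?_⟩
  rw [RingHom.map_det]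
  convert hd using 2
  ext e j
  show eval _ (Tm I b hbI P e j) = _
  simp only [Tm, Matrix.of_apply, map_sub, eval_sub0 I E P hP, eval_sub1 I E P hP]

theorem dual_deriv (p : MvPolynomial (ι ⊕ Fin k) ℂ) (v : ι → ℂ) (x : Fin k → ℂ) :
    ∃ L : (Fin k → ℂ) →L[ℂ] ℂ, HasFDerivAt (fun x => eval (Sum.elim v x) p) L x ∧
      ∀ ξ, aeval (Sum.elim (fun i => dn (v i) 0) (fun l => dn (x l) (ξ l))) p = dn (eval (Sum.elim v x) p) (L ξ) := by
  induction p using MvPolynomial.induction_on with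
  | C a =>
    refine ⟨0, ?_, ?_⟩
    · simpa using hasFDerivAt_const a x
    · intro ξ; ext <;> simp <;> rfl
  | add p q hp hq =>
    obtain ⟨L1, h1, h1'⟩ := hp
    obtain ⟨L2, h2, h2'⟩ := hq
    refine ⟨L1 + L2, ?_, ?_⟩
    · simp only [map_add]; exact h1.add h2
    · intro ξ
      rw [map_add, h1', h2']
      ext <;> simp
  | mul_X p i hp =>
    obtain ⟨L1, h1, h1'⟩ := hp
    rcases i with i | i
    · refine ⟨v i • L1, ?_, ?_⟩
      · simp only [map_mul, eval_X, Sum.elim_inl]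
        exact h1.mul_const (v i)
      · intro ξ
        rw [map_mul, h1']
        ext <;> simp
        ring
    · refine ⟨eval (Sum.elim v x) p • ContinuousLinearMap.proj i + x i • L1, ?_, ?_⟩
      · simp only [map_mul, eval_X, Sum.elim_inr]
        exact h1.mul (hasFDerivAt_apply i x)
      · intro ξ
        rw [map_mul, h1']
        ext <;> simp
        ring
end gen

theorem generic_empty {ι : Type} [Fintype ι] [DecidableEq ι] {n k : ℕ} (hk : k < n) (I : Finset ι)
    (E : Fin n → (ι → ℂ) → (Fin k → ℂ) → ℂ) (hE : ∀ e, PF2 (E e)) (hA : ∀ e, AffOn I (E e)) :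
    ∃ Q : MvPolynomial ι ℂ, Q ≠ 0 ∧ ∀ v, eval v Q ≠ 0 → ∀ x, Surj I E v x → ¬ ∀ e, E e v x = 0 := by
  classical
  choose P hP using hE
  have hP : ∀ e v x, E e v x = eval (Sum.elim v x) (P e) := fun e v x => hP e (Sum.elim v x)
  have key : ∀ b : {b : Fin n → ι // Function.Injective b ∧ ∀ j, b j ∈ I}, _ :=
    fun b => core_empty b.1 (Tm I b.1 b.2.2 P) (Rm I b.1 b.2.2 P) b.2.1 hk
  choose Q hQ hQ2 using key
  refine ⟨∏ b, Q b, Finset.prod_ne_zero_iff.2 fun b _ => hQ b, fun v hv x hS h0 => ?_⟩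
  rw [map_prod, Finset.prod_ne_zero_iff] at hv
  obtain ⟨b, hbi, hb, hd⟩ := surj_cols I E P hP hA v x hS
  refine hQ2 ⟨b, hbi, hb⟩ v x (hv _ (Finset.mem_univ _)) hd fun e => ?_
  have := aeval_identity I E P hP b hbi hb hA e v x
  have h2 := (hP e v x).symm.trans (h0 e)
  rw [← h2]
  exact this.symm

theorem generic_nondeg {ι : Type} [Fintype ι] [DecidableEq ι] {n : ℕ} (I : Finset ι)
    (E : Fin n → (ι → ℂ) → (Fin n → ℂ) → ℂ) (hE : ∀ e, PF2 (E e)) (hA : ∀ e, AffOn I (E e)) :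
    ∃ Q : MvPolynomial ι ℂ, Q ≠ 0 ∧ ∀ v, eval v Q ≠ 0 → ∀ x, Surj I E v x → (∀ e, E e v x = 0) →
      ∀ ξ, (∀ e, fderiv ℂ (fun x => E e v x) x ξ = 0) → ξ = 0 := by
  classical
  choose P hP using hE
  have hP : ∀ e v x, E e v x = eval (Sum.elim v x) (P e) := fun e v x => hP e (Sum.elim v x)
  have key : ∀ b : {b : Fin n → ι // Function.Injective b ∧ ∀ j, b j ∈ I}, _ :=
    fun b => core_nondeg b.1 (Tm I b.1 b.2.2 P) (Rm I b.1 b.2.2 P) b.2.1 rfl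
  choose Q hQ hQ2 using key
  refine ⟨∏ b, Q b, Finset.prod_ne_zero_iff.2 fun b _ => hQ b, fun v hv x hS h0 ξ hξ => ?_⟩
  rw [map_prod, Finset.prod_ne_zero_iff] at hv
  obtain ⟨b, hbi, hb, hd⟩ := surj_cols I E P hP hA v x hS
  refine hQ2 ⟨b, hbi, hb⟩ v x ξ (hv _ (Finset.mem_univ _)) hd fun e => ?_
  have := aeval_identity I E P hP b hbi hb hA e (fun i => dn (v i) 0) (fun l => dn (x l) (ξ l))
  rw [← this]
  obtain ⟨L, hL, hL2⟩ := dual_deriv (P e) v x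
  have h3 : (fun x => E e v x) = fun x => eval (Sum.elim v x) (P e) := funext fun x => hP e v x
  have h4 := hξ e
  rw [h3, hL.fderiv] at h4
  rw [hL2 ξ, h4, ← hP, h0]
  simp [dn]

end HF

namespace HF
open MvPolynomial

abbrev Zi := Fin 3 ⊕ Fin 3 ⊕ Fin 2
abbrev Z := Zi → ℂ
def zp (z : Z) : Fin 3 → ℂ := fun i => z (Sum.inl i)
def zw (z : Z) : Fin 3 → ℂ := fun i => z (Sum.inr (Sum.inl i))
def zc (z : Z) : Fin 2 → ℂ := fun i => z (Sum.inr (Sum.inr i))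
def mkZ (p w : Fin 3 → ℂ) (c : Fin 2 → ℂ) : Z := Sum.elim p (Sum.elim w c)
@[simp] theorem zp_mkZ (p w : Fin 3 → ℂ) (c : Fin 2 → ℂ) : zp (mkZ p w c) = p := rfl
@[simp] theorem zw_mkZ (p w : Fin 3 → ℂ) (c : Fin 2 → ℂ) : zw (mkZ p w c) = w := rfl
@[simp] theorem zc_mkZ (p w : Fin 3 → ℂ) (c : Fin 2 → ℂ) : zc (mkZ p w c) = c := rfl
theorem mkZ_eta (z : Z) : mkZ (zp z) (zw z) (zc z) = z := by
  funext i; rcases i with i | i | i <;> rfl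

def crs (p w : Fin 3 → ℂ) : Fin 3 → ℂ :=
  ![p 1 * w 2 - p 2 * w 1, p 2 * w 0 - p 0 * w 2, p 0 * w 1 - p 1 * w 0]
def zl (z : Z) : Fin 3 → ℂ := crs (zp z) (zw z)
def InX (z : Z) : Prop := zl z ≠ 0 ∧ zc z ≠ 0
def Rel (z z' : Z) : Prop := ∃ α β γ κ : ℂ, α ≠ 0 ∧ β ≠ 0 ∧ κ ≠ 0 ∧
  z' = mkZ (α • zp z) (β • zw z + γ • zp z) (κ • zc z)
def big (x : Fin 4 → ℂ) : Z := mkZ ![1, x 0, x 1] ![0, 1, x 2] ![1, x 3]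
def InR (z : Z) : Prop := zp z 0 ≠ 0 ∧ zl z 2 ≠ 0 ∧ zc z 0 ≠ 0
def coord (z : Z) : Fin 4 → ℂ := ![zp z 1 / zp z 0, zp z 2 / zp z 0, - zl z 1 / zl z 2, zc z 1 / zc z 0]

theorem crs_rel (p w : Fin 3 → ℂ) (α β γ : ℂ) : crs (α • p) (β • w + γ • p) = (α * β) • crs p w := by
  funext i; fin_cases i <;> simp [crs] <;> ring

theorem Rel.symm {z z' : Z} (h : Rel z z') : Rel z' z := by
  obtain ⟨α, β, γ, κ, ha, hb, hk, rfl⟩ := h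
  refine ⟨α⁻¹, β⁻¹, - (β⁻¹ * γ * α⁻¹), κ⁻¹, inv_ne_zero ha, inv_ne_zero hb, inv_ne_zero hk, ?_⟩
  conv_lhs => rw [← mkZ_eta z]
  simp only [zp_mkZ, zw_mkZ, zc_mkZ]
  congr 1
  · funext i; simp; field_simp
  · funext i; simp; field_simp; ring
  · funext i; simp; field_simp

theorem Rel.trans {z z' z'' : Z} (h : Rel z z') (h' : Rel z' z'') : Rel z z'' := by
  obtain ⟨α, β, γ, κ, ha, hb, hk, rfl⟩ := h
  obtain ⟨α', β', γ', κ', ha', hb', hk', rfl⟩ := h'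
  refine ⟨α' * α, β' * β, β' * γ + γ' * α, κ' * κ, mul_ne_zero ha' ha, mul_ne_zero hb' hb, mul_ne_zero hk' hk, ?_⟩
  simp only [zp_mkZ, zw_mkZ, zc_mkZ]
  congr 1
  · funext i; simp; ring
  · funext i; simp; ring
  · funext i; simp; ring

theorem Rel.inX {z z' : Z} (h : Rel z z') (hz : InX z) : InX z' := by
  obtain ⟨α, β, γ, κ, ha, hb, hk, rfl⟩ := h
  refine ⟨?_, ?_⟩
  · simp only [zl, zp_mkZ, zw_mkZ, crs_rel]
    exact smul_ne_zero (mul_ne_zero ha hb) hz.1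
  · exact smul_ne_zero hk hz.2

theorem Rel.inR {z z' : Z} (h : Rel z z') (hz : InR z) : InR z' := by
  obtain ⟨α, β, γ, κ, ha, hb, hk, rfl⟩ := h
  simp only [InR, zl, zp_mkZ, zw_mkZ, crs_rel, zc_mkZ, Pi.smul_apply, smul_eq_mul]
  exact ⟨mul_ne_zero ha hz.1, mul_ne_zero (mul_ne_zero ha hb) hz.2.1, mul_ne_zero hk hz.2.2⟩

theorem Rel.coord {z z' : Z} (h : Rel z z') : coord z' = coord z := by
  obtain ⟨α, β, γ, κ, ha, hb, hk, rfl⟩ := h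
  simp only [HF.coord, zl, zp_mkZ, zw_mkZ, crs_rel, zc_mkZ, Pi.smul_apply, smul_eq_mul]
  rw [mul_div_mul_left _ _ ha, mul_div_mul_left _ _ ha, mul_div_mul_left _ _ hk, ← mul_neg,
    mul_div_mul_left _ _ (mul_ne_zero ha hb)]

theorem zl_big (x : Fin 4 → ℂ) : zl (big x) = ![x 0 * x 2 - x 1, - x 2, 1] := by
  simp [zl, big, crs]

theorem coord_big (x : Fin 4 → ℂ) : coord (big x) = x := by
  funext i
  simp only [coord, zl_big]
  fin_cases i <;> simp [big]

theorem inR_big (x : Fin 4 → ℂ) : InR (big x) := by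
  simp only [InR, zl_big]; simp [big]

theorem InR.inX {z : Z} (h : InR z) : InX z :=
  ⟨fun h0 => h.2.1 (by rw [h0]; rfl), fun h0 => h.2.2 (by rw [h0]; rfl)⟩

theorem InR.rel_big {z : Z} (h : InR z) : Rel z (big (coord z)) := by
  obtain ⟨h0, h1, h2⟩ := h
  refine ⟨(zp z 0)⁻¹, zp z 0 / zl z 2, - (zw z 0 / zl z 2), (zc z 0)⁻¹, inv_ne_zero h0, div_ne_zero h0 h1,
    inv_ne_zero h2, ?_⟩
  have e2 : zl z 2 = zp z 0 * zw z 1 - zp z 1 * zw z 0 := rfl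
  have e1 : zl z 1 = zp z 2 * zw z 0 - zp z 0 * zw z 2 := rfl
  unfold big coord
  congr 1
  · funext i; fin_cases i <;> simp <;> field_simp
  · funext i; fin_cases i <;> simp <;> field_simp
    · ring
    · rw [e2]; ring
    · rw [e1]; ring
  · funext i; fin_cases i <;> simp <;> field_simp

/-! ### compact set of representatives -/
def nsq {n : ℕ} (p : Fin n → ℂ) : ℝ := ∑ i, ‖p i‖ ^ 2
def herm (p w : Fin 3 → ℂ) : ℂ := ∑ i, (starRingEnd ℂ) (p i) * w i
def KK : Set Z := {z | nsq (zp z) = 1 ∧ herm (zp z) (zw z) = 0 ∧ nsq (zw z) = 1 ∧ nsq (zc z) = 1}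

theorem herm_self (p : Fin 3 → ℂ) : herm p p = (nsq p : ℂ) := by
  simp only [herm, nsq]; push_cast
  exact Finset.sum_congr rfl fun i _ => by rw [mul_comm, Complex.mul_conj']

theorem nsq_pos {n : ℕ} {p : Fin n → ℂ} (h : p ≠ 0) : 0 < nsq p := by
  obtain ⟨i, hi⟩ := Function.ne_iff.1 h
  refine Finset.sum_pos' (fun _ _ => by positivity) ⟨i, Finset.mem_univ _, ?_⟩
  have : 0 < ‖p i‖ := norm_pos_iff.2 hi
  positivity

theorem nsq_smul {n : ℕ} (a : ℂ) (p : Fin n → ℂ) : nsq (a • p) = ‖a‖ ^ 2 * nsq p := by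
  simp [nsq, Finset.mul_sum, mul_pow]

theorem nsq_zero {n : ℕ} : nsq (0 : Fin n → ℂ) = 0 := by simp [nsq]

theorem norm_le_of_nsq {n : ℕ} {p : Fin n → ℂ} (h : nsq p = 1) (i) : ‖p i‖ ≤ 1 := by
  have : ‖p i‖ ^ 2 ≤ 1 := by
    rw [← h]
    exact Finset.single_le_sum (f := fun i => ‖p i‖ ^ 2) (fun _ _ => by positivity) (Finset.mem_univ i)
  nlinarith [norm_nonneg (p i)]

theorem KK_compact : IsCompact KK := by
  apply Metric.isCompact_of_isClosed_isBounded
  · have hp : Continuous zp := by unfold zp; fun_prop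
    have hw : Continuous zw := by unfold zw; fun_prop
    have hc : Continuous zc := by unfold zc; fun_prop
    have hn : ∀ {n : ℕ}, Continuous (nsq : (Fin n → ℂ) → ℝ) := by intro n; unfold nsq; fun_prop
    have hh : Continuous fun z : Z => herm (zp z) (zw z) := by
      unfold herm zp zw
      refine continuous_finset_sum _ fun i _ => ?_
      exact (Complex.continuous_conj.comp (continuous_apply _)).mul (continuous_apply _)
    exact (isClosed_eq (hn.comp hp) continuous_const).inter ((isClosed_eq hh continuous_const).inter
      ((isClosed_eq (hn.comp hw) continuous_const).inter (isClosed_eq (hn.comp hc) continuous_const)))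
  · refine (Metric.isBounded_closedBall (x := (0 : Z)) (r := 1)).subset ?_
    intro z hz
    rw [mem_closedBall_zero_iff, pi_norm_le_iff_of_nonneg zero_le_one]
    rintro (i | i | i)
    · exact norm_le_of_nsq hz.1 i
    · exact norm_le_of_nsq hz.2.2.1 i
    · exact norm_le_of_nsq hz.2.2.2 i

theorem KK_inX {z : Z} (hz : z ∈ KK) : InX z := by
  obtain ⟨h1, h2, h3, h4⟩ := hz
  constructor
  · intro h0
    have a0 : zp z 1 * zw z 2 - zp z 2 * zw z 1 = 0 := congrFun h0 0
    have a1 : zp z 2 * zw z 0 - zp z 0 * zw z 2 = 0 := congrFun h0 1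
    have a2 : zp z 0 * zw z 1 - zp z 1 * zw z 0 = 0 := congrFun h0 2
    have hs := herm_self (zp z)
    rw [h1] at hs
    simp only [herm, Fin.sum_univ_three] at h2 hs
    have hw : zw z = 0 := by
      funext j
      have : zw z j = zp z j * ((starRingEnd ℂ) (zp z 0) * zw z 0 + (starRingEnd ℂ) (zp z 1) * zw z 1 + (starRingEnd ℂ) (zp z 2) * zw z 2) := by
        have : zw z j = zw z j * ((starRingEnd ℂ) (zp z 0) * zp z 0 + (starRingEnd ℂ) (zp z 1) * zp z 1 + (starRingEnd ℂ) (zp z 2) * zp z 2) := by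
          rw [hs]; simp
        rw [this]
        fin_cases j
        · simp; linear_combination (- (starRingEnd ℂ) (zp z 1)) * a2 + (starRingEnd ℂ) (zp z 2) * a1
        · simp; linear_combination ((starRingEnd ℂ) (zp z 0)) * a2 - (starRingEnd ℂ) (zp z 2) * a0
        · simp; linear_combination (-(starRingEnd ℂ) (zp z 0)) * a1 + (starRingEnd ℂ) (zp z 1) * a0
      rw [this, h2]; simp
    rw [hw, nsq_zero] at h3
    exact zero_ne_one h3
  · intro h0
    rw [h0, nsq_zero] at h4
    exact zero_ne_one h4

theorem norm_scale {n : ℕ} {p : Fin n → ℂ} (h : p ≠ 0) : ∃ a : ℂ, a ≠ 0 ∧ nsq (a • p) = 1 := by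
  have := nsq_pos h
  refine ⟨((Real.sqrt (nsq p))⁻¹ : ℝ), ?_, ?_⟩
  · rw [Complex.ofReal_ne_zero]; positivity
  · rw [nsq_smul, Complex.norm_real, Real.norm_eq_abs, sq_abs, inv_pow, Real.sq_sqrt this.le]
    field_simp

theorem InX.exists_KK {z : Z} (hz : InX z) : ∃ κ ∈ KK, Rel z κ := by
  have hp : zp z ≠ 0 := by
    intro h; apply hz.1; simp [zl, crs, h]
  obtain ⟨a, ha, hap⟩ := norm_scale hp
  obtain ⟨k, hk, hkc⟩ := norm_scale hz.2
  set g : ℂ := - (herm (zp z) (zw z) / nsq (zp z)) with hg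
  have hn : (nsq (zp z) : ℂ) ≠ 0 := by exact_mod_cast (nsq_pos hp).ne'
  have hw : zw z + g • zp z ≠ 0 := by
    intro h
    apply hz.1
    have := crs_rel (zp z) (zw z) 1 1 g
    rw [one_smul, one_smul, h, one_mul, one_smul] at this
    rw [zl, ← this]
    funext i; fin_cases i <;> simp [crs]
  obtain ⟨b, hb, hbw⟩ := norm_scale hw
  have hh : herm (zp z) (zw z + g • zp z) = 0 := by
    have : herm (zp z) (zw z + g • zp z) = herm (zp z) (zw z) + g * herm (zp z) (zp z) := by
      simp [herm, Fin.sum_univ_three]; ring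
    rw [this, herm_self, hg]; field_simp; ring
  refine ⟨mkZ (a • zp z) (b • zw z + (b * g) • zp z) (k • zc z), ⟨hap, ?_, ?_, hkc⟩, a, b, b * g, k, ha, hb, hk, rfl⟩
  · have : herm (a • zp z) (b • zw z + (b * g) • zp z) = (starRingEnd ℂ) a * b * herm (zp z) (zw z + g • zp z) := by
      simp [herm, Fin.sum_univ_three]; ring
    rw [zp_mkZ, zw_mkZ, this, hh, mul_zero]
  · rw [zw_mkZ, mul_smul, ← smul_add]; exact hbw

theorem isOpen_W {U : Set (Fin 4 → ℂ)} (hU : IsOpen U) : IsOpen {z : Z | InR z ∧ coord z ∈ U} := by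
  have hp : ∀ i, Continuous fun z => zp z i := by intro i; unfold zp; fun_prop
  have hw : ∀ i, Continuous fun z => zw z i := by intro i; unfold zw; fun_prop
  have hc : ∀ i, Continuous fun z => zc z i := by intro i; unfold zc; fun_prop
  have hl1 : Continuous fun z => zl z 1 := by
    show Continuous fun z => zp z 2 * zw z 0 - zp z 0 * zw z 2
    exact ((hp _).mul (hw _)).sub ((hp _).mul (hw _))
  have hl2 : Continuous fun z => zl z 2 := by
    show Continuous fun z => zp z 0 * zw z 1 - zp z 1 * zw z 0
    exact ((hp _).mul (hw _)).sub ((hp _).mul (hw _))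
  have hR : IsOpen {z : Z | InR z} :=
    (isOpen_ne_fun (hp 0) continuous_const).inter ((isOpen_ne_fun hl2 continuous_const).inter
      (isOpen_ne_fun (hc 0) continuous_const))
  have hco : ContinuousOn coord {z : Z | InR z} := by
    rw [continuousOn_pi]
    intro i
    fin_cases i
    · exact (hp 1).continuousOn.div (hp 0).continuousOn fun z hz => hz.1
    · exact (hp 2).continuousOn.div (hp 0).continuousOn fun z hz => hz.1
    · exact hl1.neg.continuousOn.div hl2.continuousOn fun z hz => hz.2.1
    · exact (hc 1).continuousOn.div (hc 0).continuousOn fun z hz => hz.2.2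
  exact hco.isOpen_inter_preimage hR hU

end HF

namespace HF
open MvPolynomial
open Filter Topology

theorem local_unique (f : ℂ × (Fin 4 → ℂ) → (Fin 4 → ℂ)) (hf : ContDiff ℂ 1 f) (s0 : ℂ) (x0 : Fin 4 → ℂ)
    (h0 : f (s0, x0) = 0) (hn : ∀ ξ, fderiv ℂ (fun x => f (s0, x)) x0 ξ = 0 → ξ = 0)
    (O : Set (Fin 4 → ℂ)) (hO : O ∈ 𝓝 x0) :
    ∃ U, IsOpen U ∧ x0 ∈ U ∧ U ⊆ O ∧ ∀ᶠ s in 𝓝 s0, ∃! x, x ∈ U ∧ f (s, x) = 0 := by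
  have hs := hf.hasStrictFDerivAt (x := (s0, x0)) one_ne_zero
  set f' := fderiv ℂ f (s0, x0)
  have hfd : fderiv ℂ (fun x => f (s0, x)) x0 = f' ∘L ContinuousLinearMap.inr ℂ ℂ (Fin 4 → ℂ) := by
    have h2 : HasFDerivAt (fun x : Fin 4 → ℂ => (s0, x)) (ContinuousLinearMap.inr ℂ ℂ (Fin 4 → ℂ)) x0 :=
      hasFDerivAt_prodMk_right s0 x0
    exact (hs.hasFDerivAt.comp x0 h2).fderiv
  have hinv : (f' ∘L ContinuousLinearMap.inr ℂ ℂ (Fin 4 → ℂ)).IsInvertible := by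
    rw [← hfd]
    have hi : Function.Injective (fderiv ℂ (fun x => f (s0, x)) x0 : (Fin 4 → ℂ) →ₗ[ℂ] (Fin 4 → ℂ)) :=
      (injective_iff_map_eq_zero _).2 hn
    refine ⟨(LinearEquiv.ofInjectiveEndo _ hi).toContinuousLinearEquiv, ?_⟩
    ext x : 1
    rfl
  have h1 := hs.eventually_apply_eq_iff_implicitFunctionOfProdDomain hinv
  have h2 := hs.tendsto_implicitFunctionOfProdDomain hinv
  set ψ := hs.implicitFunctionOfProdDomain hinv
  rw [nhds_prod_eq, eventually_prod_iff] at h1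
  obtain ⟨pa, hpa, pb, hpb, h1⟩ := h1
  obtain ⟨U, hU1, hU2, hU3⟩ := mem_nhds_iff.1 (inter_mem hO hpb)
  refine ⟨U, hU2, hU3, fun x hx => (hU1 hx).1, ?_⟩
  have h3 : ∀ᶠ s in 𝓝 s0, ψ s ∈ U := h2 (hU2.mem_nhds hU3)
  filter_upwards [hpa, h3] with s hs1 hs2
  refine ⟨ψ s, ⟨hs2, ?_⟩, ?_⟩
  · have := (h1 hs1 (hU1 hs2).2).2 rfl
    rw [h0] at this; exact this
  · rintro y ⟨hy, hy0⟩
    exact ((h1 hs1 (hU1 hy).2).1 (by rw [hy0, h0])).symm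

def BInv (S : Fin 4 → Z → ℂ) : Prop := ∀ z z', Rel z z' → (∀ e, S e z = 0) → ∀ e, S e z' = 0
structure Good (S : Fin 4 → Z → ℂ) : Prop where
  inR : ∀ z, InX z → (∀ e, S e z = 0) → InR z
  nondeg : ∀ x, (∀ e, S e (big x) = 0) → ∀ ξ, (∀ e, fderiv ℂ (fun x => S e (big x)) x ξ = 0) → ξ = 0
def zset (S : Fin 4 → Z → ℂ) : Set (Fin 4 → ℂ) := {x | ∀ e, S e (big x) = 0}
def cnt (S : Fin 4 → Z → ℂ) : ℕ := (zset S).ncard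

theorem big_PF (i : Zi) : PF (fun x => big x i) := by
  rcases i with i | i | i <;> fin_cases i
  · exact PF.const 1
  · exact PF.var 0
  · exact PF.var 1
  · exact PF.const 0
  · exact PF.const 1
  · exact PF.var 2
  · exact PF.const 1
  · exact PF.var 3

theorem big_contDiff : ContDiff ℂ 1 big := contDiff_pi.2 fun i => (big_PF i).contDiff (n := 1)

theorem local_unique' {S : ℂ → Fin 4 → Z → ℂ} (hc : ∀ e, ContDiff ℂ 1 (fun q : ℂ × Z => S q.1 e q.2))
    (s0 : ℂ) (hg : Good (S s0)) (x0 : Fin 4 → ℂ) (hx : x0 ∈ zset (S s0)) (O : Set (Fin 4 → ℂ)) (hO : O ∈ 𝓝 x0) :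
    ∃ U, IsOpen U ∧ x0 ∈ U ∧ U ⊆ O ∧ ∀ᶠ s in 𝓝 s0, ∃! x, x ∈ U ∧ x ∈ zset (S s) := by
  have hcd : ContDiff ℂ 1 (fun q : ℂ × (Fin 4 → ℂ) => fun e => S q.1 e (big q.2)) := by
    rw [contDiff_pi]
    intro e
    exact (hc e).comp (contDiff_fst.prodMk (big_contDiff.comp contDiff_snd))
  have hn : ∀ ξ, fderiv ℂ (fun x => fun e => S s0 e (big x)) x0 ξ = 0 → ξ = 0 := by
    intro ξ hξ
    apply hg.nondeg x0 hx
    intro e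
    have hd : DifferentiableAt ℂ (fun x => fun e => S s0 e (big x)) x0 := by
      have : ContDiff ℂ 1 (fun x : Fin 4 → ℂ => fun e => S s0 e (big x)) :=
        hcd.comp (contDiff_const.prodMk contDiff_id)
      exact this.differentiable one_ne_zero x0
    have := fderiv_apply hd e
    have h2 := congrArg (fun L : (Fin 4 → ℂ) →L[ℂ] ℂ => L ξ) this
    simp only [ContinuousLinearMap.comp_apply, ContinuousLinearMap.proj_apply] at h2
    rw [h2, hξ]; rfl
  obtain ⟨U, h1, h2, h3, h4⟩ := local_unique (fun q : ℂ × (Fin 4 → ℂ) => fun e => S q.1 e (big q.2)) hcd s0 x0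
    (funext hx) hn O hO
  refine ⟨U, h1, h2, h3, ?_⟩
  filter_upwards [h4] with s hs
  simpa [zset, _root_.funext_iff] using hs

theorem zset_of_inX {S : Fin 4 → Z → ℂ} (hi : BInv S) {z : Z} (hR : InR z) (hz : ∀ e, S e z = 0) :
    coord z ∈ zset S := hi _ _ hR.rel_big hz

/-- for parameters close to a good one, all the zeros are near the zeros of the good one -/
theorem near_zeros {S : ℂ → Fin 4 → Z → ℂ} (hc : ∀ e, Continuous (fun q : ℂ × Z => S q.1 e q.2))
    (hi : ∀ s, BInv (S s)) (s0 : ℂ) (hg : Good (S s0)) (U : Set (Fin 4 → ℂ)) (hU : IsOpen U)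
    (hU' : zset (S s0) ⊆ U) : ∀ᶠ s in 𝓝 s0, zset (S s) ⊆ U := by
  have hK : IsCompact (KK \ {z : Z | InR z ∧ coord z ∈ U}) := KK_compact.diff (isOpen_W hU)
  have := hK.eventually_forall_of_forall_eventually (x₀ := s0) (P := fun s κ => ∃ e, S s e κ ≠ 0) ?_
  · filter_upwards [this] with s hs x hx
    obtain ⟨κ, hκ, hr⟩ := (inR_big x).inX.exists_KK
    have hz := hi s _ _ hr hx
    by_contra hxU
    obtain ⟨e, he⟩ := hs κ ⟨hκ, fun h => hxU (by rw [← coord_big x, ← hr.coord]; exact h.2)⟩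
    exact he (hz e)
  · rintro κ ⟨hκ, hκ'⟩
    have : ∃ e, S s0 e κ ≠ 0 := by
      by_contra hne
      push Not at hne
      have hR := hg.inR κ (KK_inX hκ) hne
      exact hκ' ⟨hR, hU' (zset_of_inX (hi s0) hR hne)⟩
    obtain ⟨e, he⟩ := this
    have h1 : ∀ᶠ q : ℂ × Z in 𝓝 (s0, κ), S q.1 e q.2 ≠ 0 := (hc e).continuousAt.eventually_ne he
    filter_upwards [h1] with q hq
    exact ⟨e, hq⟩

theorem Good.finite {S : Fin 4 → Z → ℂ} (hS : ∀ e, PF (S e)) (hi : BInv S) (hg : Good S) : (zset S).Finite := by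
  have hcd : ∀ e, ContDiff ℂ 1 (S e) := fun e => (hS e).contDiff (n := 1)
  -- the compact set of zeros
  have hC : IsCompact (KK ∩ {z | ∀ e, S e z = 0}) := by
    apply KK_compact.inter_right
    rw [Set.setOf_forall]
    exact isClosed_iInter fun e => isClosed_eq (hcd e).continuous continuous_const
  have hU : ∀ x ∈ zset S, ∃ U, IsOpen U ∧ x ∈ U ∧ ∀ y ∈ U, y ∈ zset S → y = x := by
    intro x hx
    obtain ⟨U, h1, h2, -, h4⟩ := local_unique' (S := fun _ => S) (fun e => (hcd e).comp contDiff_snd) 0 hg x hx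
      Set.univ univ_mem
    refine ⟨U, h1, h2, fun y hy hy' => ?_⟩
    obtain ⟨w, -, hw⟩ := h4.self_of_nhds
    rw [hw y ⟨hy, hy'⟩, hw x ⟨h2, hx⟩]
  choose! U hU1 hU2 hU3 using hU
  obtain ⟨t, ht⟩ := hC.elim_finite_subcover (fun x : zset S => {z : Z | InR z ∧ coord z ∈ U x})
    (fun x => isOpen_W (hU1 x x.2)) (by
      rintro z ⟨hz, hz0⟩
      have hR := hg.inR z (KK_inX hz) hz0
      have := zset_of_inX hi hR hz0
      rw [Set.mem_iUnion]
      exact ⟨⟨coord z, this⟩, hR, hU2 _ this⟩)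
  apply (t.finite_toSet.image (Subtype.val)).subset
  intro x hx
  obtain ⟨κ, hκ, hr⟩ := (inR_big x).inX.exists_KK
  have := ht ⟨hκ, hi _ _ hr hx⟩
  rw [Set.mem_iUnion₂] at this
  obtain ⟨y, hy, -, hyU⟩ := this
  rw [hr.coord, coord_big] at hyU
  exact ⟨y, hy, (hU3 y y.2 x hyU hx).symm⟩

theorem cnt_locally_const {S : ℂ → Fin 4 → Z → ℂ} (hc : ∀ e, ContDiff ℂ 1 (fun q : ℂ × Z => S q.1 e q.2))
    (hi : ∀ s, BInv (S s)) (s0 : ℂ) (hg : Good (S s0)) (hfin : (zset (S s0)).Finite) :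
    ∀ᶠ s in 𝓝 s0, cnt (S s) = cnt (S s0) := by
  obtain ⟨O, hO, hdisj⟩ := hfin.t2_separation
  have hU := fun x (hx : x ∈ zset (S s0)) => local_unique' hc s0 hg x hx (O x) ((hO x).2.mem_nhds (hO x).1)
  choose! U hU1 hU2 hU3 hU4 using hU
  have h1 := near_zeros (fun e => (hc e).continuous) hi s0 hg (⋃ x ∈ zset (S s0), U x)
    (isOpen_biUnion hU1) (fun x hx => Set.mem_biUnion hx (hU2 x hx))
  have h2 : ∀ᶠ s in 𝓝 s0, ∀ x ∈ zset (S s0), ∃! y, y ∈ U x ∧ y ∈ zset (S s) :=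
    (hfin.eventually_all).2 hU4
  filter_upwards [h1, h2] with s hs1 hs2
  choose! y hy1 hy2 using hs2
  symm
  refine Set.ncard_congr (fun x _ => y x) (fun x hx => (hy1 x hx).2) ?_ ?_
  · intro a b ha hb hab
    by_contra hne
    have := hdisj ha hb hne
    refine Set.disjoint_left.1 this (hU3 a ha (hy1 a ha).1) ?_
    have : y a = y b := hab
    rw [this]; exact hU3 b hb (hy1 b hb).1
  · intro b hb
    have := hs1 hb
    rw [Set.mem_iUnion₂] at this
    obtain ⟨x, hx, hxb⟩ := this
    exact ⟨x, hx, (hy2 x hx b ⟨hxb, hb⟩).symm⟩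

/-- regular families -/
structure Reg {ι : Type} (E : (ι → ℂ) → Fin 4 → Z → ℂ) : Prop where
  pf : ∀ e, PF2 (fun v z => E v e z)
  inv : ∀ v, BInv (E v)

theorem Reg.pf1 {ι : Type} {E : (ι → ℂ) → Fin 4 → Z → ℂ} (h : Reg E) (v : ι → ℂ) (e : Fin 4) : PF (E v e) := by
  have := PF.comp (h.pf e) (g := fun z : Z => Sum.elim v z) (by
    rintro (i | i)
    · exact PF.const _
    · exact PF.var _)
  exact this

theorem Reg.finite {ι : Type} {E : (ι → ℂ) → Fin 4 → Z → ℂ} (h : Reg E) {v : ι → ℂ} (hg : Good (E v)) :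
    (zset (E v)).Finite := hg.finite (h.pf1 v) (h.inv v)

theorem cnt_eq_of_generic {ι : Type} [Fintype ι] {E : (ι → ℂ) → Fin 4 → Z → ℂ} (hE : Reg E) (Q : MvPolynomial ι ℂ)
    (hQ : ∀ v, eval v Q ≠ 0 → Good (E v)) (v0 v1 : ι → ℂ) (h0 : Good (E v0)) (h1 : eval v1 Q ≠ 0) :
    cnt (E v0) = cnt (E v1) := by
  set ln : ℂ → ι → ℂ := fun s i => v0 i + s * (v1 i - v0 i) with hln
  let q : Polynomial ℂ := aeval (fun i => Polynomial.C (v0 i) + Polynomial.X * Polynomial.C (v1 i - v0 i)) Q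
  have hq : ∀ s, q.eval s = eval (ln s) Q := by
    intro s
    have : Polynomial.evalRingHom s q = eval (ln s) Q := by
      simp only [q, aeval_def, eval₂_eq', map_sum, eval_eq', map_mul, map_prod, map_pow]
      refine Finset.sum_congr rfl fun m _ => ?_
      simp [hln, Polynomial.algebraMap_eq]
    exact this
  have hq0 : q ≠ 0 := by
    intro h
    apply h1
    have := hq 1
    rw [h] at this
    simp [hln] at this
    exact this.symm
  let S : ℂ → Fin 4 → Z → ℂ := fun s => E (ln s)
  have hcd : ∀ e, ContDiff ℂ 1 (fun p : ℂ × Z => S p.1 e p.2) := by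
    intro e
    have a := (hE.pf e).contDiff (n := 1)
    have b : ContDiff ℂ 1 (fun p : ℂ × Z => (Sum.elim (ln p.1) p.2 : ι ⊕ Zi → ℂ)) := by
      rw [contDiff_pi]
      rintro (i | i)
      · simp only [Sum.elim_inl, hln]; fun_prop
      · simp only [Sum.elim_inr]; fun_prop
    exact a.comp b
  let T : Set ℂ := ({s | q.IsRoot s} \ {0})
  have hT : T.Countable := ((Polynomial.finite_setOf_isRoot hq0).subset Set.diff_subset).countable
  have hconn : IsConnected Tᶜ := by
    apply hT.isConnected_compl_of_one_lt_rank
    rw [Complex.rank_real_complex]; norm_num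
  have hgood : ∀ s ∈ Tᶜ, Good (S s) := by
    intro s hs
    by_cases h : s = 0
    · subst h
      simpa [S, hln] using h0
    · apply hQ
      rw [← hq]
      intro h'
      exact hs ⟨h', h⟩
  have hloc : ContinuousOn (fun s => cnt (S s)) Tᶜ := by
    intro s hs
    apply ContinuousAt.continuousWithinAt
    have := cnt_locally_const hcd (fun s => hE.inv _) s (hgood s hs) (hE.finite (hgood s hs))
    exact (continuousAt_const.congr (this.mono fun _ h => h.symm))
  have e := hconn.isPreconnected.constant hloc (x := 0) (y := 1) (fun h => h.2 rfl) (fun h => by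
    apply h1
    have := h.1
    rw [Set.mem_setOf_eq, Polynomial.IsRoot, hq] at this
    simpa [hln] using this)
  simpa [S, hln] using e

theorem exists_cnt {ι : Type} [Fintype ι] {E : (ι → ℂ) → Fin 4 → Z → ℂ} (hE : Reg E) {Q : MvPolynomial ι ℂ}
    (hQ0 : Q ≠ 0) (hQ : ∀ v, eval v Q ≠ 0 → Good (E v)) : ∃ N, ∀ v, Good (E v) → cnt (E v) = N := by
  obtain ⟨v1, h1⟩ : ∃ v, eval v Q ≠ 0 := by
    by_contra h
    push Not at h
    exact hQ0 (MvPolynomial.funext fun v => by rw [h v]; simp)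
  exact ⟨cnt (E v1), fun v hv => cnt_eq_of_generic hE Q hQ v v1 hv h1⟩

/-! ### products -/
theorem prod_one {S : Fin 4 → Z → ℂ} (j : Fin 4) :
    Good (Function.update S j (fun _ => 1)) ∧ cnt (Function.update S j (fun _ => 1)) = 0 := by
  have h : ∀ z, ¬ ∀ e, Function.update S j (fun _ => 1) e z = 0 := fun z h => by simpa using h j
  refine ⟨⟨fun z _ hz => (h z hz).elim, fun x hx => (h _ hx).elim⟩, ?_⟩
  have : zset (Function.update S j (fun _ => 1)) = ∅ := by
    ext x; simpa [zset] using h (big x)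
  rw [cnt, this, Set.ncard_empty]

theorem zero_update {S : Fin 4 → Z → ℂ} {j : Fin 4} {g : Z → ℂ} {z : Z} :
    (∀ e, Function.update S j g e z = 0) ↔ g z = 0 ∧ ∀ e, e ≠ j → S e z = 0 := by
  constructor
  · intro h
    exact ⟨by simpa using h j, fun e he => by simpa [he] using h e⟩
  · rintro ⟨h1, h2⟩ e
    by_cases he : e = j
    · subst he; simpa using h1
    · simpa [he] using h2 e he

theorem nondeg_iff {S : Fin 4 → Z → ℂ} {j : Fin 4} {g : Z → ℂ} {x ξ : Fin 4 → ℂ} :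
    (∀ e, fderiv ℂ (fun x => Function.update S j g e (big x)) x ξ = 0) ↔
      fderiv ℂ (fun x => g (big x)) x ξ = 0 ∧ ∀ e, e ≠ j → fderiv ℂ (fun x => S e (big x)) x ξ = 0 := by
  constructor
  · intro h
    exact ⟨by simpa using h j, fun e he => by simpa [he] using h e⟩
  · rintro ⟨h1, h2⟩ e
    by_cases he : e = j
    · subst he; simpa using h1
    · simpa [he] using h2 e he

theorem prod_two {S : Fin 4 → Z → ℂ} (j : Fin 4) (f g : Z → ℂ) (hf : PF f) (hg : PF g)
    (Gf : Good (Function.update S j f)) (Gg : Good (Function.update S j g))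
    (ff : (zset (Function.update S j f)).Finite) (fg : (zset (Function.update S j g)).Finite)
    (hdis : ∀ z, InX z → (∀ e, e ≠ j → S e z = 0) → f z = 0 → g z = 0 → False) :
    Good (Function.update S j (fun z => f z * g z)) ∧
    (zset (Function.update S j (fun z => f z * g z))).Finite ∧
    cnt (Function.update S j (fun z => f z * g z)) = cnt (Function.update S j f) + cnt (Function.update S j g) := by
  have hz : zset (Function.update S j (fun z => f z * g z)) =
      zset (Function.update S j f) ∪ zset (Function.update S j g) := by
    ext x
    simp only [zset, Set.mem_setOf_eq, Set.mem_union, zero_update, mul_eq_zero]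
    tauto
  have hdF : ∀ {f : Z → ℂ}, PF f → Differentiable ℂ (fun x => f (big x)) := by
    intro f hf
    exact ((hf.contDiff (n := 1)).comp big_contDiff).differentiable one_ne_zero
  refine ⟨⟨?_, ?_⟩, ?_, ?_⟩
  · intro z hz h
    rw [zero_update, mul_eq_zero] at h
    rcases h with ⟨h | h, h'⟩
    · exact Gf.inR z hz (zero_update.2 ⟨h, h'⟩)
    · exact Gg.inR z hz (zero_update.2 ⟨h, h'⟩)
  · intro x hx ξ hξ
    rw [zero_update] at hx
    rw [nondeg_iff] at hξ
    have hd : fderiv ℂ (fun x => f (big x) * g (big x)) x ξ =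
        f (big x) * fderiv ℂ (fun x => g (big x)) x ξ + g (big x) * fderiv ℂ (fun x => f (big x)) x ξ := by
      have := fderiv_fun_mul (hdF hf x) (hdF hg x)
      rw [this]; simp
    rw [hd] at hξ
    have hnot := hdis (big x) (inR_big x).inX hx.2
    rcases mul_eq_zero.1 hx.1 with h | h
    · refine Gf.nondeg x (zero_update.2 ⟨h, hx.2⟩) ξ (nondeg_iff.2 ⟨?_, hξ.2⟩)
      have h2 := hξ.1
      rw [h, zero_mul, zero_add] at h2
      exact (mul_eq_zero.1 h2).resolve_left (fun h' => hnot h h')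
    · refine Gg.nondeg x (zero_update.2 ⟨h, hx.2⟩) ξ (nondeg_iff.2 ⟨?_, hξ.2⟩)
      have h2 := hξ.1
      rw [h, zero_mul, add_zero] at h2
      exact (mul_eq_zero.1 h2).resolve_left (fun h' => hnot h' h)
  · rw [hz]; exact ff.union fg
  · unfold cnt
    rw [hz, Set.ncard_union_eq ?_ ff fg]
    rw [Set.disjoint_left]
    intro x hx hx'
    have a := zero_update.1 hx
    have b := zero_update.1 hx'
    exact hdis (big x) (inR_big x).inX a.2 a.1 b.1

theorem prod_list {S : Fin 4 → Z → ℂ} (j : Fin 4) (L : List (Z → ℂ)) (hpf : ∀ f ∈ L, PF f)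
    (hG : ∀ f ∈ L, Good (Function.update S j f)) (hfin : ∀ f ∈ L, (zset (Function.update S j f)).Finite)
    (hdis : L.Pairwise (fun f g => ∀ z, InX z → (∀ e, e ≠ j → S e z = 0) → f z = 0 → g z = 0 → False)) :
    PF (fun z => (L.map (fun f => f z)).prod) ∧
    Good (Function.update S j (fun z => (L.map (fun f => f z)).prod)) ∧
    (zset (Function.update S j (fun z => (L.map (fun f => f z)).prod))).Finite ∧
    cnt (Function.update S j (fun z => (L.map (fun f => f z)).prod)) =
      (L.map (fun f => cnt (Function.update S j f))).sum := by
  induction L with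
  | nil =>
    obtain ⟨a, b⟩ := prod_one (S := S) j
    refine ⟨by simpa using PF.const 1, by simpa using a, ?_, by simpa using b⟩
    have h : ∀ z, ¬ ∀ e, Function.update S j (fun _ => 1) e z = 0 := fun z h => by simpa using h j
    have : zset (Function.update S j (fun _ => 1)) = ∅ := by
      ext x; simpa [zset] using h (big x)
    simp [this]
  | cons f L ih =>
    rw [List.pairwise_cons] at hdis
    obtain ⟨p, a, b, c⟩ := ih (fun f hf => hpf f (List.mem_cons_of_mem _ hf)) (fun f hf => hG f (List.mem_cons_of_mem _ hf))
      (fun f hf => hfin f (List.mem_cons_of_mem _ hf)) hdis.2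
    have hm : f ∈ f :: L := List.mem_cons_self
    have := prod_two j f (fun z => (L.map (fun f => f z)).prod) (hpf f hm) p (hG f hm) a (hfin f hm) b (by
      intro z hz h1 h2 h3
      rw [List.prod_eq_zero_iff, List.mem_map] at h3
      obtain ⟨g, hg, hg0⟩ := h3
      exact hdis.1 g hg z hz h1 h2 hg0)
    simp only [List.map_cons, List.prod_cons, List.sum_cons]
    exact ⟨(hpf f hm).mul p, this.1, this.2.1, by rw [this.2.2, c]⟩

end HF

namespace HF
open MvPolynomial

theorem eval_linePoly (F : MvPolynomial (Fin 3) ℂ) (v w : Fin 3 → ℂ) (t : ℂ) :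
    (linePoly F v w).eval t = eval (v + t • w) F := by
  have : Polynomial.evalRingHom t (linePoly F v w) = eval (v + t • w) F := by
    simp only [linePoly, aeval_def, eval₂_eq', map_sum, eval_eq', map_mul, map_prod, map_pow]
    refine Finset.sum_congr rfl fun m _ => ?_
    simp [Polynomial.algebraMap_eq]
    left
    exact Finset.prod_congr rfl fun x _ => by rw [mul_comm]
  exact this

theorem linePoly_natDegree {F : MvPolynomial (Fin 3) ℂ} {d : ℕ} (hF : F.IsHomogeneous d) (v w : Fin 3 → ℂ) :
    (linePoly F v w).natDegree ≤ d := by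
  have := aeval_natDegree_le (m := d) (n := 1) F hF.totalDegree_le
    (fun i => Polynomial.C (v i) + Polynomial.X * Polynomial.C (w i)) (fun i => by compute_degree)
  simpa [linePoly] using this

theorem hom_eval_smul {F : MvPolynomial (Fin 3) ℂ} {d : ℕ} (hF : F.IsHomogeneous d) (a : ℂ) (x : Fin 3 → ℂ) :
    eval (a • x) F = a ^ d * eval x F := by
  rw [eval_eq', eval_eq', Finset.mul_sum]
  refine Finset.sum_congr rfl fun m hm => ?_
  have h : ∑ i, m i = d := by
    have := hF (mem_support_iff.1 hm)
    simpa [Finsupp.weight_apply, Finsupp.sum_fintype] using this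
  simp only [Pi.smul_apply, smul_eq_mul, mul_pow, Finset.prod_mul_distrib, Finset.prod_pow_eq_pow_sum, h]
  ring

theorem linePoly_rel {F : MvPolynomial (Fin 3) ℂ} {d : ℕ} (hF : F.IsHomogeneous d) (p w : Fin 3 → ℂ)
    {α : ℂ} (β γ : ℂ) (ha : α ≠ 0) :
    linePoly F (α • p) (β • w + γ • p) = ∑ i ∈ Finset.range (d + 1),
      Polynomial.C ((linePoly F p w).coeff i * β ^ i) * (Polynomial.C α + Polynomial.C γ * Polynomial.X) ^ (d - i) *
        Polynomial.X ^ i := by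
  apply Polynomial.eq_of_infinite_eval_eq
  have hfin : {t : ℂ | α + γ * t = 0}.Finite := by
    have : (Polynomial.C α + Polynomial.C γ * Polynomial.X : Polynomial ℂ) ≠ 0 := by
      intro h
      have := congrArg (Polynomial.eval 0) h
      simp at this
      exact ha this
    refine (Polynomial.finite_setOf_isRoot this).subset fun t ht => ?_
    simpa [Polynomial.IsRoot] using ht
  refine hfin.infinite_compl.mono fun t ht => ?_
  have ht : α + γ * t ≠ 0 := ht
  rw [Set.mem_setOf_eq, eval_linePoly]
  have h1 : α • p + t • (β • w + γ • p) = (α + γ * t) • (p + (β * t / (α + γ * t)) • w) := by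
    funext i
    simp only [Pi.add_apply, Pi.smul_apply, smul_eq_mul, mul_add, ← mul_assoc]
    rw [mul_div_cancel₀ _ ht]; ring
  rw [h1, hom_eval_smul hF, ← eval_linePoly, Polynomial.eval_eq_sum_range' (n := d + 1)
    (Nat.lt_succ_of_le (linePoly_natDegree hF p w)), Polynomial.eval_finset_sum, Finset.mul_sum]
  refine Finset.sum_congr rfl fun i hi => ?_
  have hi : i ≤ d := Nat.lt_succ_iff.1 (Finset.mem_range.1 hi)
  have h2 : (α + γ * t) ^ d = (α + γ * t) ^ (d - i) * (α + γ * t) ^ i := by rw [← pow_add]; congr 1; omega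
  simp only [Polynomial.eval_mul, Polynomial.eval_C, Polynomial.eval_pow, Polynomial.eval_add, Polynomial.eval_X]
  rw [h2, div_pow]
  field_simp
  ring

theorem linePoly_rel_coeff {F : MvPolynomial (Fin 3) ℂ} {d : ℕ} (hF : F.IsHomogeneous d) (p w : Fin 3 → ℂ)
    {α : ℂ} (β γ : ℂ) (ha : α ≠ 0) (j : ℕ) (hj : j ≤ d) (h0 : ∀ i < j, (linePoly F p w).coeff i = 0) :
    (linePoly F (α • p) (β • w + γ • p)).coeff j = α ^ (d - j) * β ^ j * (linePoly F p w).coeff j := by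
  rw [linePoly_rel hF p w β γ ha, Polynomial.finset_sum_coeff, Finset.sum_eq_single j]
  · rw [Polynomial.coeff_mul_X_pow', if_pos le_rfl, Nat.sub_self, Polynomial.coeff_C_mul,
      Polynomial.coeff_zero_eq_eval_zero]
    simp; ring
  · intro i _ hij
    rcases lt_or_gt_of_ne hij with h | h
    · rw [h0 i h]; simp
    · rw [Polynomial.coeff_mul_X_pow', if_neg (by omega)]
  · intro h; exact absurd (Finset.mem_range.2 (by omega)) h

/-! ### coefficientwise polynomial families -/
def CPF {σ : Type} (q : (σ → ℂ) → Polynomial ℂ) : Prop := ∀ i, PF (fun z => (q z).coeff i)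
theorem CPF.mul {σ : Type} {q r : (σ → ℂ) → Polynomial ℂ} (hq : CPF q) (hr : CPF r) : CPF (fun z => q z * r z) := by
  intro i
  simp only [Polynomial.coeff_mul]
  exact PF.sum _ fun a _ => (hq _).mul (hr _)
theorem CPF.one {σ : Type} : CPF (fun _ : σ → ℂ => 1) := fun i => PF.const _
theorem CPF.pow {σ : Type} {q : (σ → ℂ) → Polynomial ℂ} (hq : CPF q) (n : ℕ) : CPF (fun z => q z ^ n) := by
  induction n with
  | zero => simpa using CPF.one
  | succ n ih => simpa [pow_succ] using ih.mul hq
theorem CPF.lin {σ : Type} {a b : (σ → ℂ) → ℂ} (ha : PF a) (hb : PF b) :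
    CPF (fun z => Polynomial.C (a z) + Polynomial.X * Polynomial.C (b z)) := by
  intro i
  match i with
  | 0 => simpa using ha
  | 1 => simpa [Polynomial.coeff_C] using hb
  | (i + 2) => simpa [Polynomial.coeff_C, Polynomial.coeff_X_mul] using PF.const 0

theorem linePoly_monomial (m : Fin 3 →₀ ℕ) (p w : Fin 3 → ℂ) : linePoly (monomial m 1) p w =
    (Polynomial.C (p 0) + Polynomial.X * Polynomial.C (w 0)) ^ m 0 *
    (Polynomial.C (p 1) + Polynomial.X * Polynomial.C (w 1)) ^ m 1 *
    (Polynomial.C (p 2) + Polynomial.X * Polynomial.C (w 2)) ^ m 2 := by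
  rw [linePoly, aeval_monomial, map_one, one_mul, Finsupp.prod_fintype _ _ (by simp), Fin.prod_univ_three]

theorem PF_zp (i) : PF (fun z => zp z i) := PF.var _
theorem PF_zw (i) : PF (fun z => zw z i) := PF.var _
theorem PF_zc (i) : PF (fun z => zc z i) := PF.var _
theorem PF_zl (i) : PF (fun z => zl z i) := by
  fin_cases i <;> exact ((PF_zp _).mul (PF_zw _)).sub ((PF_zp _).mul (PF_zw _))

def Mc (m : Fin 3 →₀ ℕ) (i : ℕ) (z : Z) : ℂ := (linePoly (monomial m 1) (zp z) (zw z)).coeff i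
theorem PF_Mc (m : Fin 3 →₀ ℕ) (i : ℕ) : PF (Mc m i) := by
  have : CPF (fun z : Z => linePoly (monomial m 1) (zp z) (zw z)) := by
    simp only [linePoly_monomial]
    exact ((((CPF.lin (PF_zp _) (PF_zw _)).pow _).mul ((CPF.lin (PF_zp _) (PF_zw _)).pow _))).mul
      ((CPF.lin (PF_zp _) (PF_zw _)).pow _)
  exact this i

/-! ### parameters -/
abbrev Mon (d : ℕ) := {m : Fin 3 →₀ ℕ // m ∈ Finset.finsuppAntidiag (Finset.univ : Finset (Fin 3)) d}
abbrev Lbl (d : ℕ) := Fin 4 ⊕ (Fin 3 × Fin (d + 3))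
abbrev Ix (d : ℕ) := (Fin 2 × Mon d) ⊕ (Lbl d × Fin 3) ⊕ (Fin 3 × Fin 3 × Fin 2) ⊕ Fin 2

variable {d : ℕ}
def form (v : Ix d → ℂ) (r : Fin 2) : MvPolynomial (Fin 3) ℂ := ∑ m : Mon d, monomial m.1 (v (Sum.inl (r, m)))
def member (v : Ix d → ℂ) (c : Fin 2 → ℂ) : MvPolynomial (Fin 3) ℂ := c 0 • form v 0 + c 1 • form v 1
def ff (i : ℕ) (v : Ix d → ℂ) (z : Z) : ℂ := (linePoly (member v (zc z)) (zp z) (zw z)).coeff i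
def pt (ty : Fin 3) (z : Z) : Fin 3 → ℂ :=
  match ty with
  | 0 => zp z
  | 1 => zl z
  | 2 => ![zc z 0, zc z 1, 0]
def lin (ty : Fin 3) (a : Lbl d) (v : Ix d → ℂ) (z : Z) : ℂ := ∑ i, v (Sum.inr (Sum.inl (a, i))) * pt ty z i

theorem Mon.sum (m : Mon d) : ∑ i, m.1 i = d := by
  have := m.2
  rw [Finset.mem_finsuppAntidiag] at this
  exact this.1

theorem mem_Mon {m : Fin 3 →₀ ℕ} (h : ∑ i, m i = d) : m ∈ Finset.finsuppAntidiag (Finset.univ : Finset (Fin 3)) d := by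
  rw [Finset.mem_finsuppAntidiag]; exact ⟨h, Finset.subset_univ _⟩

theorem form_hom (v : Ix d → ℂ) (r : Fin 2) : (form v r).IsHomogeneous d := by
  unfold form
  refine IsHomogeneous.sum _ _ _ fun m _ => isHomogeneous_monomial _ ?_
  rw [Finsupp.degree_eq_sum, m.sum]

theorem member_hom (v : Ix d → ℂ) (c) : (member v c).IsHomogeneous d := by
  unfold member
  rw [smul_eq_C_mul, smul_eq_C_mul]
  exact ((form_hom v 0).C_mul _).add ((form_hom v 1).C_mul _)

/-- coefficient vector of a homogeneous form -/
theorem hom_eq_sum {P : MvPolynomial (Fin 3) ℂ} (hP : P.IsHomogeneous d) :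
    P = ∑ m : Mon d, monomial m.1 (coeff m.1 P) := by
  ext n
  rw [coeff_sum]
  simp only [coeff_monomial]
  by_cases hn : ∑ i, n i = d
  · rw [Finset.sum_eq_single (⟨n, mem_Mon hn⟩ : Mon d)]
    · simp
    · intro b _ hb
      rw [if_neg]
      intro h; exact hb (Subtype.ext h)
    · intro h; exact absurd (Finset.mem_univ _) h
  · rw [Finset.sum_eq_zero]
    · by_contra h
      have := hP h
      apply hn
      simpa [Finsupp.weight_apply, Finsupp.sum_fintype] using this
    · intro m _
      rw [if_neg]
      intro h; exact hn (by rw [← h]; exact m.sum)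

def formVec (P : MvPolynomial (Fin 3) ℂ) (r : Fin 2) : Ix d → ℂ :=
  Sum.elim (fun q => if q.1 = r then coeff q.2.1 P else 0) 0

theorem form_add (v u : Ix d → ℂ) (r : Fin 2) : form (v + u) r = form v r + form u r := by
  simp [form, Finset.sum_add_distrib]
theorem form_formVec {P : MvPolynomial (Fin 3) ℂ} (hP : P.IsHomogeneous d) (r r' : Fin 2) :
    form (formVec P r : Ix d → ℂ) r' = if r' = r then P else 0 := by
  split_ifs with h
  · conv_rhs => rw [hom_eq_sum hP]
    simp [form, formVec, h]
  · simp [form, formVec, h]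

theorem ff_add_formVec {P : MvPolynomial (Fin 3) ℂ} (hP : P.IsHomogeneous d) (r : Fin 2) (i : ℕ) (v : Ix d → ℂ) (z : Z) :
    ff i (v + formVec P r) z = ff i v z + zc z r * (linePoly P (zp z) (zw z)).coeff i := by
  unfold ff member linePoly
  rw [form_add, form_add, form_formVec hP, form_formVec hP]
  fin_cases r <;> simp <;> ring

theorem ff_eq (i : ℕ) (v : Ix d → ℂ) (z : Z) :
    ff i v z = ∑ q : Fin 2 × Mon d, v (Sum.inl q) * (zc z q.1 * Mc q.2.1 i z) := by
  have h : ∀ r, (linePoly (form v r) (zp z) (zw z)).coeff i = ∑ m : Mon d, v (Sum.inl (r, m)) * Mc m.1 i z := by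
    intro r
    unfold form linePoly
    rw [map_sum, Polynomial.finset_sum_coeff]
    refine Finset.sum_congr rfl fun m _ => ?_
    have : monomial m.1 (v (Sum.inl (r, m))) = v (Sum.inl (r, m)) • (monomial m.1 (1 : ℂ)) := by
      rw [smul_monomial, smul_eq_mul, mul_one]
    rw [this, map_smul, Polynomial.coeff_smul]; rfl
  have h2 : ff i v z = ∑ r, zc z r * (linePoly (form v r) (zp z) (zw z)).coeff i := by
    unfold ff member linePoly
    simp [Fin.sum_univ_two]
  rw [h2, Fintype.sum_prod_type]
  refine Finset.sum_congr rfl fun r _ => ?_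
  rw [h, Finset.mul_sum]
  exact Finset.sum_congr rfl fun m _ => by ring

theorem PF_pt (ty i) : PF (fun z => pt ty z i) := by
  fin_cases ty
  · exact PF_zp i
  · exact PF_zl i
  · fin_cases i
    · exact PF_zc 0
    · exact PF_zc 1
    · exact PF.const 0

theorem PF2.ofR {ι κ : Type} {g : (κ → ℂ) → ℂ} (h : PF g) : PF2 (fun (_ : ι → ℂ) z => g z) :=
  PF.comp (g := fun (y : ι ⊕ κ → ℂ) => fun l => y (Sum.inr l)) h (fun i => PF.var _)
theorem PF2.varL {ι κ : Type} (i : ι) : PF2 (fun (v : ι → ℂ) (_ : κ → ℂ) => v i) := PF.var (Sum.inl i)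
theorem PF2.add {ι κ : Type} {f g : (ι → ℂ) → (κ → ℂ) → ℂ} (hf : PF2 f) (hg : PF2 g) : PF2 (fun v z => f v z + g v z) :=
  PF.add hf hg
theorem PF2.mul {ι κ : Type} {f g : (ι → ℂ) → (κ → ℂ) → ℂ} (hf : PF2 f) (hg : PF2 g) : PF2 (fun v z => f v z * g v z) :=
  PF.mul hf hg
theorem PF2.sum {ι κ τ : Type} (s : Finset τ) {f : τ → (ι → ℂ) → (κ → ℂ) → ℂ} (hf : ∀ i ∈ s, PF2 (f i)) :
    PF2 (fun v z => ∑ i ∈ s, f i v z) := PF.sum s hf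
theorem PF2.list {ι κ τ : Type} (s : List τ) {f : τ → (ι → ℂ) → (κ → ℂ) → ℂ} (hf : ∀ i ∈ s, PF2 (f i)) :
    PF2 (fun v z => (s.map fun i => f i v z).prod) := by
  induction s with
  | nil => simpa using PF2.ofR (ι := ι) (PF.const (σ := κ) 1)
  | cons a s ih =>
    simp only [List.map_cons, List.prod_cons]
    exact (hf a (by simp)).mul (ih fun i hi => hf i (by simp [hi]))

theorem PF2_ff (i : ℕ) : PF2 (fun (v : Ix d → ℂ) z => ff i v z) := by
  simp only [ff_eq]
  exact PF2.sum _ fun q _ => (PF2.varL _).mul (PF2.ofR ((PF_zc _).mul (PF_Mc _ _)))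
theorem PF2_lin (ty) (a : Lbl d) : PF2 (fun (v : Ix d → ℂ) z => lin ty a v z) := by
  unfold lin
  exact PF2.sum _ fun q _ => (PF2.varL _).mul (PF2.ofR (PF_pt _ _))

end HF

namespace HF
open MvPolynomial

def Gen {ι : Type} (P : (ι → ℂ) → Prop) : Prop := ∃ Q : MvPolynomial ι ℂ, Q ≠ 0 ∧ ∀ v, eval v Q ≠ 0 → P v

theorem Gen.mono {ι : Type} {P P' : (ι → ℂ) → Prop} (h : Gen P) (hm : ∀ v, P v → P' v) : Gen P' := by
  obtain ⟨Q, h1, h2⟩ := h; exact ⟨Q, h1, fun v hv => hm v (h2 v hv)⟩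
theorem Gen.true {ι : Type} {P : (ι → ℂ) → Prop} (h : ∀ v, P v) : Gen P := ⟨1, one_ne_zero, fun v _ => h v⟩
theorem Gen.and {ι : Type} {P P' : (ι → ℂ) → Prop} (h : Gen P) (h' : Gen P') : Gen (fun v => P v ∧ P' v) := by
  obtain ⟨Q, h1, h2⟩ := h
  obtain ⟨Q', h1', h2'⟩ := h'
  refine ⟨Q * Q', mul_ne_zero h1 h1', fun v hv => ?_⟩
  rw [map_mul, mul_ne_zero_iff] at hv
  exact ⟨h2 v hv.1, h2' v hv.2⟩
theorem Gen.all {ι τ : Type} [Finite τ] {P : τ → (ι → ℂ) → Prop} (h : ∀ t, Gen (P t)) : Gen (fun v => ∀ t, P t v) := by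
  choose Q h1 h2 using h
  have := Fintype.ofFinite τ
  refine ⟨∏ t, Q t, Finset.prod_ne_zero_iff.2 fun t _ => h1 t, fun v hv t => h2 t v ?_⟩
  rw [map_prod, Finset.prod_ne_zero_iff] at hv
  exact hv t (Finset.mem_univ _)
theorem Gen.equiv {ι : Type} {P : (ι → ℂ) → Prop} (h : Gen P) (σ : ι ≃ ι) : Gen (fun v => P (v ∘ σ)) := by
  obtain ⟨Q, h1, h2⟩ := h
  refine ⟨rename σ Q, ?_, fun v hv => h2 _ ?_⟩
  · intro h; exact h1 ((rename_injective σ σ.injective) (by rw [h, map_zero]))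
  · rwa [eval_rename] at hv
theorem Gen.exists {ι : Type} {P : (ι → ℂ) → Prop} (h : Gen P) : ∃ v, P v := by
  obtain ⟨Q, h1, h2⟩ := h
  by_contra hn
  push Not at hn
  exact h1 (MvPolynomial.funext fun v => by
    rw [map_zero]; by_contra h; exact hn v (h2 v h))

/-! ### cells -/
def flagP (b : Fin 6) (x : Fin 3 → ℂ) : Fin 3 → ℂ :=
  match b with
  | 0 => ![1, x 0, x 1] | 1 => ![1, x 0, x 1] | 2 => ![0, 1, x 0] | 3 => ![0, 1, x 0] | 4 => ![0, 0, 1] | 5 => ![0, 0, 1]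
def flagW (b : Fin 6) (x : Fin 3 → ℂ) : Fin 3 → ℂ :=
  match b with
  | 0 => ![0, 1, x 2] | 1 => ![0, 0, 1] | 2 => ![1, 0, x 1] | 3 => ![0, 0, 1] | 4 => ![1, x 0, 0] | 5 => ![0, 1, 0]
def cellA (b : Fin 6) (x : Fin 3 → ℂ) : Z := mkZ (flagP b x) (flagW b x) ![0, 1]
def cellC (b : Fin 6) (x : Fin 3 → ℂ) : Z := mkZ (flagP b ![x 0, x 1, 0]) (flagW b ![x 0, x 1, 0]) ![1, x 2]

theorem flag_crs (b : Fin 6) (x : Fin 3 → ℂ) : crs (flagP b x) (flagW b x) ≠ 0 := by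
  intro h
  have h0 := congrFun h 0
  have h1 := congrFun h 1
  have h2 := congrFun h 2
  fin_cases b <;> simp [crs, flagP, flagW] at h0 h1 h2

theorem cellA_inX (b x) : InX (cellA b x) := ⟨flag_crs b x, fun h => by simpa [cellA] using congrFun h 1⟩
theorem cellC_inX (b x) : InX (cellC b x) := ⟨flag_crs b _, fun h => by simpa [cellC] using congrFun h 0⟩

theorem PF_cellA (b i) : PF (fun x => cellA b x i) := by
  rcases i with i | i | i <;> fin_cases b <;> fin_cases i <;>
    first | exact PF.const 0 | exact PF.const 1 | exact PF.var 0 | exact PF.var 1 | exact PF.var 2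
theorem PF_cellC (b i) : PF (fun x => cellC b x i) := by
  rcases i with i | i | i <;> fin_cases b <;> fin_cases i <;>
    first | exact PF.const 0 | exact PF.const 1 | exact PF.var 0 | exact PF.var 1 | exact PF.var 2

/-- every flag is equivalent to a standard one -/
theorem flag_cover (p w : Fin 3 → ℂ) (h : crs p w ≠ 0) : ∃ (b : Fin 6) (x : Fin 3 → ℂ) (α β γ : ℂ), α ≠ 0 ∧ β ≠ 0 ∧
    flagP b x = α • p ∧ flagW b x = β • w + γ • p ∧ (b = 0 → p 0 ≠ 0 ∧ crs p w 2 ≠ 0) := by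
  have e0 : crs p w 0 = p 1 * w 2 - p 2 * w 1 := rfl
  have e1 : crs p w 1 = p 2 * w 0 - p 0 * w 2 := rfl
  have e2 : crs p w 2 = p 0 * w 1 - p 1 * w 0 := rfl
  by_cases h0 : p 0 = 0
  · by_cases h1 : p 1 = 0
    · have h2 : p 2 ≠ 0 := by
        intro h2; apply h; funext i; fin_cases i <;> simp [crs, h0, h1, h2]
      by_cases hw : w 0 = 0
      · have hw1 : w 1 ≠ 0 := by
          intro hw1; apply h; funext i; fin_cases i <;> simp [crs, h0, h1, hw, hw1]
        refine ⟨5, 0, (p 2)⁻¹, (w 1)⁻¹, - (w 1)⁻¹ * w 2 / p 2, inv_ne_zero h2, inv_ne_zero hw1, ?_, ?_, by simp⟩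
        · funext i; fin_cases i <;> simp [flagP, h0, h1, h2]
        · funext i; fin_cases i <;> simp [flagW, h0, h1, hw, hw1]
          field_simp; ring
      · refine ⟨4, ![w 1 / w 0, 0, 0], (p 2)⁻¹, (w 0)⁻¹, - (w 0)⁻¹ * w 2 / p 2, inv_ne_zero h2, inv_ne_zero hw, ?_, ?_, by simp⟩
        · funext i; fin_cases i <;> simp [flagP, h0, h1, h2]
        · funext i; fin_cases i <;> simp [flagW, h0, h1, hw] <;> field_simp; ring
    · by_cases hw : w 0 = 0
      · have hl : p 1 * w 2 - p 2 * w 1 ≠ 0 := by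
          intro hl; apply h; funext i; fin_cases i <;> simp [crs, h0, hw, hl]
        refine ⟨3, ![p 2 / p 1, 0, 0], (p 1)⁻¹, p 1 / (p 1 * w 2 - p 2 * w 1), - w 1 / (p 1 * w 2 - p 2 * w 1),
          inv_ne_zero h1, div_ne_zero h1 hl, ?_, ?_, by simp⟩
        · funext i; fin_cases i <;> simp [flagP, h0, h1]; field_simp
        · funext i; fin_cases i <;> simp [flagW, h0, hw]
          · field_simp; ring
          · rw [div_mul_eq_mul_div, div_mul_eq_mul_div, ← add_div, eq_div_iff hl]; ring
      · refine ⟨2, ![p 2 / p 1, (w 2 - w 1 * p 2 / p 1) / w 0, 0], (p 1)⁻¹, (w 0)⁻¹, - (w 1 / (p 1 * w 0)),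
          inv_ne_zero h1, inv_ne_zero hw, ?_, ?_, by simp⟩
        · funext i; fin_cases i <;> simp [flagP, h0, h1]; field_simp
        · funext i; fin_cases i <;> simp [flagW, h0, hw] <;> field_simp <;> ring
  · by_cases h2 : p 0 * w 1 - p 1 * w 0 = 0
    · have hl : p 0 * w 2 - p 2 * w 0 ≠ 0 := by
        intro hl
        apply h
        have : p 0 * (p 1 * w 2 - p 2 * w 1) = 0 := by linear_combination p 1 * hl - p 2 * h2
        have := (mul_eq_zero.1 this).resolve_left h0
        funext i; fin_cases i
        · simpa [crs] using this
        · simp [crs]; linear_combination - hl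
        · simpa [crs] using h2
      refine ⟨1, ![p 1 / p 0, p 2 / p 0, 0], (p 0)⁻¹, p 0 / (p 0 * w 2 - p 2 * w 0), - w 0 / (p 0 * w 2 - p 2 * w 0),
          inv_ne_zero h0, div_ne_zero h0 hl, ?_, ?_, by simp⟩
      · funext i; fin_cases i <;> simp [flagP, h0] <;> field_simp
      · funext i; fin_cases i <;> simp [flagW]
        · field_simp; ring
        · rw [div_mul_eq_mul_div, div_mul_eq_mul_div, ← add_div, eq_comm, div_eq_zero_iff]; left
          linear_combination h2
        · rw [div_mul_eq_mul_div, div_mul_eq_mul_div, ← add_div, eq_div_iff hl]; ring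
    · refine ⟨0, ![p 1 / p 0, p 2 / p 0, (p 0 * w 2 - p 2 * w 0) / (p 0 * w 1 - p 1 * w 0)], (p 0)⁻¹,
          p 0 / (p 0 * w 1 - p 1 * w 0), - w 0 / (p 0 * w 1 - p 1 * w 0),
          inv_ne_zero h0, div_ne_zero h0 h2, ?_, ?_, fun _ => ⟨h0, by rw [e2]; exact h2⟩⟩
      · funext i; fin_cases i <;> simp [flagP, h0] <;> field_simp
      · funext i; fin_cases i <;> simp [flagW]
        · field_simp; ring
        · rw [div_mul_eq_mul_div, div_mul_eq_mul_div, ← add_div, eq_div_iff h2]; ring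
        · rw [div_mul_eq_mul_div, div_mul_eq_mul_div, ← add_div, div_left_inj' h2]; ring

theorem cell_cover {z : Z} (hz : InX z) (hR : ¬ InR z) : ∃ b x, Rel z (cellA b x) ∨ Rel z (cellC b x) := by
  obtain ⟨b, x, α, β, γ, ha, hb, h1, h2, h3⟩ := flag_cover (zp z) (zw z) hz.1
  by_cases hc : zc z 0 = 0
  · have hc1 : zc z 1 ≠ 0 := by
      intro hc1; apply hz.2; funext i; fin_cases i
      · exact hc
      · exact hc1
    refine ⟨b, x, Or.inl ⟨α, β, γ, (zc z 1)⁻¹, ha, hb, inv_ne_zero hc1, ?_⟩⟩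
    rw [cellA, h1, h2]; congr 1
    funext i; fin_cases i <;> simp [hc, hc1]
  · have hb0 : b ≠ 0 := fun h => hR ⟨(h3 h).1, (h3 h).2, hc⟩
    refine ⟨b, ![x 0, x 1, zc z 1 / zc z 0], Or.inr ⟨α, β, γ, (zc z 0)⁻¹, ha, hb, inv_ne_zero hc, ?_⟩⟩
    have a1 : flagP b ![x 0, x 1, 0] = flagP b x := by fin_cases b <;> simp [flagP]
    have a2 : flagW b ![x 0, x 1, 0] = flagW b x := by fin_cases b <;> simp [flagW] at hb0 ⊢
    have a3 : cellC b ![x 0, x 1, zc z 1 / zc z 0] = mkZ (flagP b x) (flagW b x) ![1, zc z 1 / zc z 0] := by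
      rw [← a1, ← a2]; rfl
    rw [a3, h1, h2]; congr 1
    · funext i; fin_cases i <;> simp [hc]; field_simp

/-- triangular surjectivity at all points -/
def Tri {ι : Type} {n : ℕ} (I : Finset ι) (E : Fin n → (ι → ℂ) → Z → ℂ) : Prop :=
  ∀ v z, InX z → ∀ e, ∃ u : ι → ℂ, (∀ i, i ∉ I → u i = 0) ∧ (∀ e' < e, E e' (v + u) z = E e' v z) ∧
      E e (v + u) z ≠ E e v z

theorem pull_gen {ι : Type} [Fintype ι] [DecidableEq ι] {n k : ℕ} (hk : k < n) (I : Finset ι)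
    (E : Fin n → (ι → ℂ) → Z → ℂ) (hE : ∀ e, PF2 (E e)) (hA : ∀ e, AffOn I (E e)) (hT : Tri I E)
    (cell : (Fin k → ℂ) → Z) (hc : ∀ i, PF (fun x => cell x i)) (hX : ∀ x, InX (cell x)) :
    Gen (fun v => ∀ x, ¬ ∀ e, E e v (cell x) = 0) := by
  obtain ⟨Q, h1, h2⟩ := generic_empty hk I (fun e v x => E e v (cell x)) (fun e => by
      refine PF.comp (hE e) (g := fun y : ι ⊕ Fin k → ℂ => Sum.elim (fun i => y (Sum.inl i)) (cell fun l => y (Sum.inr l))) ?_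
      rintro (i | i)
      · exact PF.var _
      · exact PF.comp (hc i) (g := fun y : ι ⊕ Fin k → ℂ => fun l => y (Sum.inr l)) (fun l => PF.var _))
    (fun e v x => hA e v (cell x))
  exact ⟨Q, h1, fun v hv x => h2 v hv x (surj_of_tri (hT v _ (hX x)))⟩

theorem gen_boundary {ι : Type} [Fintype ι] [DecidableEq ι] {n : ℕ} (hn : 3 < n) (I : Finset ι)
    (E : Fin n → (ι → ℂ) → Z → ℂ) (hE : ∀ e, PF2 (E e)) (hA : ∀ e, AffOn I (E e)) (hT : Tri I E)
    (hB : ∀ v z z', Rel z z' → (∀ e, E e v z = 0) → ∀ e, E e v z' = 0) :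
    Gen (fun v => ∀ z, InX z → (∀ e, E e v z = 0) → InR z) := by
  have h1 := Gen.all fun b => pull_gen hn I E hE hA hT (cellA b) (PF_cellA b) (cellA_inX b)
  have h2 := Gen.all fun b => pull_gen hn I E hE hA hT (cellC b) (PF_cellC b) (cellC_inX b)
  refine (h1.and h2).mono fun v hv z hz h0 => ?_
  by_contra hR
  obtain ⟨b, x, h | h⟩ := cell_cover hz hR
  · exact hv.1 b x (hB v _ _ h h0)
  · exact hv.2 b x (hB v _ _ h h0)

theorem gen_empty5 {ι : Type} [Fintype ι] [DecidableEq ι] (I : Finset ι)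
    (E : Fin 5 → (ι → ℂ) → Z → ℂ) (hE : ∀ e, PF2 (E e)) (hA : ∀ e, AffOn I (E e)) (hT : Tri I E)
    (hB : ∀ v z z', Rel z z' → (∀ e, E e v z = 0) → ∀ e, E e v z' = 0) :
    Gen (fun v => ∀ z, InX z → ¬ ∀ e, E e v z = 0) := by
  refine ((gen_boundary (by norm_num) I E hE hA hT hB).and
    (pull_gen (by norm_num) I E hE hA hT big big_PF (fun x => (inR_big x).inX))).mono fun v hv z hz h0 => ?_
  exact hv.2 _ (hB v _ _ (hv.1 z hz h0).rel_big h0)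

theorem gen_good {ι : Type} [Fintype ι] [DecidableEq ι] (I : Finset ι)
    (E : (ι → ℂ) → Fin 4 → Z → ℂ) (hR : Reg E) (hA : ∀ e, AffOn I (fun v z => E v e z))
    (hT : Tri I (fun e v z => E v e z)) : Gen (fun v => Good (E v)) := by
  have h1 := gen_boundary (by norm_num) I (fun e v z => E v e z) hR.pf hA hT (fun v z z' h => hR.inv v z z' h)
  obtain ⟨Q, h2, h3⟩ := generic_nondeg I (fun e v x => E v e (big x)) (fun e => by
      refine PF.comp (hR.pf e) (g := fun y : ι ⊕ Fin 4 → ℂ => Sum.elim (fun i => y (Sum.inl i)) (big fun l => y (Sum.inr l))) ?_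
      rintro (i | i)
      · exact PF.var _
      · exact PF.comp (big_PF i) (g := fun y : ι ⊕ Fin 4 → ℂ => fun l => y (Sum.inr l)) (fun l => PF.var _))
    (fun e v x => hA e v (big x))
  have h4 : Gen (fun v => ∀ x, (∀ e, E v e (big x) = 0) → ∀ ξ, (∀ e, fderiv ℂ (fun x => E v e (big x)) x ξ = 0) → ξ = 0) :=
    ⟨Q, h2, fun v hv x => h3 v hv x (surj_of_tri (hT v _ (inR_big x).inX))⟩
  exact (h1.and h4).mono fun v hv => ⟨hv.1, hv.2⟩

/-! ### affinity calculus -/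
def InvOn {ι X : Type} (I : Finset ι) (g : (ι → ℂ) → X → ℂ) : Prop :=
  ∀ v v' x, (∀ i, i ∉ I → v i = v' i) → g v x = g v' x
def Aff {ι X : Type} (I : Finset ι) (g : (ι → ℂ) → X → ℂ) : Prop :=
  ∃ (R : (ι → ℂ) → X → ℂ) (T : ι → (ι → ℂ) → X → ℂ), InvOn I R ∧ (∀ i, InvOn I (T i)) ∧
    ∀ v x, g v x = R v x + ∑ i ∈ I, v i * T i v x

theorem Aff.affOn {ι X : Type} [DecidableEq ι] {I : Finset ι} {g : (ι → ℂ) → X → ℂ} (h : Aff I g) : AffOn I g := by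
  obtain ⟨R, T, hR, hT, h⟩ := h
  intro v x
  have a : ∀ i, i ∉ I → v i = z0 I v i := fun i hi => by simp [z0, hi]
  have b : ∀ j ∈ I, ∀ i, i ∉ I → v i = (z0 I v + Pi.single j 1 : ι → ℂ) i := fun j hj i hi => by
    have : i ≠ j := fun h => hi (h ▸ hj)
    simp [z0, hi, this]
  have g0 : g (z0 I v) x = R v x := by
    rw [h, ← hR v _ x a, Finset.sum_eq_zero, add_zero]
    intro i hi; simp [z0, hi]
  rw [h v x, g0]
  congr 1
  refine Finset.sum_congr rfl fun j hj => ?_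
  rw [h, ← hR v _ x (b j hj), add_sub_cancel_left, Finset.sum_eq_single j]
  · rw [← hT j v _ x (b j hj)]; simp [z0, hj]
  · intro i hi hij
    simp [z0, hi, hij]
  · intro h; exact absurd hj h

theorem InvOn.aff {ι X : Type} {I : Finset ι} {g : (ι → ℂ) → X → ℂ} (h : InvOn I g) : Aff I g :=
  ⟨g, fun _ _ _ => 0, h, fun _ _ _ _ _ => rfl, fun v x => by simp⟩
theorem Aff.add {ι X : Type} {I : Finset ι} {g g' : (ι → ℂ) → X → ℂ} (h : Aff I g) (h' : Aff I g') :
    Aff I (fun v x => g v x + g' v x) := by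
  obtain ⟨R, T, hR, hT, h⟩ := h
  obtain ⟨R', T', hR', hT', h'⟩ := h'
  refine ⟨fun v x => R v x + R' v x, fun i v x => T i v x + T' i v x, fun v v' x hv => ?_, fun i v v' x hv => ?_, fun v x => ?_⟩
  · show _ + _ = _ + _; rw [hR v v' x hv, hR' v v' x hv]
  · show _ + _ = _ + _; rw [hT i v v' x hv, hT' i v v' x hv]
  · simp only [h, h', mul_add, Finset.sum_add_distrib]; ring
theorem Aff.mul {ι X : Type} {I : Finset ι} {g g' : (ι → ℂ) → X → ℂ} (h : InvOn I g) (h' : Aff I g') :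
    Aff I (fun v x => g v x * g' v x) := by
  obtain ⟨R', T', hR', hT', h'⟩ := h'
  refine ⟨fun v x => g v x * R' v x, fun i v x => g v x * T' i v x, fun v v' x hv => ?_, fun i v v' x hv => ?_, fun v x => ?_⟩
  · show _ * _ = _ * _; rw [h v v' x hv, hR' v v' x hv]
  · show _ * _ = _ * _; rw [h v v' x hv, hT' i v v' x hv]
  · simp only [h', mul_add, Finset.mul_sum]; congr 1; exact Finset.sum_congr rfl fun i _ => by ring
theorem Aff.sum {ι X τ : Type} {I : Finset ι} (s : Finset τ) {g : τ → (ι → ℂ) → X → ℂ} (h : ∀ t ∈ s, Aff I (g t)) :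
    Aff I (fun v x => ∑ t ∈ s, g t v x) := by
  classical
  induction s using Finset.induction_on with
  | empty => simpa using (InvOn.aff (I := I) (g := fun (_ : ι → ℂ) (_ : X) => (0 : ℂ)) fun _ _ _ _ => rfl)
  | insert a s ha ih =>
    simp only [Finset.sum_insert ha]
    exact (h a (by simp)).add (ih fun t ht => h t (by simp [ht]))
theorem Aff.var {ι X : Type} {I : Finset ι} (i : ι) (k : X → ℂ) : Aff I (fun v x => v i * k x) := by
  classical
  by_cases hi : i ∈ I
  · refine ⟨fun _ _ => 0, fun j _ x => if j = i then k x else 0, fun _ _ _ _ => rfl, fun _ _ _ _ _ => rfl, fun v x => ?_⟩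
    simp [hi]
  · exact InvOn.aff fun v v' x hv => by simp only [hv i hi]

theorem InvOn.list {ι X τ : Type} {I : Finset ι} (s : List τ) {g : τ → (ι → ℂ) → X → ℂ} (h : ∀ t ∈ s, InvOn I (g t)) :
    InvOn I (fun v x => (s.map fun t => g t v x).prod) := by
  intro v v' x hv
  show (s.map fun t => g t v x).prod = _
  congr 1
  exact List.map_congr_left fun t ht => h t ht v v' x hv

end HF

namespace HF
open MvPolynomial
variable {d : ℕ}

/-! ### forms adapted to a flag -/
def linForm (a : Fin 3 → ℂ) : MvPolynomial (Fin 3) ℂ := ∑ i, C (a i) * X i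
def dotp (a p : Fin 3 → ℂ) : ℂ := ∑ i, a i * p i
theorem linForm_hom (a : Fin 3 → ℂ) : (linForm a).IsHomogeneous 1 :=
  IsHomogeneous.sum _ _ _ fun i _ => (isHomogeneous_X _ _).C_mul _
theorem linePoly_linForm (a p w : Fin 3 → ℂ) :
    linePoly (linForm a) p w = Polynomial.C (dotp a p) + Polynomial.X * Polynomial.C (dotp a w) := by
  simp [linePoly, linForm, dotp, Fin.sum_univ_three]; ring
theorem linePoly_mul (F G : MvPolynomial (Fin 3) ℂ) (p w) : linePoly (F * G) p w = linePoly F p w * linePoly G p w := by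
  simp [linePoly]
theorem linePoly_pow (F : MvPolynomial (Fin 3) ℂ) (n : ℕ) (p w) : linePoly (F ^ n) p w = linePoly F p w ^ n := by
  simp [linePoly]

theorem exists_dual {p w : Fin 3 → ℂ} (h : crs p w ≠ 0) : ∃ a b : Fin 3 → ℂ,
    dotp a p = 1 ∧ dotp a w = 0 ∧ dotp b p = 0 ∧ dotp b w = 1 := by
  obtain ⟨i, hi⟩ := Function.ne_iff.1 h
  refine ⟨(crs p w i)⁻¹ • crs w (Pi.single i 1), (crs p w i)⁻¹ • crs (Pi.single i 1) p, ?_⟩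
  have hi : crs p w i ≠ 0 := hi
  have e : ∀ (a q : Fin 3 → ℂ), dotp ((crs p w i)⁻¹ • a) q = (crs p w i)⁻¹ * dotp a q := by
    intro a q; simp [dotp, Finset.mul_sum, mul_assoc]
  rw [e, e, e, e]
  have h1 : dotp (crs w (Pi.single i 1)) p = crs p w i := by
    fin_cases i <;> simp [crs, dotp, Fin.sum_univ_three] <;> ring
  have h2 : dotp (crs w (Pi.single i 1)) w = 0 := by
    fin_cases i <;> simp [crs, dotp, Fin.sum_univ_three] <;> ring
  have h3 : dotp (crs (Pi.single i 1) p) p = 0 := by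
    fin_cases i <;> simp [crs, dotp, Fin.sum_univ_three] <;> ring
  have h4 : dotp (crs (Pi.single i 1) p) w = crs p w i := by
    fin_cases i <;> simp [crs, dotp, Fin.sum_univ_three] <;> ring
  rw [h1, h2, h3, h4]
  simp [hi]

theorem exists_form {p w : Fin 3 → ℂ} (h : crs p w ≠ 0) (e : ℕ) (he : e ≤ d) :
    ∃ P : MvPolynomial (Fin 3) ℂ, P.IsHomogeneous d ∧ linePoly P p w = Polynomial.X ^ e := by
  obtain ⟨a, b, h1, h2, h3, h4⟩ := exists_dual h
  refine ⟨linForm a ^ (d - e) * linForm b ^ e, ?_, ?_⟩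
  · have := ((linForm_hom a).pow (d - e)).mul ((linForm_hom b).pow e)
    convert this using 1; omega
  · rw [linePoly_mul, linePoly_pow, linePoly_pow, linePoly_linForm, linePoly_linForm, h1, h2, h3, h4]; simp

theorem zc_ne {z : Z} (h : zc z ≠ 0) : ∃ r, zc z r ≠ 0 := Function.ne_iff.1 h

theorem ff_vary (z : Z) (hz : InX z) (e : ℕ) (he : e ≤ d) : ∃ u : Ix d → ℂ, (∀ i, u (Sum.inr i) = 0) ∧
    ∀ v, (∀ i, i ≠ e → ff i (v + u) z = ff i v z) ∧ ff e (v + u) z ≠ ff e v z := by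
  obtain ⟨P, hP, hl⟩ := exists_form (d := d) hz.1 e he
  obtain ⟨r, hr⟩ := zc_ne hz.2
  refine ⟨formVec P r, fun i => rfl, fun v => ⟨fun i hi => ?_, ?_⟩⟩
  · rw [ff_add_formVec hP, hl, Polynomial.coeff_X_pow, if_neg hi]; simp
  · rw [ff_add_formVec hP, hl, Polynomial.coeff_X_pow, if_pos rfl]; simpa using hr

theorem lin_congr {ty : Fin 3} {a : Lbl d} {v v' : Ix d → ℂ} (h : ∀ i, v (Sum.inr (Sum.inl (a, i))) = v' (Sum.inr (Sum.inl (a, i)))) (z : Z) :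
    lin ty a v z = lin ty a v' z := by
  unfold lin; exact Finset.sum_congr rfl fun i _ => by rw [h i]
theorem ff_congr {i : ℕ} {v v' : Ix d → ℂ} (h : ∀ q, v (Sum.inl q) = v' (Sum.inl q)) (z : Z) : ff i v z = ff i v' z := by
  rw [ff_eq, ff_eq]; exact Finset.sum_congr rfl fun q _ => by rw [h q]

theorem pt_ne {z : Z} (hz : InX z) (ty : Fin 3) : ∃ i, pt ty z i ≠ 0 := by
  fin_cases ty
  · refine Function.ne_iff.1 (fun h => hz.1 ?_)
    have h : zp z = 0 := h
    simp [zl, crs, h]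
  · exact Function.ne_iff.1 hz.1
  · obtain ⟨r, hr⟩ := zc_ne hz.2
    fin_cases r
    · exact ⟨0, hr⟩
    · exact ⟨1, hr⟩

theorem lin_vary (z : Z) (hz : InX z) (ty : Fin 3) (a : Lbl d) : ∃ u : Ix d → ℂ,
    (∀ k, (∀ i, k ≠ Sum.inr (Sum.inl (a, i))) → u k = 0) ∧ ∀ v, lin ty a (v + u) z ≠ lin ty a v z := by
  classical
  obtain ⟨i, hi⟩ := pt_ne hz ty
  refine ⟨Pi.single (Sum.inr (Sum.inl (a, i))) 1, fun k hk => Pi.single_eq_of_ne (hk i) _, fun v => ?_⟩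
  have : lin ty a (v + Pi.single (Sum.inr (Sum.inl (a, i))) 1) z = lin ty a v z + pt ty z i := by
    simp [lin, add_mul, Finset.sum_add_distrib, Pi.single_apply]
  rw [this]; simpa using hi

/-! ### scaling -/
def wt (ty : Fin 3) (α β κ : ℂ) : ℂ := match ty with | 0 => α | 1 => α * β | 2 => κ

theorem pt_rel (z : Z) (α β γ κ : ℂ) (ty : Fin 3) :
    pt ty (mkZ (α • zp z) (β • zw z + γ • zp z) (κ • zc z)) = wt ty α β κ • pt ty z := by
  fin_cases ty
  · rfl
  · simp only [pt, zl, zp_mkZ, zw_mkZ, crs_rel]; rfl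
  · funext i; fin_cases i <;> simp [pt, wt]

theorem lin_rel (z : Z) (α β γ κ : ℂ) (ty : Fin 3) (a : Lbl d) (v : Ix d → ℂ) :
    lin ty a v (mkZ (α • zp z) (β • zw z + γ • zp z) (κ • zc z)) = wt ty α β κ * lin ty a v z := by
  simp only [lin, pt_rel, Pi.smul_apply, smul_eq_mul, Finset.mul_sum]
  exact Finset.sum_congr rfl fun i _ => by ring

theorem ff_rel (z : Z) {α : ℂ} (β γ κ : ℂ) (ha : α ≠ 0) (v : Ix d → ℂ) (j : ℕ) (hj : j ≤ d) (h0 : ∀ i < j, ff i v z = 0) :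
    ff j v (mkZ (α • zp z) (β • zw z + γ • zp z) (κ • zc z)) = κ * α ^ (d - j) * β ^ j * ff j v z := by
  have e : member v (κ • zc z) = κ • member v (zc z) := by
    simp [member, mul_smul]
  unfold ff
  simp only [zp_mkZ, zw_mkZ, zc_mkZ, e]
  have e2 : ∀ p w, linePoly (κ • member v (zc z)) p w = κ • linePoly (member v (zc z)) p w := by
    intro p w; simp [linePoly]
  rw [e2, Polynomial.coeff_smul, linePoly_rel_coeff (member_hom v (zc z)) (zp z) (zw z) β γ ha j hj h0, smul_eq_mul]
  ring

/-! ### the systems -/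
def Sys (j : ℕ) (t : Fin 4 → Fin 3) (v : Ix d → ℂ) (e : Fin 4) : Z → ℂ :=
  if e.val < j then ff e.val v else lin (t e) (Sum.inl e) v
def xlin (q : Fin 3 × Fin (d + 3)) (v : Ix d → ℂ) : Z → ℂ := lin q.1 (Sum.inr q) v
def part (d : ℕ) (ty : Fin 3) (n : ℕ) : List (Fin 3 × Fin (d + 3)) := ((List.finRange (d + 3)).take n).map (fun r => (ty, r))
def listM (d j : ℕ) : List (Fin 3 × Fin (d + 3)) := part d 0 (2 * j)
def listK (d j : ℕ) : List (Fin 3 × Fin (d + 3)) := part d 0 d ++ part d 1 j ++ part d 2 1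
def fam (j : ℕ) (v : Ix d → ℂ) (z : Z) : ℂ :=
  v (Sum.inr (Sum.inr (Sum.inr 0))) * ((listM d j).map fun q => xlin q v z).prod * ff j v z +
  (∑ q : Fin 3 × Fin 3 × Fin 2, v (Sum.inr (Sum.inr (Sum.inl q))) * (zp z q.1 ^ d * zl z q.2.1 ^ j * zc z q.2.2)) +
  v (Sum.inr (Sum.inr (Sum.inr 1))) * ((listK d j).map fun q => xlin q v z).prod
def Fam (j : Fin 4) (t : Fin 4 → Fin 3) (v : Ix d → ℂ) : Fin 4 → Z → ℂ := Function.update (Sys j.val t v) j (fam j.val v)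

theorem part_length (ty n) (hn : n ≤ d + 3) : (part d ty n).length = n := by simp [part, hn]
theorem part_nodup (ty n) : (part d ty n).Nodup :=
  ((List.nodup_finRange _).sublist (List.take_sublist _ _)).map (fun a b h => (Prod.mk.inj h).2)
theorem part_mem {ty n} {q : Fin 3 × Fin (d + 3)} (h : q ∈ part d ty n) : q.1 = ty := by
  simp only [part, List.mem_map] at h
  obtain ⟨r, -, rfl⟩ := h; rfl
theorem listK_nodup (j) : (listK d j).Nodup := by
  refine ((part_nodup 0 d).append (part_nodup 1 j) ?_).append (part_nodup 2 1) ?_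
  · intro q h1 h2
    have := (part_mem h1).symm.trans (part_mem h2)
    exact absurd this (by decide)
  · intro q h1 h2
    have h2 := part_mem h2
    rcases List.mem_append.1 h1 with h | h
    · have := (part_mem h).symm.trans h2; exact absurd this (by decide)
    · have := (part_mem h).symm.trans h2; exact absurd this (by decide)

theorem part_prod_rel (z : Z) (α β γ κ : ℂ) (ty : Fin 3) (n : ℕ) (hn : n ≤ d + 3) (v : Ix d → ℂ) :
    ((part d ty n).map fun q => xlin q v (mkZ (α • zp z) (β • zw z + γ • zp z) (κ • zc z))).prod =
      wt ty α β κ ^ n * ((part d ty n).map fun q => xlin q v z).prod := by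
  have : (part d ty n).map (fun q => xlin q v (mkZ (α • zp z) (β • zw z + γ • zp z) (κ • zc z))) =
      (part d ty n).map (fun q => wt ty α β κ * xlin q v z) := by
    refine List.map_congr_left fun q hq => ?_
    rw [xlin, lin_rel, part_mem hq]
  rw [this, List.prod_map_mul, List.map_const', List.prod_replicate, part_length ty n hn]

theorem fam_rel (hd : 3 ≤ d) (z : Z) {α : ℂ} (β γ κ : ℂ) (ha : α ≠ 0) (v : Ix d → ℂ) (j : ℕ) (hj : j ≤ 3) (h0 : ∀ i < j, ff i v z = 0) :
    fam j v (mkZ (α • zp z) (β • zw z + γ • zp z) (κ • zc z)) = κ * α ^ (d + j) * β ^ j * fam j v z := by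
  unfold fam
  rw [ff_rel z β γ κ ha v j (by omega) h0, listM, listK, List.map_append, List.map_append, List.prod_append,
    List.prod_append, List.map_append, List.map_append, List.prod_append, List.prod_append,
    part_prod_rel _ _ _ _ _ _ _ (by omega), part_prod_rel _ _ _ _ _ _ _ (by omega),
    part_prod_rel _ _ _ _ _ _ _ (by omega), part_prod_rel _ _ _ _ _ _ _ (by omega)]
  have e1 : α ^ (d + j) = α ^ (2 * j) * α ^ (d - j) := by rw [← pow_add]; congr 1; omega
  have e2 : ∀ q : Fin 3 × Fin 3 × Fin 2, v (Sum.inr (Sum.inr (Sum.inl q))) * (zp (mkZ (α • zp z) (β • zw z + γ • zp z) (κ • zc z)) q.1 ^ d * zl (mkZ (α • zp z) (β • zw z + γ • zp z) (κ • zc z)) q.2.1 ^ j * zc (mkZ (α • zp z) (β • zw z + γ • zp z) (κ • zc z)) q.2.2)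
      = κ * α ^ (d + j) * β ^ j * (v (Sum.inr (Sum.inr (Sum.inl q))) * (zp z q.1 ^ d * zl z q.2.1 ^ j * zc z q.2.2)) := by
    intro q
    simp only [zl, zp_mkZ, zw_mkZ, zc_mkZ, crs_rel, Pi.smul_apply, smul_eq_mul, mul_pow, pow_add]
    ring
  rw [Finset.sum_congr rfl fun q _ => e2 q, ← Finset.mul_sum]
  simp only [wt]
  rw [mul_add, mul_add]
  congr 1
  · congr 1
    rw [e1]; ring
  · rw [pow_add]; ring

theorem sys_lt {j : ℕ} {t : Fin 4 → Fin 3} {v : Ix d → ℂ} {e : Fin 4} (h : e.val < j) : Sys j t v e = ff e.val v := if_pos h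
theorem sys_ge {j : ℕ} {t : Fin 4 → Fin 3} {v : Ix d → ℂ} {e : Fin 4} (h : ¬ e.val < j) : Sys j t v e = lin (t e) (Sum.inl e) v := if_neg h

/-- each equation of `Sys`, given the vanishing of the previous ones, is semi-invariant -/
theorem sys_rel (hd : 3 ≤ d) {j : ℕ} {t : Fin 4 → Fin 3} {v : Ix d → ℂ} {z z' : Z} (h : Rel z z') (e : Fin 4)
    (h0 : ∀ e' ≤ e, Sys j t v e' z = 0) : Sys j t v e z' = 0 := by
  obtain ⟨α, β, γ, κ, ha, hb, hk, rfl⟩ := h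
  by_cases he : e.val < j
  · rw [sys_lt he, ff_rel z β γ κ ha v e.val (by omega), ← sys_lt (t := t) he, h0 e le_rfl, mul_zero]
    intro i hi
    have := h0 ⟨i, by omega⟩ (Fin.mk_le_of_le_val hi.le)
    rwa [sys_lt (show i < j by omega)] at this
  · rw [sys_ge he, lin_rel, ← sys_ge he, h0 e le_rfl, mul_zero]

theorem Sys_reg (hd : 3 ≤ d) (j : ℕ) (t : Fin 4 → Fin 3) : Reg (fun v : Ix d → ℂ => Sys j t v) := by
  refine ⟨fun e => ?_, fun v z z' h h0 e => sys_rel hd h e fun e' _ => h0 e'⟩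
  by_cases he : e.val < j
  · simp only [sys_lt he]; exact PF2_ff _
  · simp only [sys_ge he]; exact PF2_lin _ _

theorem PF2_fam (j : ℕ) : PF2 (fun (v : Ix d → ℂ) z => fam j v z) := by
  unfold fam
  refine ((((PF2.varL _).mul (PF2.list _ fun q _ => PF2_lin _ _)).mul (PF2_ff _)).add (PF2.sum _ fun q _ =>
    (PF2.varL _).mul (PF2.ofR ?_))).add ((PF2.varL _).mul (PF2.list _ fun q _ => PF2_lin _ _))
  exact (((PF_zp _).pow _).mul ((PF_zl _).pow _)).mul (PF_zc _)

theorem Fam_reg (hd : 3 ≤ d) (j : Fin 4) (t : Fin 4 → Fin 3) : Reg (fun v : Ix d → ℂ => Fam j t v) := by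
  refine ⟨fun e => ?_, fun v z z' h h0 => ?_⟩
  · by_cases he : e = j
    · subst he
      simp only [Fam, Function.update_self]; exact PF2_fam _
    · simp only [Fam, Function.update_of_ne he]; exact (Sys_reg hd _ t).pf e
  · rw [Fam, zero_update] at h0 ⊢
    have hs : ∀ e, e ≠ j → Sys j.val t v e z' = 0 := by
      intro e he
      by_cases hlt : e.val < j.val
      · refine sys_rel hd h e fun e' he' => h0.2 e' ?_
        intro h; rw [h] at he'
        have : j.val ≤ e.val := he'
        omega
      · obtain ⟨α, β, γ, κ, ha, hb, hk, rfl⟩ := h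
        rw [sys_ge hlt, lin_rel, ← sys_ge hlt, h0.2 e he, mul_zero]
    refine ⟨?_, hs⟩
    obtain ⟨α, β, γ, κ, ha, hb, hk, rfl⟩ := h
    rw [fam_rel hd z β γ κ ha v j.val (by omega), h0.1, mul_zero]
    intro i hi
    have := h0.2 ⟨i, by omega⟩ (by intro h; rw [← h] at hi; exact lt_irrefl _ hi)
    rwa [sys_lt hi] at this

theorem Aff_ff (I : Finset (Ix d)) (i : ℕ) : Aff I (fun (v : Ix d → ℂ) z => ff i v z) := by
  simp only [ff_eq]; exact Aff.sum _ fun q _ => Aff.var _ _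
theorem Aff_lin (I : Finset (Ix d)) (ty a) : Aff I (fun (v : Ix d → ℂ) z => lin ty a v z) := by
  unfold lin; exact Aff.sum _ fun q _ => Aff.var _ _
theorem Aff_Sys (I : Finset (Ix d)) (j t e) : Aff I (fun (v : Ix d → ℂ) z => Sys j t v e z) := by
  by_cases he : e.val < j
  · simp only [sys_lt he]; exact Aff_ff _ _
  · simp only [sys_ge he]; exact Aff_lin _ _ _

/-- variation of a single equation of `Sys` -/
theorem sys_vary (hd : 3 ≤ d) (j : ℕ) (t : Fin 4 → Fin 3) (z : Z) (hz : InX z) (e : Fin 4) : ∃ u : Ix d → ℂ,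
    (∀ q i, u (Sum.inr (Sum.inl (Sum.inr q, i))) = 0) ∧ (∀ i, u (Sum.inr (Sum.inr i)) = 0) ∧
    ∀ v, (∀ e' < e, Sys j t (v + u) e' z = Sys j t v e' z) ∧ (∀ i < e.val, ff i (v + u) z = ff i v z) ∧
      Sys j t (v + u) e z ≠ Sys j t v e z := by
  by_cases he : e.val < j
  · obtain ⟨u, h1, h2⟩ := ff_vary (d := d) z hz e.val (by omega)
    refine ⟨u, fun q i => h1 _, fun i => h1 _, fun v => ⟨fun e' he' => ?_, fun i hi => (h2 v).1 i hi.ne, ?_⟩⟩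
    · have : e'.val < e.val := he'
      rw [sys_lt (show e'.val < j by omega), sys_lt (show e'.val < j by omega)]
      exact (h2 v).1 _ this.ne
    · rw [sys_lt he, sys_lt he]; exact (h2 v).2
  · obtain ⟨u, h1, h2⟩ := lin_vary (d := d) z hz (t e) (Sum.inl e)
    have hf : ∀ v i, ff i (v + u) z = ff i v z := fun v i => ff_congr (fun q => by simp [h1 (Sum.inl q) (by simp)]) z
    refine ⟨u, fun q i => h1 _ (by simp), fun i => h1 _ (by simp), fun v => ⟨fun e' he' => ?_, fun i hi => hf v i, ?_⟩⟩
    · by_cases h : e'.val < j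
      · rw [sys_lt h, sys_lt h]; exact hf v _
      · rw [sys_ge h, sys_ge h]
        refine lin_congr (fun i => ?_) z
        have : u (Sum.inr (Sum.inl (Sum.inl e', i))) = 0 := h1 _ (by
          intro i' h; simp at h; exact absurd h.1 he'.ne)
        simp [this]
    · rw [sys_ge he, sys_ge he]; exact h2 v

theorem gen_Sys (hd : 3 ≤ d) (j : ℕ) (t : Fin 4 → Fin 3) : Gen (fun v : Ix d → ℂ => Good (Sys j t v)) := by
  classical
  refine gen_good Finset.univ (fun v : Ix d → ℂ => Sys j t v) (Sys_reg hd j t) (fun e => (Aff_Sys _ j t e).affOn) ?_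
  intro v z hz e
  obtain ⟨u, -, -, h⟩ := sys_vary (d := d) hd j t z hz e
  exact ⟨u, fun i hi => absurd (Finset.mem_univ i) hi, (h v).1, (h v).2.2⟩

def isI : Ix d → Bool
  | Sum.inl _ => true
  | Sum.inr (Sum.inl (Sum.inl _, _)) => true
  | Sum.inr (Sum.inl (Sum.inr _, _)) => false
  | Sum.inr (Sum.inr (Sum.inl _)) => true
  | Sum.inr (Sum.inr (Sum.inr _)) => false
def I1 (d : ℕ) : Finset (Ix d) := Finset.univ.filter (fun i => isI i = true)
theorem mem_I1 {i : Ix d} : i ∈ I1 d ↔ isI i = true := by simp [I1]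

theorem Inv_xlin (q) : InvOn (I1 d) (fun v z => xlin q v z) := by
  intro v v' z h
  exact lin_congr (fun i => h _ (by simp [mem_I1, isI])) z

theorem InvOn.mul {ι X : Type} {I : Finset ι} {g g' : (ι → ℂ) → X → ℂ} (h : InvOn I g) (h' : InvOn I g') :
    InvOn I (fun v x => g v x * g' v x) := by
  intro v v' x hv
  show _ * _ = _ * _
  rw [h v v' x hv, h' v v' x hv]

theorem Aff_fam (j : ℕ) : Aff (I1 d) (fun v z => fam j v z) := by
  have he : ∀ i, InvOn (I1 d) (fun (v : Ix d → ℂ) (z : Z) => v (Sum.inr (Sum.inr (Sum.inr i)))) := by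
    intro i v v' z h
    exact h _ (by simp [mem_I1, isI])
  unfold fam
  refine ((Aff.mul ((he 0).mul (InvOn.list _ fun q _ => Inv_xlin q)) (Aff_ff _ _)).add
    (Aff.sum _ fun q _ => Aff.var _ _)).add
    ((he 1).mul (InvOn.list _ fun q _ => Inv_xlin q)).aff

theorem gen_Fam (hd : 3 ≤ d) (j : Fin 4) (t : Fin 4 → Fin 3) : Gen (fun v : Ix d → ℂ => Good (Fam j t v)) := by
  classical
  refine gen_good (I1 d) (fun v : Ix d → ℂ => Fam j t v) (Fam_reg hd j t) (fun e => ?_) ?_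
  · by_cases he : e = j
    · subst he
      simp only [Fam, Function.update_self]; exact (Aff_fam _).affOn
    · simp only [Fam, Function.update_of_ne he]; exact (Aff_Sys _ _ t e).affOn
  intro v z hz e
  by_cases he : e = j
  · subst he
    obtain ⟨a, ha⟩ := pt_ne hz 0
    obtain ⟨b, hb⟩ := pt_ne hz 1
    obtain ⟨c, hc⟩ := zc_ne hz.2
    have hsys : ∀ e' < e, Sys e.val t (v + Pi.single (Sum.inr (Sum.inr (Sum.inl (a, b, c)))) 1) e' z = Sys e.val t v e' z := by
      intro e' he'
      rw [sys_lt he', sys_lt he']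
      exact ff_congr (fun q => by simp) z
    refine ⟨Pi.single (Sum.inr (Sum.inr (Sum.inl (a, b, c)))) 1, fun i hi => Pi.single_eq_of_ne (fun h => hi (by subst h; simp [mem_I1, isI])) _, ?_, ?_⟩
    · intro e' he'
      simp only [Fam, Function.update_of_ne he'.ne]
      exact hsys e' he'
    · simp only [Fam, Function.update_self]
      have : fam e.val (v + Pi.single (Sum.inr (Sum.inr (Sum.inl (a, b, c)))) 1) z = fam e.val v z + zp z a ^ d * zl z b ^ e.val * zc z c := by
        have h1 : ∀ q : Fin 3 × Fin (d + 3), xlin q (v + Pi.single (Sum.inr (Sum.inr (Sum.inl (a, b, c)))) 1) z = xlin q v z := fun q =>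
          lin_congr (fun i => by simp) z
        have h2 : ff e.val (v + Pi.single (Sum.inr (Sum.inr (Sum.inl (a, b, c)))) 1) z = ff e.val v z := ff_congr (fun q => by simp) z
        unfold fam
        simp only [h1, h2]
        simp [add_mul, Finset.sum_add_distrib, Pi.single_apply]
        ring
      rw [this]
      have h3 : zp z a ≠ 0 := ha
      have h4 : zl z b ≠ 0 := hb
      simp [h3, h4, hc]
  · obtain ⟨u, h1, h2, h⟩ := sys_vary (d := d) hd j.val t z hz e
    by_cases hlt : e.val < j.val
    · refine ⟨u, ?_, fun e' he' => ?_, ?_⟩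
      · rintro (i | ⟨q | q, i⟩ | q | i) hi
        · simp [mem_I1, isI] at hi
        · simp [mem_I1, isI] at hi
        · exact h1 q i
        · simp [mem_I1, isI] at hi
        · exact h2 _
      · have : e'.val < e.val := he'
        have hne : e' ≠ j := by intro h; rw [h] at this; omega
        simp only [Fam, Function.update_of_ne hne]
        exact (h v).1 e' he'
      · simp only [Fam, Function.update_of_ne he]
        exact (h v).2.2
    · obtain ⟨u, h1, h2⟩ := lin_vary (d := d) z hz (t e) (Sum.inl e)
      have hf : ∀ i, ff i (v + u) z = ff i v z := fun i => ff_congr (fun q => by simp [h1 (Sum.inl q) (by simp)]) z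
      have hx : ∀ q, xlin q (v + u) z = xlin q v z := fun q => lin_congr (fun i => by
        rw [Pi.add_apply, h1 _ (by simp), add_zero]) z
      have hr : ∀ i, (v + u) (Sum.inr (Sum.inr i)) = v (Sum.inr (Sum.inr i)) := fun i => by
        rw [Pi.add_apply, h1 _ (by simp), add_zero]
      refine ⟨u, ?_, fun e' he' => ?_, ?_⟩
      · intro i hi
        apply h1
        intro k hk
        subst hk
        simp [mem_I1, isI] at hi
      · by_cases h' : e' = j
        · subst h'
          simp only [Fam, Function.update_self]
          unfold fam
          simp only [hf, hx, hr]
        · simp only [Fam, Function.update_of_ne h']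
          by_cases h : e'.val < j.val
          · rw [sys_lt h, sys_lt h]; exact hf _
          · rw [sys_ge h, sys_ge h]
            refine lin_congr (fun i => ?_) z
            rw [Pi.add_apply, h1 _ (by intro i' h; simp at h; exact absurd h.1 he'.ne), add_zero]
      · simp only [Fam, Function.update_of_ne he]
        rw [sys_ge hlt, sys_ge hlt]; exact h2 v

theorem gen_five (hd : 3 ≤ d) (j : ℕ) (t : Fin 4 → Fin 3) (q : Fin 3 × Fin (d + 3)) :
    Gen (fun v : Ix d → ℂ => ∀ z, InX z → (∀ e, Sys j t v e z = 0) → xlin q v z = 0 → False) := by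
  classical
  have := gen_empty5 (Finset.univ : Finset (Ix d)) (fun e v z => Fin.snoc (α := fun _ => ℂ) (fun e => Sys j t v e z) (xlin q v z) e)
    (fun e => by
      refine Fin.lastCases ?_ (fun e => ?_) e
      · simp only [Fin.snoc_last]; exact PF2_lin _ _
      · simp only [Fin.snoc_castSucc]; exact (Sys_reg hd j t).pf e)
    (fun e => by
      refine Fin.lastCases ?_ (fun e => ?_) e
      · simp only [Fin.snoc_last]; exact (Aff_lin _ _ _).affOn
      · simp only [Fin.snoc_castSucc]; exact (Aff_Sys _ _ _ _).affOn)
    (fun v z hz e => by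
      refine Fin.lastCases ?_ (fun e => ?_) e
      · obtain ⟨u, h1, h2⟩ := lin_vary (d := d) z hz q.1 (Sum.inr q)
        refine ⟨u, fun i hi => absurd (Finset.mem_univ i) hi, fun e' he' => ?_, ?_⟩
        · obtain ⟨e', rfl⟩ := Fin.exists_castSucc_eq.2 he'.ne
          simp only [Fin.snoc_castSucc]
          by_cases h : e'.val < j
          · rw [sys_lt h, sys_lt h]; exact ff_congr (fun q => by rw [Pi.add_apply, h1 _ (by simp), add_zero]) z
          · rw [sys_ge h, sys_ge h]
            exact lin_congr (fun i => by rw [Pi.add_apply, h1 _ (by simp), add_zero]) z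
        · simp only [Fin.snoc_last]; exact h2 v
      · obtain ⟨u, -, -, h⟩ := sys_vary (d := d) hd j t z hz e
        refine ⟨u, fun i hi => absurd (Finset.mem_univ i) hi, fun e' he' => ?_, ?_⟩
        · obtain ⟨e', rfl⟩ := Fin.exists_castSucc_eq.2 (he'.trans (Fin.castSucc_lt_last e)).ne
          simp only [Fin.snoc_castSucc]
          exact (h v).1 e' (by simpa using he')
        · simp only [Fin.snoc_castSucc]; exact (h v).2.2)
    (fun v z z' hr h0 e => by
      have hs : ∀ e, Sys j t v e z = 0 := fun e => by simpa using h0 e.castSucc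
      have hx : xlin q v z = 0 := by
        have := h0 (Fin.last 4); rwa [Fin.snoc_last] at this
      refine Fin.lastCases ?_ (fun e => ?_) e
      · simp only [Fin.snoc_last]
        obtain ⟨α, β, γ, κ, ha, hb, hk, rfl⟩ := hr
        rw [xlin, lin_rel]
        have hx : lin q.1 (Sum.inr q) v z = 0 := hx
        rw [hx, mul_zero]
      · simp only [Fin.snoc_castSucc]
        exact (Sys_reg hd j t).inv v z z' hr hs e)
  refine this.mono fun v hv z hz h1 h2 => hv z hz fun e => ?_
  refine Fin.lastCases ?_ (fun e => ?_) e
  · rw [Fin.snoc_last]; exact h2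
  · simpa using h1 e

end HF

namespace HF
open MvPolynomial
variable {d : ℕ}

/-! ### relabelling -/
def lp (π : Equiv.Perm (Lbl d)) : Ix d ≃ Ix d :=
  Equiv.sumCongr (Equiv.refl _) (Equiv.sumCongr (Equiv.prodCongr π (Equiv.refl _)) (Equiv.refl _))
theorem lin_lp (π : Equiv.Perm (Lbl d)) (ty a) (v : Ix d → ℂ) : lin ty a (v ∘ lp π) = lin ty (π a) v := rfl
theorem ff_lp (π : Equiv.Perm (Lbl d)) (i) (v : Ix d → ℂ) : ff i (v ∘ lp π) = ff i v := by
  funext z; exact ff_congr (fun q => rfl) z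

def sw (j : Fin 4) (q : Fin 3 × Fin (d + 3)) : Equiv.Perm (Lbl d) := Equiv.swap (Sum.inl j) (Sum.inr q)

theorem upd_ff (j : Fin 4) (t : Fin 4 → Fin 3) (v : Ix d → ℂ) :
    Function.update (Sys j.val t v) j (ff j.val v) = Sys (j.val + 1) t v := by
  funext e
  by_cases he : e = j
  · subst he; rw [Function.update_self, sys_lt (by omega)]
  · rw [Function.update_of_ne he]
    have he' : e.val ≠ j.val := fun h => he (Fin.ext h)
    by_cases h : e.val < j.val
    · rw [sys_lt h, sys_lt (by omega)]
    · rw [sys_ge h, sys_ge (by omega)]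

theorem upd_xlin (j : Fin 4) (t : Fin 4 → Fin 3) (v : Ix d → ℂ) (q : Fin 3 × Fin (d + 3)) :
    Function.update (Sys j.val t v) j (xlin q v) = Sys j.val (Function.update t j q.1) (v ∘ lp (sw j q)) := by
  funext e
  by_cases he : e = j
  · subst he
    rw [Function.update_self, sys_ge (by omega), lin_lp, sw, Equiv.swap_apply_left, Function.update_self]; rfl
  · rw [Function.update_of_ne he]
    by_cases h : e.val < j.val
    · rw [sys_lt h, sys_lt h, ff_lp]
    · rw [sys_ge h, sys_ge h, lin_lp, sw, Equiv.swap_apply_of_ne_of_ne (by simpa using he) (by simp), Function.update_of_ne he]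

structure Nice (v : Ix d → ℂ) : Prop where
  good : ∀ (j : Fin 5) t π, Good (Sys j.val t (v ∘ lp π))
  five : ∀ (j : Fin 5) t π q z, InX z → (∀ e, Sys j.val t (v ∘ lp π) e z = 0) → xlin q (v ∘ lp π) z = 0 → False

theorem gen_Nice (hd : 3 ≤ d) : Gen (Nice (d := d)) := by
  have h1 : Gen (fun v : Ix d → ℂ => ∀ (j : Fin 5) t π, Good (Sys j.val t (v ∘ lp π))) :=
    Gen.all fun j => Gen.all fun t => Gen.all fun π => (gen_Sys hd j.val t).equiv (lp π)
  have h2 : Gen (fun v : Ix d → ℂ => ∀ (j : Fin 5) t π q, ∀ z, InX z → (∀ e, Sys j.val t (v ∘ lp π) e z = 0) → xlin q (v ∘ lp π) z = 0 → False) :=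
    Gen.all fun j => Gen.all fun t => Gen.all fun π => Gen.all fun q => (gen_five hd j.val t q).equiv (lp π)
  exact (h1.and h2).mono fun v h => ⟨h.1, h.2⟩

theorem Nice.good1 {v : Ix d → ℂ} (h : Nice v) (j : Fin 5) (t) : Good (Sys j.val t v) := h.good j t 1
theorem Nice.five1 {v : Ix d → ℂ} (h : Nice v) (j : Fin 5) (t) (q) : ∀ z, InX z → (∀ e, Sys j.val t v e z = 0) → xlin q v z = 0 → False :=
  h.five j t 1 q

def setE (v : Ix d → ℂ) (a b : ℂ) : Ix d → ℂ
  | Sum.inl q => v (Sum.inl q)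
  | Sum.inr (Sum.inl q) => v (Sum.inr (Sum.inl q))
  | Sum.inr (Sum.inr (Sum.inl q)) => 0
  | Sum.inr (Sum.inr (Sum.inr q)) => ![a, b] q

theorem Sys_setE (j t) (v : Ix d → ℂ) (a b : ℂ) : Sys j t (setE v a b) = Sys j t v := by
  funext e z
  by_cases h : e.val < j
  · rw [sys_lt h, sys_lt h]; exact ff_congr (fun q => rfl) z
  · rw [sys_ge h, sys_ge h]; exact lin_congr (fun q => rfl) z
theorem xlin_setE (q) (v : Ix d → ℂ) (a b : ℂ) : xlin q (setE v a b) = xlin q v := by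
  funext z; exact lin_congr (fun q => rfl) z
theorem ff_setE (i) (v : Ix d → ℂ) (a b : ℂ) : ff i (setE v a b) = ff i v := by
  funext z; exact ff_congr (fun q => rfl) z

theorem fam_setE (j) (v : Ix d → ℂ) (a b : ℂ) (z : Z) : fam j (setE v a b) z =
    a * ((listM d j).map fun q => xlin q v z).prod * ff j v z + b * ((listK d j).map fun q => xlin q v z).prod := by
  unfold fam
  simp only [xlin_setE, ff_setE]
  simp [setE]

theorem nice_xlin (hd : 3 ≤ d) {v : Ix d → ℂ} (h : Nice v) (j : Fin 4) (t : Fin 4 → Fin 3) (q) :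
    PF (xlin q v) ∧ Good (Function.update (Sys j.val t v) j (xlin q v)) ∧
    (zset (Function.update (Sys j.val t v) j (xlin q v))).Finite := by
  refine ⟨?_, ?_⟩
  · have := (Sys_reg hd j.val (Function.update t j q.1)).pf1 (v ∘ lp (sw j q)) j
    rw [← upd_xlin, Function.update_self] at this
    exact this
  · rw [upd_xlin]
    have hg := h.good j.castSucc (Function.update t j q.1) (sw j q)
    exact ⟨hg, (Sys_reg hd j.val _).finite hg⟩

theorem nice_dis {v : Ix d → ℂ} (h : Nice v) (j : Fin 4) (t : Fin 4 → Fin 3) {q q'} (hq : q ≠ q') (z : Z) (hz : InX z)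
    (h0 : ∀ e, e ≠ j → Sys j.val t v e z = 0) (h1 : xlin q v z = 0) (h2 : xlin q' v z = 0) : False := by
  refine h.five j.castSucc (Function.update t j q.1) (sw j q) q' z hz ?_ ?_
  · have := (zero_update (S := Sys j.val t v) (j := j) (g := xlin q v) (z := z)).2 ⟨h1, h0⟩
    rwa [upd_xlin] at this
  · rw [xlin, lin_lp, sw, Equiv.swap_apply_of_ne_of_ne (by simp) (by simpa using hq.symm)]; exact h2

theorem exists_N (hd : 3 ≤ d) : ∃ N : ℕ → (Fin 4 → Fin 3) → ℕ,
    (∀ j t (v : Ix d → ℂ), Good (Sys j t v) → cnt (Sys j t v) = N j t) ∧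
    ∀ (j : Fin 4) t, N (j.val + 1) t + 2 * j.val * N j.val (Function.update t j 0) =
      d * N j.val (Function.update t j 0) + j.val * N j.val (Function.update t j 1) + N j.val (Function.update t j 2) := by
  have hN : ∀ j t, ∃ N, ∀ v : Ix d → ℂ, Good (Sys j t v) → cnt (Sys j t v) = N := by
    intro j t
    obtain ⟨Q, h1, h2⟩ := gen_Sys hd j t
    exact exists_cnt (Sys_reg hd j t) h1 h2
  choose N hN using hN
  refine ⟨N, hN, fun j t => ?_⟩
  obtain ⟨Q, hQ1, hQ2⟩ := gen_Fam hd j t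
  obtain ⟨NF, hNF⟩ := exists_cnt (Fam_reg hd j t) hQ1 hQ2
  obtain ⟨v, hv⟩ := (gen_Nice hd).exists
  have hcx : ∀ q : Fin 3 × Fin (d + 3), cnt (Function.update (Sys j.val t v) j (xlin q v)) = N j.val (Function.update t j q.1) := by
    intro q
    have := (nice_xlin hd hv j t q).2.1
    rw [upd_xlin] at this ⊢
    exact hN _ _ _ this
  have hpart : ∀ ty n, n ≤ d + 3 → ((part d ty n).map fun q => cnt (Function.update (Sys j.val t v) j (xlin q v))).sum =
      n * N j.val (Function.update t j ty) := by
    intro ty n hn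
    have : (part d ty n).map (fun q => cnt (Function.update (Sys j.val t v) j (xlin q v))) =
        (part d ty n).map (fun q => N j.val (Function.update t j ty)) := by
      refine List.map_congr_left fun q hq => ?_
      rw [hcx, part_mem hq]
    rw [this, List.map_const', List.sum_replicate, part_length ty n hn, smul_eq_mul]
  have hfg : Good (Sys (j.val + 1) t v) := hv.good1 j.succ t
  have hj := j.2
  -- first specialisation
  obtain ⟨-, g1, -, c1⟩ := prod_list (S := Sys j.val t v) j (ff j.val v :: (listM d j.val).map (fun q => xlin q v))
    (by
      intro f hf
      rcases List.mem_cons.1 hf with rfl | hf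
      · have := (Sys_reg hd (j.val + 1) t).pf1 v j
        rwa [sys_lt (by omega)] at this
      · obtain ⟨q, -, rfl⟩ := List.mem_map.1 hf
        exact (nice_xlin hd hv j t q).1)
    (by
      intro f hf
      rcases List.mem_cons.1 hf with rfl | hf
      · rw [upd_ff]; exact hfg
      · obtain ⟨q, -, rfl⟩ := List.mem_map.1 hf
        exact (nice_xlin hd hv j t q).2.1)
    (by
      intro f hf
      rcases List.mem_cons.1 hf with rfl | hf
      · rw [upd_ff]; exact (Sys_reg hd (j.val + 1) t).finite hfg
      · obtain ⟨q, -, rfl⟩ := List.mem_map.1 hf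
        exact (nice_xlin hd hv j t q).2.2)
    (by
      refine List.Pairwise.cons ?_ ?_
      · intro f hf z hz h0 h1 h2
        obtain ⟨q, -, rfl⟩ := List.mem_map.1 hf
        refine hv.five1 j.succ t q z hz ?_ h2
        have := (zero_update (S := Sys j.val t v) (j := j) (g := ff j.val v) (z := z)).2 ⟨h1, h0⟩
        rwa [upd_ff] at this
      · refine List.pairwise_map.2 ((part_nodup 0 _).imp fun hq z hz h0 h1 h2 => nice_dis hv j t hq z hz h0 h1 h2))
  obtain ⟨-, g2, -, c2⟩ := prod_list (S := Sys j.val t v) j ((listK d j.val).map (fun q => xlin q v))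
    (by
      intro f hf
      obtain ⟨q, -, rfl⟩ := List.mem_map.1 hf
      exact (nice_xlin hd hv j t q).1)
    (by
      intro f hf
      obtain ⟨q, -, rfl⟩ := List.mem_map.1 hf
      exact (nice_xlin hd hv j t q).2.1)
    (by
      intro f hf
      obtain ⟨q, -, rfl⟩ := List.mem_map.1 hf
      exact (nice_xlin hd hv j t q).2.2)
    (by
      refine List.pairwise_map.2 ((listK_nodup _).imp fun hq z hz h0 h1 h2 => nice_dis hv j t hq z hz h0 h1 h2))
  have e1 : Fam j t (setE v 1 0) = Function.update (Sys j.val t v) j (fun z => ((ff j.val v :: (listM d j.val).map (fun q => xlin q v)).map (fun f => f z)).prod) := by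
    rw [Fam, Sys_setE]; congr 1; funext z
    rw [fam_setE]; simp [Function.comp_def, mul_comm]
  have e2 : Fam j t (setE v 0 1) = Function.update (Sys j.val t v) j (fun z => (((listK d j.val).map (fun q => xlin q v)).map (fun f => f z)).prod) := by
    rw [Fam, Sys_setE]; congr 1; funext z
    rw [fam_setE]; simp [Function.comp_def, mul_comm]
  rw [← e1] at g1 c1
  rw [← e2] at g2 c2
  have := (hNF _ g1).trans (hNF _ g2).symm
  rw [c1, c2, List.map_cons, List.sum_cons, upd_ff, hN _ _ _ hfg, List.map_map, List.map_map] at this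
  simp only [Function.comp_def] at this
  rw [listM, listK, List.map_append, List.map_append, List.sum_append, List.sum_append,
    hpart _ _ (by omega), hpart _ _ (by omega), hpart _ _ (by omega), hpart _ _ (by omega), one_mul] at this
  exact this

end HF

namespace HF
open MvPolynomial
variable {d : ℕ}

def rk (t : Fin 4 → Fin 3) (e : Fin 4) : ℕ := (Finset.univ.filter (fun e' => e' < e ∧ t e' = t e)).card
def cn (t : Fin 4 → Fin 3) (ty : Fin 3) : ℕ := (Finset.univ.filter (fun e' => t e' = ty)).card
def MM (t : Fin 4 → Fin 3) : ℕ :=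
  if (cn t 0 = 2 ∧ cn t 1 = 1 ∧ cn t 2 = 1) ∨ (cn t 0 = 1 ∧ cn t 1 = 2 ∧ cn t 2 = 1) then 1 else 0
def cf : Fin 3 → ℕ → Fin 3 → ℂ
  | 0, 0 => ![0, 1, 0]
  | 0, 1 => ![0, 0, 1]
  | 0, _ => ![1, 0, 0]
  | 1, 0 => ![0, 1, 0]
  | 1, 1 => ![1, 0, 1]
  | 1, _ => ![0, 0, 1]
  | 2, 0 => ![0, 1, 0]
  | 2, _ => ![1, 0, 0]
def vb (d : ℕ) (t : Fin 4 → Fin 3) : Ix d → ℂ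
  | Sum.inr (Sum.inl (Sum.inl e, i)) => cf (t e) (rk t e) i
  | _ => 0
def lv (ty : Fin 3) (r : ℕ) (z : Z) : ℂ := ∑ i, cf ty r i * pt ty z i

theorem Sys_vb (t e) (z : Z) : Sys 0 t (vb d t) e z = lv (t e) (rk t e) z := by
  rw [sys_ge (by omega)]; rfl

def hasSlot (t : Fin 4 → Fin 3) (ty : Fin 3) (r : ℕ) : Prop := ∃ e, t e = ty ∧ rk t e = r
instance (t ty r) : Decidable (hasSlot t ty r) := by unfold hasSlot; infer_instance

theorem slot_dec : ∀ t : Fin 4 → Fin 3,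
    (hasSlot t 0 0 ∧ hasSlot t 0 1 ∧ hasSlot t 0 2 ∧ MM t = 0) ∨
    (hasSlot t 1 0 ∧ hasSlot t 1 1 ∧ hasSlot t 1 2 ∧ MM t = 0) ∨
    (hasSlot t 2 0 ∧ hasSlot t 2 1 ∧ MM t = 0) ∨
    (hasSlot t 0 0 ∧ hasSlot t 0 1 ∧ hasSlot t 1 0 ∧ hasSlot t 1 1 ∧ MM t = 0) ∨
    (hasSlot t 0 0 ∧ hasSlot t 0 1 ∧ hasSlot t 1 0 ∧ hasSlot t 2 0 ∧ MM t = 1 ∧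
      ∀ e, (t e = 0 ∧ rk t e = 0) ∨ (t e = 0 ∧ rk t e = 1) ∨ (t e = 1 ∧ rk t e = 0) ∨ (t e = 2 ∧ rk t e = 0)) ∨
    (hasSlot t 0 0 ∧ hasSlot t 1 0 ∧ hasSlot t 1 1 ∧ hasSlot t 2 0 ∧ MM t = 1 ∧
      ∀ e, (t e = 0 ∧ rk t e = 0) ∨ (t e = 1 ∧ rk t e = 0) ∨ (t e = 1 ∧ rk t e = 1) ∨ (t e = 2 ∧ rk t e = 0)) := by
  decide +kernel

theorem slot_zero {t ty r} (h : hasSlot t ty r) {z : Z} (h0 : ∀ e, Sys 0 t (vb d t) e z = 0) : lv ty r z = 0 := by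
  obtain ⟨e, rfl, rfl⟩ := h
  rw [← Sys_vb (d := d)]; exact h0 e
theorem slot_der {t ty r} (h : hasSlot t ty r) {x ξ : Fin 4 → ℂ} (h0 : ∀ e, fderiv ℂ (fun x => Sys 0 t (vb d t) e (big x)) x ξ = 0) :
    fderiv ℂ (fun x => lv ty r (big x)) x ξ = 0 := by
  obtain ⟨e, rfl, rfl⟩ := h
  have := h0 e
  simp only [Sys_vb] at this; exact this

theorem lv00 (z : Z) : lv 0 0 z = zp z 1 := by simp [lv, cf, pt, Fin.sum_univ_three]
theorem lv01 (z : Z) : lv 0 1 z = zp z 2 := by simp [lv, cf, pt, Fin.sum_univ_three]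
theorem lv02 (z : Z) : lv 0 2 z = zp z 0 := by simp [lv, cf, pt, Fin.sum_univ_three]
theorem lv10 (z : Z) : lv 1 0 z = zl z 1 := by simp [lv, cf, pt, Fin.sum_univ_three]
theorem lv11 (z : Z) : lv 1 1 z = zl z 0 + zl z 2 := by simp [lv, cf, pt, Fin.sum_univ_three]
theorem lv12 (z : Z) : lv 1 2 z = zl z 2 := by simp [lv, cf, pt, Fin.sum_univ_three]
theorem lv20 (z : Z) : lv 2 0 z = zc z 1 := by simp [lv, cf, pt, Fin.sum_univ_three]
theorem lv21 (z : Z) : lv 2 1 z = zc z 0 := by simp [lv, cf, pt, Fin.sum_univ_three]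

theorem zl_dot (z : Z) : zl z 0 * zp z 0 + zl z 1 * zp z 1 + zl z 2 * zp z 2 = 0 := by
  simp [zl, crs]; ring
theorem vec3_zero {p : Fin 3 → ℂ} (h0 : p 0 = 0) (h1 : p 1 = 0) (h2 : p 2 = 0) : p = 0 := by
  funext i; fin_cases i <;> assumption
theorem vec2_zero {p : Fin 2 → ℂ} (h0 : p 0 = 0) (h1 : p 1 = 0) : p = 0 := by
  funext i; fin_cases i <;> assumption
theorem zp_ne {z : Z} (hz : InX z) : zp z ≠ 0 := fun h => hz.1 (by simp [zl, crs, h])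

theorem big_inX (x) : InX (big x) := (inR_big x).inX

theorem fd_coord (i : Fin 4) (x ξ : Fin 4 → ℂ) : fderiv ℂ (fun x : Fin 4 → ℂ => x i) x ξ = ξ i := by
  rw [(hasFDerivAt_apply i x).fderiv]; rfl

theorem empty_case {S : Fin 4 → Z → ℂ} (h : ∀ z, InX z → (∀ e, S e z = 0) → False) : Good S ∧ cnt S = 0 := by
  refine ⟨⟨fun z hz h0 => (h z hz h0).elim, fun x hx => (h _ (big_inX x) hx).elim⟩, ?_⟩
  have : zset S = ∅ := Set.eq_empty_of_forall_notMem fun x hx => h _ (big_inX x) hx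
  rw [cnt, this, Set.ncard_empty]

theorem base_case (t : Fin 4 → Fin 3) : Good (Sys 0 t (vb d t)) ∧ cnt (Sys 0 t (vb d t)) = MM t := by
  have f00 : ∀ x : Fin 4 → ℂ, lv 0 0 (big x) = x 0 := fun x => by rw [lv00]; rfl
  have f01 : ∀ x : Fin 4 → ℂ, lv 0 1 (big x) = x 1 := fun x => by rw [lv01]; rfl
  have f10 : ∀ x : Fin 4 → ℂ, lv 1 0 (big x) = - x 2 := fun x => by rw [lv10, zl_big]; rfl
  have f11 : ∀ x : Fin 4 → ℂ, lv 1 1 (big x) = x 0 * x 2 - x 1 + 1 := fun x => by rw [lv11, zl_big]; rfl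
  have f20 : ∀ x : Fin 4 → ℂ, lv 2 0 (big x) = x 3 := fun x => by rw [lv20]; rfl
  rcases slot_dec t with ⟨a, b, c, m⟩ | ⟨a, b, c, m⟩ | ⟨a, b, m⟩ | ⟨a, b, c, f, m⟩ | ⟨a, b, c, f, m, hall⟩ | ⟨a, b, c, f, m, hall⟩
  · rw [m]; refine empty_case fun z hz h0 => ?_
    have a := slot_zero a h0
    have b := slot_zero b h0
    have c := slot_zero c h0
    rw [lv00] at a; rw [lv01] at b; rw [lv02] at c
    exact zp_ne hz (vec3_zero c a b)
  · rw [m]; refine empty_case fun z hz h0 => ?_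
    have a := slot_zero a h0
    have b := slot_zero b h0
    have c := slot_zero c h0
    rw [lv10] at a; rw [lv11] at b; rw [lv12] at c
    exact hz.1 (vec3_zero (by rwa [c, add_zero] at b) a c)
  · rw [m]; refine empty_case fun z hz h0 => ?_
    have a := slot_zero a h0
    have b := slot_zero b h0
    rw [lv20] at a; rw [lv21] at b
    exact hz.2 (vec2_zero b a)
  · rw [m]; refine empty_case fun z hz h0 => ?_
    have a := slot_zero a h0
    have b := slot_zero b h0
    have c := slot_zero c h0
    have f := slot_zero f h0
    rw [lv00] at a; rw [lv01] at b; rw [lv10] at c; rw [lv11] at f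
    have hp : zp z 0 ≠ 0 := fun h => zp_ne hz (vec3_zero h a b)
    have h := zl_dot z
    rw [a, b, mul_zero, mul_zero, add_zero, add_zero] at h
    have h := (mul_eq_zero.1 h).resolve_right hp
    rw [h, zero_add] at f
    exact hz.1 (vec3_zero h c f)
  · have hg : Good (Sys 0 t (vb d t)) := by
      refine ⟨fun z hz h0 => ?_, fun x hx ξ hξ => ?_⟩
      · have a := slot_zero a h0
        have b := slot_zero b h0
        have c := slot_zero c h0
        have f := slot_zero f h0
        rw [lv00] at a; rw [lv01] at b; rw [lv10] at c; rw [lv20] at f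
        have hp : zp z 0 ≠ 0 := fun h => zp_ne hz (vec3_zero h a b)
        have h := zl_dot z
        rw [a, b, mul_zero, mul_zero, add_zero, add_zero] at h
        have h := (mul_eq_zero.1 h).resolve_right hp
        exact ⟨hp, fun h2 => hz.1 (vec3_zero h c h2), fun h2 => hz.2 (vec2_zero h2 f)⟩
      · have a := slot_der a hξ
        have b := slot_der b hξ
        have c := slot_der c hξ
        have f := slot_der f hξ
        simp only [f00, f01, f10, f20, fderiv_fun_neg, fd_coord, ContinuousLinearMap.neg_apply, neg_eq_zero] at a b c f
        funext i; fin_cases i <;> assumption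
    refine ⟨hg, ?_⟩
    have : zset (Sys 0 t (vb d t)) = {0} := by
      ext x
      constructor
      · intro h0
        have a := slot_zero a h0
        have b := slot_zero b h0
        have c := slot_zero c h0
        have f := slot_zero f h0
        rw [f00] at a; rw [f01] at b; rw [f10, neg_eq_zero] at c; rw [f20] at f
        show x = 0
        funext i; fin_cases i <;> assumption
      · rintro rfl e
        rw [Sys_vb]
        rcases hall e with ⟨h1, h2⟩ | ⟨h1, h2⟩ | ⟨h1, h2⟩ | ⟨h1, h2⟩ <;> rw [h1, h2]
        · rw [f00]; rfl
        · rw [f01]; rfl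
        · rw [f10]; simp
        · rw [f20]; rfl
    rw [cnt, this, Set.ncard_singleton, m]
  · have hg : Good (Sys 0 t (vb d t)) := by
      refine ⟨fun z hz h0 => ?_, fun x hx ξ hξ => ?_⟩
      · have a := slot_zero a h0
        have b := slot_zero b h0
        have c := slot_zero c h0
        have f := slot_zero f h0
        rw [lv00] at a; rw [lv10] at b; rw [lv11] at c; rw [lv20] at f
        have hl : zl z 2 ≠ 0 := fun h => hz.1 (vec3_zero (by rwa [h, add_zero] at c) b h)
        have h := zl_dot z
        have h' : zl z 2 * (zp z 2 - zp z 0) = 0 := by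
          rw [b] at h
          linear_combination h - zp z 0 * c
        have h' := (mul_eq_zero.1 h').resolve_left hl
        refine ⟨fun h0 => zp_ne hz (vec3_zero h0 a ?_), hl, fun h2 => hz.2 (vec2_zero h2 f)⟩
        rwa [h0, sub_zero] at h'
      · have a := slot_der a hξ
        have b := slot_der b hξ
        have c := slot_der c hξ
        have f := slot_der f hξ
        simp only [f00, f10, f20, fderiv_fun_neg, fd_coord, ContinuousLinearMap.neg_apply, neg_eq_zero] at a b f
        have hc : HasFDerivAt (fun x : Fin 4 → ℂ => x 0 * x 2 - x 1 + 1) _ x :=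
          ((((hasFDerivAt_apply (𝕜 := ℂ) (0 : Fin 4) x).mul (hasFDerivAt_apply (𝕜 := ℂ) (2 : Fin 4) x)).sub (hasFDerivAt_apply (𝕜 := ℂ) (1 : Fin 4) x)).add_const 1)
        simp only [f11] at c
        rw [hc.fderiv] at c
        simp [a, b] at c
        funext i; fin_cases i <;> assumption
    refine ⟨hg, ?_⟩
    have : zset (Sys 0 t (vb d t)) = {![0, 1, 0, 0]} := by
      ext x
      constructor
      · intro h0
        have a := slot_zero a h0
        have b := slot_zero b h0
        have c := slot_zero c h0
        have f := slot_zero f h0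
        rw [f00] at a; rw [f10, neg_eq_zero] at b; rw [f11] at c; rw [f20] at f
        show x = _
        have c : x 1 = 1 := by rw [a] at c; linear_combination -c
        funext i; fin_cases i <;> assumption
      · rintro rfl e
        rw [Sys_vb]
        rcases hall e with ⟨h1, h2⟩ | ⟨h1, h2⟩ | ⟨h1, h2⟩ | ⟨h1, h2⟩ <;> rw [h1, h2]
        · rw [f00]; rfl
        · rw [f10]; simp
        · rw [f11]; simp
        · rw [f20]; rfl
    rw [cnt, this, Set.ncard_singleton, m]

theorem upd0 {α : Type} (a b c e x : α) : Function.update ![a, b, c, e] 0 x = ![x, b, c, e] := by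
  funext i; fin_cases i <;> rfl
theorem upd1 {α : Type} (a b c e x : α) : Function.update ![a, b, c, e] 1 x = ![a, x, c, e] := by
  funext i; fin_cases i <;> rfl
theorem upd2 {α : Type} (a b c e x : α) : Function.update ![a, b, c, e] 2 x = ![a, b, x, e] := by
  funext i; fin_cases i <;> rfl
theorem upd3 {α : Type} (a b c e x : α) : Function.update ![a, b, c, e] 3 x = ![a, b, c, x] := by
  funext i; fin_cases i <;> rfl

def mm (a b c e : Fin 3) : ℕ := MM ![a, b, c, e]

theorem main_count (hd : 3 ≤ d) (v : Ix d → ℂ) (h : Good (Sys 4 ![0, 0, 0, 0] v)) :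
    (cnt (Sys 4 ![0, 0, 0, 0] v) : ℤ) = 6 * ((d : ℤ) - 3) * (3 * (d : ℤ) - 2) := by
  obtain ⟨N, hN, hr⟩ := exists_N hd
  rw [hN _ _ _ h]
  have h0 : ∀ t, N 0 t = MM t := fun t => by
    obtain ⟨h1, h2⟩ := base_case (d := d) t
    rw [← h2, hN _ _ _ h1]
  have r1 : ∀ a b c e, (N 1 ![a, b, c, e] : ℤ) = d * mm 0 b c e + mm 2 b c e := by
    intro a b c e
    have := hr 0 ![a, b, c, e]
    rw [upd0, upd0, upd0] at this
    simp [h0] at this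
    rw [this]; push_cast; rfl
  have r2 : ∀ a b c e, (N 2 ![a, b, c, e] : ℤ) = (d - 2) * N 1 ![a, 0, c, e] + N 1 ![a, 1, c, e] + N 1 ![a, 2, c, e] := by
    intro a b c e
    have := hr 1 ![a, b, c, e]
    rw [upd1, upd1, upd1] at this
    simp only [Fin.val_one] at this
    zify at this
    linear_combination this
  have r3 : ∀ a b c e, (N 3 ![a, b, c, e] : ℤ) = (d - 4) * N 2 ![a, b, 0, e] + 2 * N 2 ![a, b, 1, e] + N 2 ![a, b, 2, e] := by
    intro a b c e
    have := hr 2 ![a, b, c, e]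
    rw [upd2, upd2, upd2] at this
    simp only [Fin.val_two] at this
    zify at this
    linear_combination this
  have r4 : ∀ a b c e, (N 4 ![a, b, c, e] : ℤ) = (d - 6) * N 3 ![a, b, c, 0] + 3 * N 3 ![a, b, c, 1] + N 3 ![a, b, c, 2] := by
    intro a b c e
    have := hr 3 ![a, b, c, e]
    rw [upd3, upd3, upd3] at this
    have e3 : (3 : Fin 4).val = 3 := rfl
    simp only [e3] at this
    zify at this
    linear_combination this
  rw [r4]
  simp only [r3, r2, r1]
  have hm : ∀ a b c e : Fin 3, mm a b c e =
      if ((if a = 0 then 1 else 0) + (if b = 0 then 1 else 0) + (if c = 0 then 1 else 0) + (if e = 0 then 1 else 0) = 2 ∧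
          (if a = 1 then 1 else 0) + (if b = 1 then 1 else 0) + (if c = 1 then 1 else 0) + (if e = 1 then 1 else 0) = 1) ∨
         ((if a = 0 then 1 else 0) + (if b = 0 then 1 else 0) + (if c = 0 then 1 else 0) + (if e = 0 then 1 else 0) = 1 ∧
          (if a = 1 then 1 else 0) + (if b = 1 then 1 else 0) + (if c = 1 then 1 else 0) + (if e = 1 then 1 else 0) = 2)
      then 1 else 0 := by decide +kernel
  simp [hm]
  ring
end HF

namespace HF
open MvPolynomial
variable {d : ℕ}

theorem gen_two {n k : ℕ} (hk : k < n) (deg : Fin n → ℕ) (cell : Fin n → (Fin k → ℂ) → Z)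
    (hc : ∀ e i, PF (fun x => cell e x i)) :
    Gen (fun v : Ix d → ℂ => ∀ x, (∀ e, zc (cell e x) 0 ≠ 0) →
      (∀ e, ∃ P : MvPolynomial (Fin 3) ℂ, P.IsHomogeneous d ∧
        (∀ e' < e, (linePoly P (zp (cell e' x)) (zw (cell e' x))).coeff (deg e') = 0) ∧
        (linePoly P (zp (cell e x)) (zw (cell e x))).coeff (deg e) ≠ 0) →
      ¬ ∀ e, ff (deg e) v (cell e x) = 0) := by
  classical
  obtain ⟨Q, h1, h2⟩ := generic_empty (ι := Ix d) hk Finset.univ (fun e v x => ff (deg e) v (cell e x)) (fun e => by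
      refine PF.comp (PF2_ff (d := d) (deg e)) (g := fun y : Ix d ⊕ Fin k → ℂ => Sum.elim (fun i => y (Sum.inl i)) (cell e fun l => y (Sum.inr l))) ?_
      rintro (i | i)
      · exact PF.var _
      · exact PF.comp (hc e i) (g := fun y : Ix d ⊕ Fin k → ℂ => fun l => y (Sum.inr l)) (fun l => PF.var _))
    (fun e v x => (Aff_ff (Finset.univ : Finset (Ix d)) (deg e)).affOn v (cell e x))
  refine ⟨Q, h1, fun v hv x hz hP => h2 v hv x (surj_of_tri fun e => ?_)⟩
  obtain ⟨P, hP, hP1, hP2⟩ := hP e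
  refine ⟨formVec P 0, fun i hi => absurd (Finset.mem_univ i) hi, fun e' he' => ?_, ?_⟩
  · show ff _ _ _ = ff _ _ _
    rw [ff_add_formVec hP, hP1 e' he', mul_zero, add_zero]
  · show ff _ _ _ ≠ ff _ _ _
    rw [ff_add_formVec hP]
    simpa using ⟨hz e, hP2⟩

theorem exists_form2 (p w : Fin 3 → ℂ) {p' w' : Fin 3 → ℂ} (h : crs p' w' ≠ 0) (i : ℕ) (hi : i + 1 ≤ d) :
    ∃ P : MvPolynomial (Fin 3) ℂ, P.IsHomogeneous d ∧ linePoly P p w = 0 ∧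
      linePoly P p' w' = (Polynomial.C (dotp (crs p w) p') + Polynomial.X * Polynomial.C (dotp (crs p w) w')) * Polynomial.X ^ i := by
  obtain ⟨a, b, h1, h2, h3, h4⟩ := exists_dual h
  have k1 : dotp (crs p w) p = 0 := by simp [crs, dotp, Fin.sum_univ_three]; ring
  have k2 : dotp (crs p w) w = 0 := by simp [crs, dotp, Fin.sum_univ_three]; ring
  refine ⟨linForm (crs p w) * (linForm a ^ (d - (i + 1)) * linForm b ^ i), ?_, ?_, ?_⟩
  · have := (linForm_hom (crs p w)).mul (((linForm_hom a).pow (d - (i + 1))).mul ((linForm_hom b).pow i))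
    convert this using 1; omega
  · rw [linePoly_mul, linePoly_linForm, k1, k2]; simp
  · rw [linePoly_mul, linePoly_mul, linePoly_pow, linePoly_pow, linePoly_linForm, linePoly_linForm, linePoly_linForm, h1, h2, h3, h4]; simp

theorem exists_form3 {p w : Fin 3 → ℂ} (h : crs p w ≠ 0) (τ : ℂ) (hd : 5 ≤ d) :
    (∃ P : MvPolynomial (Fin 3) ℂ, P.IsHomogeneous d ∧ linePoly P p w = Polynomial.X ^ 4 ∧
      linePoly P (p + τ • w) w = (Polynomial.C τ + Polynomial.X) ^ 4) ∧
    (∃ P : MvPolynomial (Fin 3) ℂ, P.IsHomogeneous d ∧ linePoly P p w = (Polynomial.C (-τ) + Polynomial.X) * Polynomial.X ^ 4 ∧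
      linePoly P (p + τ • w) w = Polynomial.X * (Polynomial.C τ + Polynomial.X) ^ 4) := by
  obtain ⟨a, b, h1, h2, h3, h4⟩ := exists_dual h
  have dl : ∀ a : Fin 3 → ℂ, dotp a (p + τ • w) = dotp a p + τ * dotp a w := by
    intro a; simp [dotp, Fin.sum_univ_three]; ring
  have ds : ∀ q : Fin 3 → ℂ, dotp (b - τ • a) q = dotp b q - τ * dotp a q := by
    intro a; simp [dotp, Fin.sum_univ_three]; ring
  constructor
  · refine ⟨linForm a ^ (d - 4) * linForm b ^ 4, ?_, ?_, ?_⟩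
    · have := ((linForm_hom a).pow (d - 4)).mul ((linForm_hom b).pow 4)
      convert this using 1; omega
    · rw [linePoly_mul, linePoly_pow, linePoly_pow, linePoly_linForm, linePoly_linForm, h1, h2, h3, h4]; simp
    · rw [linePoly_mul, linePoly_pow, linePoly_pow, linePoly_linForm, linePoly_linForm, dl, dl, h1, h2, h3, h4]; simp
  · refine ⟨linForm (b - τ • a) * (linForm a ^ (d - 5) * linForm b ^ 4), ?_, ?_, ?_⟩
    · have := (linForm_hom (b - τ • a)).mul (((linForm_hom a).pow (d - 5)).mul ((linForm_hom b).pow 4))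
      convert this using 1; omega
    · rw [linePoly_mul, linePoly_mul, linePoly_pow, linePoly_pow, linePoly_linForm, linePoly_linForm, linePoly_linForm, ds, ds, h1, h2, h3, h4]; simp
    · rw [linePoly_mul, linePoly_mul, linePoly_pow, linePoly_pow, linePoly_linForm, linePoly_linForm, linePoly_linForm, ds, ds, dl, dl, h1, h2, h3, h4]; simp

/-- `v` is a parameter whose hyperflex zeros are at `x` -/
def HZ (v : Ix d → ℂ) (x : Fin 4 → ℂ) : Prop := ∀ i < 4, ff i v (big x) = 0

def dg (e : Fin 4) : ℕ := e.val

theorem PF_big {k : ℕ} (g : (Fin k → ℂ) → Fin 4 → ℂ) (hg : ∀ l, PF (fun x => g x l)) (i : Zi) : PF (fun x => big (g x) i) :=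
  PF.comp (big_PF i) hg

theorem low_coeff {q : Polynomial ℂ} {n i : ℕ} (h : i < n) : (q * Polynomial.X ^ n).coeff i = 0 := by
  rw [Polynomial.coeff_mul_X_pow']; rw [if_neg (by omega)]

theorem gen_I (hd : 4 ≤ d) : Gen (fun v : Ix d → ℂ => ∀ x y : Fin 4 → ℂ, x 3 = y 3 → HZ v x → HZ v y →
    dotp (zl (big x)) (zp (big y)) = 0) := by
  let deg : Fin (4 + 4) → ℕ := Fin.append (fun e => e.val) (fun e => e.val)
  let cell : Fin (4 + 4) → (Fin 7 → ℂ) → Z := Fin.append (fun _ x => big ![x 0, x 1, x 2, x 6]) (fun _ x => big ![x 3, x 4, x 5, x 6])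
  refine (gen_two (d := d) (by norm_num) deg cell ?_).mono ?_
  · intro e i
    refine Fin.addCases (fun e => ?_) (fun e => ?_) e
    · simp only [cell, Fin.append_left]
      refine PF_big _ (fun l => ?_) i
      fin_cases l <;> exact PF.var _
    · simp only [cell, Fin.append_right]
      refine PF_big _ (fun l => ?_) i
      fin_cases l <;> exact PF.var _
  intro v hv x y h3 hx hy
  by_contra hne
  have ex : (![x 0, x 1, x 2, x 3] : Fin 4 → ℂ) = x := by funext i; fin_cases i <;> rfl
  have ey : (![y 0, y 1, y 2, x 3] : Fin 4 → ℂ) = y := by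
    funext i; fin_cases i
    · rfl
    · rfl
    · rfl
    · exact h3
  have cl : ∀ e : Fin 4, cell (Fin.castAdd 4 e) ![x 0, x 1, x 2, y 0, y 1, y 2, x 3] = big x := by
    intro e; simp only [cell, Fin.append_left]; exact congrArg big ex
  have cr : ∀ e : Fin 4, cell (Fin.natAdd 4 e) ![x 0, x 1, x 2, y 0, y 1, y 2, x 3] = big y := by
    intro e; simp only [cell, Fin.append_right]; exact congrArg big ey
  have dl : ∀ e : Fin 4, deg (Fin.castAdd 4 e) = e.val := fun e => by simp only [deg, Fin.append_left]
  have dr : ∀ e : Fin 4, deg (Fin.natAdd 4 e) = e.val := fun e => by simp only [deg, Fin.append_right]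
  refine hv ![x 0, x 1, x 2, y 0, y 1, y 2, x 3] ?_ ?_ ?_
  · intro e
    refine Fin.addCases (fun e => ?_) (fun e => ?_) e
    · rw [cl]; exact (inR_big x).2.2
    · rw [cr]; exact (inR_big y).2.2
  · intro e
    refine Fin.addCases (fun e => ?_) (fun e => ?_) e
    · obtain ⟨P, hP, hl⟩ := exists_form (d := d) (big_inX x).1 e.val (by omega)
      refine ⟨P, hP, fun e' => ?_, ?_⟩
      · refine Fin.addCases (fun e' => ?_) (fun e' => ?_) e' <;> intro he'
        · have : e'.val < e.val := he'
          rw [cl, dl, hl, Polynomial.coeff_X_pow, if_neg this.ne]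
        · exfalso
          have : 4 + e'.val < e.val := he'
          omega
      · rw [cl, dl, hl, Polynomial.coeff_X_pow_self]; exact one_ne_zero
    · obtain ⟨P, hP, hl, hl'⟩ := exists_form2 (d := d) (zp (big x)) (zw (big x)) (big_inX y).1 e.val (by omega)
      refine ⟨P, hP, fun e' => ?_, ?_⟩
      · refine Fin.addCases (fun e' => ?_) (fun e' => ?_) e' <;> intro he'
        · rw [cl, hl]; simp
        · have : 4 + e'.val < 4 + e.val := he'
          rw [cr, dr, hl', low_coeff (by omega)]
      · rw [cr, dr, hl', Polynomial.coeff_mul_X_pow', if_pos le_rfl]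
        have hne : ¬ dotp (crs (zp (big x)) (zw (big x))) (zp (big y)) = 0 := hne
        simpa using hne
  · intro e
    refine Fin.addCases (fun e => ?_) (fun e => ?_) e
    · rw [cl, dl]; exact hx _ e.2
    · rw [cr, dr]; exact hy _ e.2

theorem gen_IIa (hd : 4 ≤ d) : Gen (fun v : Ix d → ℂ => ∀ x y : Fin 4 → ℂ, x 3 = y 3 → x 0 = y 0 → x 1 = y 1 → HZ v x → HZ v y →
    x 2 = y 2) := by
  let deg : Fin (4 + 2) → ℕ := Fin.append (fun e => e.val) (fun e => e.val + 1)
  let cell : Fin (4 + 2) → (Fin 5 → ℂ) → Z := Fin.append (fun _ x => big ![x 0, x 1, x 2, x 4]) (fun _ x => big ![x 0, x 1, x 3, x 4])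
  refine (gen_two (d := d) (by norm_num) deg cell ?_).mono ?_
  · intro e i
    refine Fin.addCases (fun e => ?_) (fun e => ?_) e
    · simp only [cell, Fin.append_left]
      refine PF_big _ (fun l => ?_) i
      fin_cases l <;> exact PF.var _
    · simp only [cell, Fin.append_right]
      refine PF_big _ (fun l => ?_) i
      fin_cases l <;> exact PF.var _
  intro v hv x y h3 h0 h1 hx hy
  by_contra hne
  have ex : (![x 0, x 1, x 2, x 3] : Fin 4 → ℂ) = x := by funext i; fin_cases i <;> rfl
  have ey : (![x 0, x 1, y 2, x 3] : Fin 4 → ℂ) = y := by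
    funext i; fin_cases i
    · exact h0
    · exact h1
    · rfl
    · exact h3
  have cl : ∀ e : Fin 4, cell (Fin.castAdd 2 e) ![x 0, x 1, x 2, y 2, x 3] = big x := by
    intro e; simp only [cell, Fin.append_left]; exact congrArg big ex
  have cr : ∀ e : Fin 2, cell (Fin.natAdd 4 e) ![x 0, x 1, x 2, y 2, x 3] = big y := by
    intro e; simp only [cell, Fin.append_right]; exact congrArg big ey
  have dl : ∀ e : Fin 4, deg (Fin.castAdd 2 e) = e.val := fun e => by simp only [deg, Fin.append_left]
  have dr : ∀ e : Fin 2, deg (Fin.natAdd 4 e) = e.val + 1 := fun e => by simp only [deg, Fin.append_right]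
  have k1 : dotp (zl (big x)) (zp (big y)) = 0 := by
    rw [zl_big, ← ey]; simp [dotp, Fin.sum_univ_three, big]; ring
  have k2 : dotp (zl (big x)) (zw (big y)) ≠ 0 := by
    rw [zl_big]; simp [dotp, Fin.sum_univ_three, big]
    intro h; exact hne (by linear_combination -h)
  refine hv ![x 0, x 1, x 2, y 2, x 3] ?_ ?_ ?_
  · intro e
    refine Fin.addCases (fun e => ?_) (fun e => ?_) e
    · rw [cl]; exact (inR_big x).2.2
    · rw [cr]; exact (inR_big y).2.2
  · intro e
    refine Fin.addCases (fun e => ?_) (fun e => ?_) e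
    · obtain ⟨P, hP, hl⟩ := exists_form (d := d) (big_inX x).1 e.val (by omega)
      refine ⟨P, hP, fun e' => ?_, ?_⟩
      · refine Fin.addCases (fun e' => ?_) (fun e' => ?_) e' <;> intro he'
        · have : e'.val < e.val := he'
          rw [cl, dl, hl, Polynomial.coeff_X_pow, if_neg this.ne]
        · exfalso
          have : 4 + e'.val < e.val := he'
          omega
      · rw [cl, dl, hl, Polynomial.coeff_X_pow_self]; exact one_ne_zero
    · obtain ⟨P, hP, hl, hl'⟩ := exists_form2 (d := d) (zp (big x)) (zw (big x)) (big_inX y).1 e.val (by omega)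
      have k1' : dotp (crs (zp (big x)) (zw (big x))) (zp (big y)) = 0 := k1
      have hl2 : linePoly P (zp (big y)) (zw (big y)) = Polynomial.C (dotp (zl (big x)) (zw (big y))) * Polynomial.X ^ (e.val + 1) := by
        rw [hl', k1', map_zero, zero_add, pow_succ]; simp only [zl]; ring
      refine ⟨P, hP, fun e' => ?_, ?_⟩
      · refine Fin.addCases (fun e' => ?_) (fun e' => ?_) e' <;> intro he'
        · rw [cl, hl]; simp
        · have : 4 + e'.val < 4 + e.val := he'
          rw [cr, dr, hl2, low_coeff (by omega)]
      · rw [cr, dr, hl2, Polynomial.coeff_mul_X_pow', if_pos le_rfl]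
        simpa using k2
  · intro e
    refine Fin.addCases (fun e => ?_) (fun e => ?_) e
    · rw [cl, dl]; exact hx _ e.2
    · rw [cr, dr]; exact hy _ (by omega)

theorem zp_shift (x y : Fin 4 → ℂ) (h : y 1 = x 1 + (y 0 - x 0) * x 2) : zp (big y) = zp (big x) + (y 0 - x 0) • zw (big x) := by
  funext i; fin_cases i <;> simp [big, h]
theorem zw_shift (x y : Fin 4 → ℂ) (h : x 2 = y 2) : zw (big y) = zw (big x) := by
  funext i; fin_cases i <;> simp [big, h]

theorem gen_IIb (hd : 5 ≤ d) : Gen (fun v : Ix d → ℂ => ∀ x y : Fin 4 → ℂ, x 3 = y 3 → x 2 = y 2 → y 1 = x 1 + (y 0 - x 0) * x 2 → HZ v x → HZ v y →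
    x 0 = y 0) := by
  let deg : Fin (4 + 2) → ℕ := Fin.append (fun e => e.val) (fun e => e.val)
  let cell : Fin (4 + 2) → (Fin 5 → ℂ) → Z := Fin.append (fun _ x => big ![x 0, x 1, x 2, x 4])
    (fun _ x => big ![x 3, x 1 + (x 3 - x 0) * x 2, x 2, x 4])
  refine (gen_two (d := d) (by norm_num) deg cell ?_).mono ?_
  · intro e i
    refine Fin.addCases (fun e => ?_) (fun e => ?_) e
    · simp only [cell, Fin.append_left]
      refine PF_big _ (fun l => ?_) i
      fin_cases l <;> exact PF.var _
    · simp only [cell, Fin.append_right]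
      refine PF_big _ (fun l => ?_) i
      fin_cases l
      · exact PF.var _
      · exact (PF.var _).add (((PF.var _).sub (PF.var _)).mul (PF.var _))
      · exact PF.var _
      · exact PF.var _
  intro v hv x y h3 h2 h1 hx hy
  by_contra hne
  have hne : y 0 - x 0 ≠ 0 := sub_ne_zero.2 (Ne.symm hne)
  have ex : (![x 0, x 1, x 2, x 3] : Fin 4 → ℂ) = x := by funext i; fin_cases i <;> rfl
  have ey : (![y 0, x 1 + (y 0 - x 0) * x 2, x 2, x 3] : Fin 4 → ℂ) = y := by
    funext i; fin_cases i
    · rfl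
    · exact h1.symm
    · exact h2
    · exact h3
  have cl : ∀ e : Fin 4, cell (Fin.castAdd 2 e) ![x 0, x 1, x 2, y 0, x 3] = big x := by
    intro e; simp only [cell, Fin.append_left]; exact congrArg big ex
  have cr : ∀ e : Fin 2, cell (Fin.natAdd 4 e) ![x 0, x 1, x 2, y 0, x 3] = big y := by
    intro e; simp only [cell, Fin.append_right]; exact congrArg big ey
  have dl : ∀ e : Fin 4, deg (Fin.castAdd 2 e) = e.val := fun e => by simp only [deg, Fin.append_left]
  have dr : ∀ e : Fin 2, deg (Fin.natAdd 4 e) = e.val := fun e => by simp only [deg, Fin.append_right]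
  refine hv ![x 0, x 1, x 2, y 0, x 3] ?_ ?_ ?_
  · intro e
    refine Fin.addCases (fun e => ?_) (fun e => ?_) e
    · rw [cl]; exact (inR_big x).2.2
    · rw [cr]; exact (inR_big y).2.2
  · intro e
    refine Fin.addCases (fun e => ?_) (fun e => ?_) e
    · obtain ⟨P, hP, hl⟩ := exists_form (d := d) (big_inX x).1 e.val (by omega)
      refine ⟨P, hP, fun e' => ?_, ?_⟩
      · refine Fin.addCases (fun e' => ?_) (fun e' => ?_) e' <;> intro he'
        · have : e'.val < e.val := he'
          rw [cl, dl, hl, Polynomial.coeff_X_pow, if_neg this.ne]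
        · exfalso
          have : 4 + e'.val < e.val := he'
          omega
      · rw [cl, dl, hl, Polynomial.coeff_X_pow_self]; exact one_ne_zero
    · obtain ⟨⟨P, hP, a1, a2⟩, ⟨P', hP', b1, b2⟩⟩ := exists_form3 (d := d) (big_inX x).1 (y 0 - x 0) hd
      have c0 : ((Polynomial.C (y 0 - x 0) + Polynomial.X) ^ 4).coeff 0 ≠ 0 := by
        rw [Polynomial.coeff_zero_eq_eval_zero]; simpa using hne
      fin_cases e
      · refine ⟨P, hP, fun e' => ?_, ?_⟩
        · refine Fin.addCases (fun e' => ?_) (fun e' => ?_) e' <;> intro he'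
          · rw [cl, dl, a1, Polynomial.coeff_X_pow, if_neg (by omega)]
          · exfalso
            have : 4 + e'.val < 4 + 0 := he'
            omega
        · rw [cr, dr, zp_shift x y h1, zw_shift x y h2, a2]; exact c0
      · refine ⟨P', hP', fun e' => ?_, ?_⟩
        · refine Fin.addCases (fun e' => ?_) (fun e' => ?_) e' <;> intro he'
          · rw [cl, dl, b1, low_coeff e'.2]
          · have : 4 + e'.val < 4 + 1 := he'
            have h0 : e'.val = 0 := by omega
            rw [cr, dr, h0, zp_shift x y h1, zw_shift x y h2, b2, Polynomial.coeff_X_mul_zero]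
        · rw [cr, dr, zp_shift x y h1, zw_shift x y h2, b2]
          show (_ : Polynomial ℂ).coeff (0 + 1) ≠ 0
          rw [Polynomial.coeff_X_mul]; exact c0
  · intro e
    refine Fin.addCases (fun e => ?_) (fun e => ?_) e
    · rw [cl, dl]; exact hx _ e.2
    · rw [cr, dr]; exact hy _ (by omega)

theorem four_case (v : Ix 4 → ℂ) (hfin : {x | HZ v x}.Finite) (x y : Fin 4 → ℂ) (h3 : x 3 = y 3) (h2 : x 2 = y 2)
    (h1 : y 1 = x 1 + (y 0 - x 0) * x 2) (hx : HZ v x) (hy : HZ v y) : x 0 = y 0 := by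
  by_contra hne
  have hne : y 0 - x 0 ≠ 0 := sub_ne_zero.2 (Ne.symm hne)
  have hc : zc (big y) = zc (big x) := by funext i; fin_cases i <;> simp [big, h3]
  set F := member v (zc (big x)) with hF
  have hF4 : F.IsHomogeneous 4 := member_hom v _
  set q := linePoly F (zp (big x)) (zw (big x)) with hq
  have q0 : ∀ i < 4, q.coeff i = 0 := hx
  have qd : q.natDegree ≤ 4 := linePoly_natDegree hF4 _ _
  have qe : q = Polynomial.C (q.coeff 4) * Polynomial.X ^ 4 := by
    ext i
    rw [Polynomial.coeff_C_mul_X_pow]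
    split_ifs with h
    · rw [h]
    · rcases lt_or_gt_of_ne h with h | h
      · exact q0 i h
      · exact Polynomial.coeff_eq_zero_of_natDegree_lt (by omega)
  have e0 : q.eval (y 0 - x 0) = 0 := by
    rw [hq, eval_linePoly, ← zp_shift x y h1]
    have := hy 0 (by norm_num)
    rw [ff, Polynomial.coeff_zero_eq_eval_zero, eval_linePoly, hc, zero_smul, add_zero] at this
    exact this
  have q4 : q.coeff 4 = 0 := by
    rw [qe] at e0
    simpa [hne] using e0
  have qz : q = 0 := by rw [qe, q4]; simp
  refine Set.infinite_of_injective_forall_mem (f := fun s : ℂ => (![x 0 + s, x 1 + s * x 2, x 2, x 3] : Fin 4 → ℂ)) ?_ ?_ hfin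
  · intro s s' h
    have := congrFun h 0
    simpa using this
  · intro s i hi
    have hc' : zc (big ![x 0 + s, x 1 + s * x 2, x 2, x 3]) = zc (big x) := by funext i; fin_cases i <;> simp [big]
    have hl : linePoly F (zp (big ![x 0 + s, x 1 + s * x 2, x 2, x 3])) (zw (big ![x 0 + s, x 1 + s * x 2, x 2, x 3])) = 0 := by
      refine Polynomial.funext fun t => ?_
      have ea : zp (big ![x 0 + s, x 1 + s * x 2, x 2, x 3]) + t • zw (big ![x 0 + s, x 1 + s * x 2, x 2, x 3]) =
          zp (big x) + (s + t) • zw (big x) := by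
        funext i; fin_cases i <;> simp [big] <;> ring
      rw [eval_linePoly, ea, ← eval_linePoly, ← hq, qz]; simp
    rw [ff, hc', ← hF, hl]; simp

theorem HZ_iff (v : Ix d → ℂ) (x) : HZ v x ↔ x ∈ zset (Sys 4 ![0, 0, 0, 0] v) := by
  constructor
  · intro h e; rw [sys_lt e.2]; exact h _ e.2
  · intro h i hi
    have := h ⟨i, hi⟩
    rwa [sys_lt (show (⟨i, hi⟩ : Fin 4).val < 4 from hi)] at this

theorem gen_inj (hd : 3 ≤ d) : Gen (fun v : Ix d → ℂ => Good (Sys 4 ![0, 0, 0, 0] v) ∧ ∀ x y : Fin 4 → ℂ, x 3 = y 3 → HZ v x → HZ v y → x = y) := by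
  have hg := gen_Sys hd 4 ![0, 0, 0, 0]
  rcases hd.eq_or_lt with rfl | hd4
  · refine hg.mono fun v hv => ⟨hv, fun x y _ hx _ => ?_⟩
    have := main_count hd v hv
    norm_num at this
    have hf := (Sys_reg hd 4 ![0, 0, 0, 0]).finite hv
    rw [cnt, Set.ncard_eq_zero hf] at this
    rw [HZ_iff, this] at hx
    exact absurd hx (Set.notMem_empty _)
  have hb : Gen (fun v : Ix d → ℂ => Good (Sys 4 ![0, 0, 0, 0] v) → ∀ x y : Fin 4 → ℂ, x 3 = y 3 → x 2 = y 2 → y 1 = x 1 + (y 0 - x 0) * x 2 → HZ v x → HZ v y →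
    x 0 = y 0) := by
    rcases (show 4 ≤ d from hd4).eq_or_lt with rfl | hd5
    · refine Gen.true fun v hv => four_case v ?_
      have hf := (Sys_reg hd 4 ![0, 0, 0, 0]).finite hv
      refine hf.subset fun x hx => (HZ_iff v x).1 hx
    · exact (gen_IIb hd5).mono fun v hv _ => hv
  refine (hg.and ((gen_I hd4).and ((gen_IIa hd4).and hb))).mono fun v hv => ⟨hv.1, fun x y h3 hx hy => ?_⟩
  obtain ⟨hG, hI, hA, hB⟩ := hv
  have i1 := hI x y h3 hx hy
  have i2 := hI y x h3.symm hy hx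
  rw [zl_big] at i1 i2
  simp [dotp, Fin.sum_univ_three, big] at i1 i2
  have hp : (x 2 - y 2) * (y 0 - x 0) = 0 := by linear_combination -i1 - i2
  have key : x 0 = y 0 ∧ x 1 = y 1 ∧ x 2 = y 2 := by
    rcases mul_eq_zero.1 hp with h | h
    · have h2 : x 2 = y 2 := sub_eq_zero.1 h
      have h0 := hB hG x y h3 h2 (by linear_combination i1) hx hy
      exact ⟨h0, by rw [h0] at i1; linear_combination -i1, h2⟩
    · have h0 : x 0 = y 0 := (sub_eq_zero.1 h).symm
      have h1 : x 1 = y 1 := by rw [h0] at i1; linear_combination -i1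
      exact ⟨h0, h1, hA x y h3 h0 h1 hx hy⟩
  funext i; fin_cases i
  · exact key.1
  · exact key.2.1
  · exact key.2.2
  · exact h3

end HF

namespace HF
open MvPolynomial
variable {d : ℕ}

theorem li_iff (p w : Fin 3 → ℂ) : LinearIndependent ℂ ![p, w] ↔ crs p w ≠ 0 := by
  rw [← crossProduct_ne_zero_iff_linearIndependent]
  rw [cross_apply]; rfl

theorem coeff_form (v : Ix d → ℂ) (r : Fin 2) (m : Mon d) : coeff m.1 (form v r) = v (Sum.inl (r, m)) := by
  unfold form
  rw [coeff_sum, Finset.sum_eq_single m]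
  · simp
  · intro b _ hb
    rw [coeff_monomial, if_neg]
    exact fun h => hb (Subtype.ext h)
  · simp

def mvec (v₀ : Ix d → ℂ) (F G : MvPolynomial (Fin 3) ℂ) : Ix d → ℂ :=
  Sum.elim (fun q => if q.1 = 0 then coeff q.2.1 F else coeff q.2.1 G) (fun i => v₀ (Sum.inr i))

theorem form_mvec0 (v₀ : Ix d → ℂ) {F : MvPolynomial (Fin 3) ℂ} (hF : F.IsHomogeneous d) (G) :
    form (mvec v₀ F G) 0 = F := by
  conv_rhs => rw [hom_eq_sum hF]
  simp [form, mvec]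

theorem form_mvec1 (v₀ : Ix d → ℂ) (F) {G : MvPolynomial (Fin 3) ℂ} (hG : G.IsHomogeneous d) :
    form (mvec v₀ F G) 1 = G := by
  conv_rhs => rw [hom_eq_sum hG]
  simp [form, mvec]

theorem mvec_form (v : Ix d → ℂ) : mvec v (form v 0) (form v 1) = v := by
  funext i
  rcases i with ⟨r, m⟩ | i
  · fin_cases r <;> simp [mvec, coeff_form]
  · rfl

def subQ (v₀ : Ix d → ℂ) : Ix d → MvPolynomial ((Fin 3 →₀ ℕ) ⊕ (Fin 3 →₀ ℕ)) ℂ :=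
  Sum.elim (fun q => X (if q.1 = 0 then Sum.inl q.2.1 else Sum.inr q.2.1)) (fun i => C (v₀ (Sum.inr i)))

theorem eval_subQ (v₀ : Ix d → ℂ) (F G) (Q : MvPolynomial (Ix d) ℂ) :
    eval (coeffs2 F G) (aeval (subQ v₀) Q) = eval (mvec v₀ F G) Q := by
  induction Q using MvPolynomial.induction_on with
  | C a => simp
  | add p q hp hq => rw [map_add, map_add, map_add, hp, hq]
  | mul_X p i hp =>
    rw [map_mul, map_mul, map_mul, hp, aeval_X, eval_X]
    congr 1
    rcases i with ⟨r, m⟩ | i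
    · fin_cases r <;> simp [subQ, mvec, coeffs2]
    · simp [subQ, mvec]

def mono0 (d : ℕ) (i : Fin 3) : Mon d := ⟨Finsupp.single i d, mem_Mon (by
  rw [← Finsupp.degree_eq_sum, Finsupp.degree_single])⟩

theorem mono0_ne (hd : 3 ≤ d) : mono0 d 0 ≠ mono0 d 1 := by
  intro h
  have := congrArg (fun m : Mon d => m.1 0) h
  simp [mono0] at this
  omega

theorem gen_minor (hd : 3 ≤ d) : Gen (fun v : Ix d → ℂ =>
    v (Sum.inl (0, mono0 d 0)) * v (Sum.inl (1, mono0 d 1)) - v (Sum.inl (0, mono0 d 1)) * v (Sum.inl (1, mono0 d 0)) ≠ 0) := by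
  classical
  refine ⟨X (Sum.inl (0, mono0 d 0)) * X (Sum.inl (1, mono0 d 1)) - X (Sum.inl (0, mono0 d 1)) * X (Sum.inl (1, mono0 d 0)), ?_, ?_⟩
  · intro h
    have := congrArg (eval (fun i : Ix d => if i = Sum.inl (0, mono0 d 0) ∨ i = Sum.inl (1, mono0 d 1) then (1 : ℂ) else 0)) h
    simp [mono0_ne hd, (mono0_ne hd).symm] at this
  · intro v hv
    simpa using hv

theorem li_form (v : Ix d → ℂ)
    (h : v (Sum.inl (0, mono0 d 0)) * v (Sum.inl (1, mono0 d 1)) - v (Sum.inl (0, mono0 d 1)) * v (Sum.inl (1, mono0 d 0)) ≠ 0) :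
    LinearIndependent ℂ ![form v 0, form v 1] := by
  rw [LinearIndependent.pair_iff]
  intro s t hst
  have h0 := congrArg (coeff (mono0 d 0).1) hst
  have h1 := congrArg (coeff (mono0 d 1).1) hst
  simp only [coeff_add, coeff_smul, coeff_form, smul_eq_mul, coeff_zero] at h0 h1
  constructor
  · refine (mul_eq_zero.1 (?_ : s * _ = 0)).resolve_right h
    linear_combination v (Sum.inl (1, mono0 d 1)) * h0 - v (Sum.inl (1, mono0 d 0)) * h1
  · refine (mul_eq_zero.1 (?_ : t * _ = 0)).resolve_right h
    linear_combination v (Sum.inl (0, mono0 d 0)) * h1 - v (Sum.inl (0, mono0 d 1)) * h0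

theorem one_ne (a : ℂ) : (![1, a] : Fin 2 → ℂ) ≠ 0 := fun h => by simpa using congrFun h 0

def phi (x : Fin 4 → ℂ) : Projectivization ℂ (Fin 2 → ℂ) := Projectivization.mk ℂ ![1, x 3] (one_ne _)

theorem phi_inj {x y : Fin 4 → ℂ} (h : phi x = phi y) : x 3 = y 3 := by
  rw [phi, phi, Projectivization.mk_eq_mk_iff'] at h
  obtain ⟨a, ha⟩ := h
  have h0 := congrFun ha 0
  have h1 := congrFun ha 1
  simp at h0 h1
  rw [← h1, h0, one_mul]

theorem hyper_iff (v : Ix d → ℂ) (c : Projectivization ℂ (Fin 2 → ℂ)) (p w : Fin 3 → ℂ) :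
    ContactLE (pencilMember (form v 0) (form v 1) c) p w 4 ↔ ∀ e, Sys 4 ![0, 0, 0, 0] v e (mkZ p w c.rep) = 0 := by
  rw [ContactLE, Polynomial.X_pow_dvd_iff]
  constructor
  · intro h e; rw [sys_lt e.2]; exact h _ e.2
  · intro h i hi
    have := h ⟨i, hi⟩
    rwa [sys_lt (show (⟨i, hi⟩ : Fin 4).val < 4 from hi)] at this

theorem hyper_eq (hd : 3 ≤ d) (v : Ix d → ℂ) (hg : Good (Sys 4 ![0, 0, 0, 0] v)) :
    hyperflexMembers (form v 0) (form v 1) = Set.image phi (zset (Sys 4 ![0, 0, 0, 0] v)) := by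
  have hinv := (Sys_reg hd 4 ![0, 0, 0, 0]).inv v
  ext c
  constructor
  · rintro ⟨p, w, hl, hc⟩
    rw [hyper_iff] at hc
    rw [li_iff] at hl
    have hX : InX (mkZ p w c.rep) := ⟨hl, c.rep_nonzero⟩
    have hR := hg.inR _ hX hc
    refine ⟨coord (mkZ p w c.rep), hinv _ _ hR.rel_big hc, ?_⟩
    have h0 : c.rep 0 ≠ 0 := hR.2.2
    conv_rhs => rw [← c.mk_rep]
    rw [phi, Projectivization.mk_eq_mk_iff']
    refine ⟨(c.rep 0)⁻¹, ?_⟩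
    have h3 : coord (mkZ p w c.rep) 3 = c.rep 1 / c.rep 0 := rfl
    rw [h3]
    funext i; fin_cases i
    · simp [h0]
    · simp; field_simp
  · rintro ⟨x, hx, rfl⟩
    refine ⟨![1, x 0, x 1], ![0, 1, x 2], (li_iff _ _).2 (big_inX x).1, ?_⟩
    rw [hyper_iff]
    obtain ⟨a, ha⟩ := Projectivization.exists_smul_eq_mk_rep ℂ ![1, x 3] (one_ne _)
    refine hinv (big x) _ ⟨1, 1, 0, a, one_ne_zero, one_ne_zero, a.ne_zero, ?_⟩ hx
    rw [phi, ← ha]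
    simp [big, Units.smul_def]

theorem main (hd : 3 ≤ d) :
    ∃ Q : MvPolynomial ((Fin 3 →₀ ℕ) ⊕ (Fin 3 →₀ ℕ)) ℂ,
      (∃ F G : MvPolynomial (Fin 3) ℂ, F.IsHomogeneous d ∧ G.IsHomogeneous d ∧
          LinearIndependent ℂ ![F, G] ∧ MvPolynomial.eval (coeffs2 F G) Q ≠ 0) ∧
      ∀ F G : MvPolynomial (Fin 3) ℂ, F.IsHomogeneous d → G.IsHomogeneous d →
        LinearIndependent ℂ ![F, G] → MvPolynomial.eval (coeffs2 F G) Q ≠ 0 →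
          (hyperflexMembers F G).Finite ∧
            ((hyperflexMembers F G).ncard : ℤ) = 6 * ((d : ℤ) - 3) * (3 * (d : ℤ) - 2) := by
  obtain ⟨Q, hQ, hP⟩ := (gen_inj hd).and (gen_minor hd)
  obtain ⟨v₀, h₀⟩ := Gen.exists (P := fun v => eval v Q ≠ 0) ⟨Q, hQ, fun v h => h⟩
  refine ⟨aeval (subQ v₀) Q, ⟨form v₀ 0, form v₀ 1, form_hom _ _, form_hom _ _, li_form _ (hP _ h₀).2, ?_⟩, ?_⟩
  · rw [eval_subQ, mvec_form]; exact h₀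
  · intro F G hF hG _ hev
    rw [eval_subQ] at hev
    obtain ⟨⟨hg, hinj⟩, -⟩ := hP _ hev
    have he := hyper_eq hd _ hg
    rw [form_mvec0 v₀ hF, form_mvec1 v₀ F hG] at he
    rw [he]
    refine ⟨((Sys_reg hd 4 _).finite hg).image _, ?_⟩
    rw [Set.ncard_image_of_injOn]
    · exact main_count hd _ hg
    · intro x hx y hy hxy
      exact hinj x y (phi_inj hxy) ((HZ_iff _ _).2 hx) ((HZ_iff _ _).2 hy)

end HF

/-- For a general pencil of degree-`d` plane curves, the number of members admitting a
hyperflex line is `6(d-3)(3d-2)`. Genericity is expressed by the nonvanishing of a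
polynomial `Q` in the coefficients of the two spanning forms whose nonvanishing locus
meets the parameter space (hence is a dense Zariski-open subset of it). -/
theorem hyperflex_count (d : ℕ) (hd : 3 ≤ d) :
    ∃ Q : MvPolynomial ((Fin 3 →₀ ℕ) ⊕ (Fin 3 →₀ ℕ)) ℂ,
      (∃ F G : MvPolynomial (Fin 3) ℂ, F.IsHomogeneous d ∧ G.IsHomogeneous d ∧
          LinearIndependent ℂ ![F, G] ∧ MvPolynomial.eval (coeffs2 F G) Q ≠ 0) ∧
      ∀ F G : MvPolynomial (Fin 3) ℂ, F.IsHomogeneous d → G.IsHomogeneous d →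
        LinearIndependent ℂ ![F, G] → MvPolynomial.eval (coeffs2 F G) Q ≠ 0 →
          (hyperflexMembers F G).Finite ∧
            ((hyperflexMembers F G).ncard : ℤ) = 6 * ((d : ℤ) - 3) * (3 * (d : ℤ) - 2) := by
  exact HF.main hd
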